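/- (Type II estimate on average.) Let σ > 2ϖ be a real number with 19σ + 90ϖ + 71ε < 1. For every C > 0 there exist η > 0, X₀ ≥ 2 and C' > 0 such that for all X ≥ X₀ the following holds: for all reals U, V with U·V = X and X^(1/2 − σ) ≤ U ≤ X^(1/2 − 2ϖ − ε), and all sequences of complex numbers (a_u), (b_v) satisfying |a_u| ≤ τ(u)^C and |b_v| ≤ τ(v)^C for all u, v, one has Σ_{d ∈ 𝔇(X)} | Σ_{U < u ≤ 2U, V < v ≤ 2V, uv ≡ a (mod d²)} a_u b_v ψ(uv/X) − (1/φ(d²)) · Σ_{U < u ≤ 2U, V < v ≤ 2V, gcd(uv, d²) = 1} a_u b_v ψ(uv/X) | ≤ C' · D^(−1/2) · X^(1−η). -/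

import Mathlib

open scoped Classical

noncomputable section

/-- `ϖ = 1/1400`. -/
def varpi : ℝ := 1 / 1400

/-- `K = ⌈1/ε⌉`. -/
def bigK (ε : ℝ) : ℕ := ⌈1 / ε⌉₊

/-- `D = X^(1/2 + 2ϖ)`. -/
def bigD (X : ℝ) : ℝ := X ^ ((1 : ℝ) / 2 + 2 * varpi)

/-- `P = D^(1/K)`. -/
def bigP (ε X : ℝ) : ℝ := bigD X ^ ((1 : ℝ) / (bigK ε : ℝ))

/-- The set `𝔇(X)` of squarefree integers `d = p₁ p₂ ⋯ p_K` where `p_j` is a prime in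
`I_j = (2^(j-1) P^(1/2), 2^j P^(1/2)]` for each `j = 1, …, K` (here indexed by `j = 0, …, K-1`). -/
def frakD (ε X : ℝ) : Set ℕ :=
  {d | ∃ p : Fin (bigK ε) → ℕ,
    (∀ j, (p j).Prime ∧
      (2 : ℝ) ^ (j : ℕ) * bigP ε X ^ ((1 : ℝ) / 2) < (p j : ℝ) ∧
      (p j : ℝ) ≤ (2 : ℝ) ^ ((j : ℕ) + 1) * bigP ε X ^ ((1 : ℝ) / 2)) ∧
    d = ∏ j, p j}

/-- `P(z)`: the product of all primes `p < z`. -/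
def primeProd (z : ℝ) : ℕ := ∏ p ∈ Finset.filter Nat.Prime (Finset.range ⌈z⌉₊), p

/-- `S(𝒜_u^d, z) = Σ_{n ≥ 1, u ∣ n, n ≡ a (mod d²), (n, P(z)) = 1} ψ(n/X)`. -/
def SA (a : ℤ) (ψ : ℝ → ℝ) (X : ℝ) (d u : ℕ) (z : ℝ) : ℝ :=
  ∑' n : ℕ, if 1 ≤ n ∧ u ∣ n ∧ ((d : ℤ) ^ 2 ∣ (n : ℤ) - a) ∧ Nat.gcd n (primeProd z) = 1
    then ψ ((n : ℝ) / X) else 0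

/-- `S(ℬ_u^d, z) = (1/φ(d²)) Σ_{n ≥ 1, u ∣ n, (n, d²) = 1, (n, P(z)) = 1} ψ(n/X)`. -/
def SB (ψ : ℝ → ℝ) (X : ℝ) (d u : ℕ) (z : ℝ) : ℝ :=
  (1 / (Nat.totient (d ^ 2) : ℝ)) *
    ∑' n : ℕ, if 1 ≤ n ∧ u ∣ n ∧ Nat.gcd n (d ^ 2) = 1 ∧ Nat.gcd n (primeProd z) = 1
      then ψ ((n : ℝ) / X) else 0

section

/-! ### Divisor bound -/

lemma tt_local (δ : ℝ) (hδ : 0 < δ) (p : ℕ) (hp : p.Prime) (k : ℕ) :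
    ((k : ℝ) + 1) ≤ (if (p : ℝ) < (2 : ℝ) ^ (1 / δ) then 1 + 1 / (δ * Real.log 2) else 1) *
      ((p : ℝ) ^ δ) ^ k := by
  have hp2 : (2 : ℝ) ≤ p := by exact_mod_cast hp.two_le
  have hl2 : 0 < Real.log 2 := Real.log_pos (by norm_num)
  split_ifs with h
  · have h1 : 1 + δ * Real.log 2 ≤ (p : ℝ) ^ δ := by
      calc 1 + δ * Real.log 2 = Real.log 2 * δ + 1 := by ring
        _ ≤ Real.exp (Real.log 2 * δ) := Real.add_one_le_exp _
        _ = (2 : ℝ) ^ δ := by rw [Real.rpow_def_of_pos (by norm_num)]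
        _ ≤ (p : ℝ) ^ δ := Real.rpow_le_rpow (by norm_num) hp2 hδ.le
    have h2 : 1 + (k : ℝ) * (δ * Real.log 2) ≤ ((p : ℝ) ^ δ) ^ k := by
      calc 1 + (k : ℝ) * (δ * Real.log 2) ≤ (1 + δ * Real.log 2) ^ k :=
            one_add_mul_le_pow (by nlinarith [mul_pos hδ hl2]) k
        _ ≤ _ := pow_le_pow_left₀ (by positivity) h1 k
    have hx : 0 < δ * Real.log 2 := mul_pos hδ hl2
    set x := δ * Real.log 2 with hxdef
    calc (k : ℝ) + 1 ≤ (1 + 1 / x) * (1 + k * x) := by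
          have : (1 + 1 / x) * (1 + k * x) = 1 + k + k * x + 1 / x := by field_simp; ring
          rw [this]
          have : 0 ≤ (k : ℝ) * x + 1 / x := by positivity
          linarith
      _ ≤ _ := by gcongr
  · push Not at h
    have h1 : (2 : ℝ) ≤ (p : ℝ) ^ δ := by
      calc (2 : ℝ) = ((2 : ℝ) ^ (1 / δ)) ^ δ := by
            rw [← Real.rpow_mul (by norm_num)]; simp [hδ.ne']
        _ ≤ _ := Real.rpow_le_rpow (by positivity) h hδ.le
    rw [one_mul]
    calc (k : ℝ) + 1 ≤ (2 : ℝ) ^ k := by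
          have : k + 1 ≤ 2 ^ k := Nat.lt_two_pow_self
          exact_mod_cast this
      _ ≤ _ := pow_le_pow_left₀ (by norm_num) h1 k

lemma tau_bound (δ : ℝ) (hδ : 0 < δ) :
    ∃ C : ℝ, 1 ≤ C ∧ ∀ n : ℕ, n ≠ 0 → (n.divisors.card : ℝ) ≤ C * (n : ℝ) ^ δ := by
  set B : ℝ := 1 + 1 / (δ * Real.log 2)
  have hl2 : 0 < Real.log 2 := Real.log_pos (by norm_num)
  have hB : 1 ≤ B := by
    have : 0 ≤ 1 / (δ * Real.log 2) := by positivity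
    simp only [B]; linarith
  set M : ℕ := ⌈(2 : ℝ) ^ (1 / δ)⌉₊
  refine ⟨B ^ M, one_le_pow₀ hB, fun n hn => ?_⟩
  rw [Nat.card_divisors hn]
  push_cast
  have hn2 : (n : ℝ) ^ δ = ∏ p ∈ n.primeFactors, ((p : ℝ) ^ δ) ^ (n.factorization p) := by
    conv_lhs => rw [← Nat.prod_factorization_pow_eq_self hn]
    rw [Finsupp.prod, Nat.support_factorization]
    push_cast
    rw [← Real.finsetProd_rpow _ _ (fun i _ => by positivity)]
    refine Finset.prod_congr rfl fun p _ => ?_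
    rw [← Real.rpow_natCast, ← Real.rpow_natCast, ← Real.rpow_mul (by positivity),
      ← Real.rpow_mul (by positivity), mul_comm]
  rw [hn2]
  calc ∏ p ∈ n.primeFactors, ((n.factorization p : ℝ) + 1)
      ≤ ∏ p ∈ n.primeFactors, ((if (p : ℝ) < (2 : ℝ) ^ (1 / δ) then B else 1) *
        ((p : ℝ) ^ δ) ^ (n.factorization p)) := by
        refine Finset.prod_le_prod (fun _ _ => by positivity) fun p hp => ?_
        exact tt_local δ hδ p (Nat.prime_of_mem_primeFactors hp) _
    _ = (∏ p ∈ n.primeFactors, (if (p : ℝ) < (2 : ℝ) ^ (1 / δ) then B else 1)) *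
        ∏ p ∈ n.primeFactors, ((p : ℝ) ^ δ) ^ (n.factorization p) := Finset.prod_mul_distrib
    _ ≤ _ := by
        gcongr
        rw [Finset.prod_ite]
        simp only [Finset.prod_const, one_pow, mul_one]
        refine pow_le_pow_right₀ hB ?_
        calc _ ≤ (Finset.range M).card := by
              refine Finset.card_le_card fun p hp => ?_
              rw [Finset.mem_filter] at hp
              rw [Finset.mem_range]
              exact Nat.lt_ceil.2 hp.2
          _ = M := by simp

/-! ### The additive character -/

def ee (x : ℝ) : ℂ := Complex.exp ((2 * Real.pi * x : ℝ) * Complex.I)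

lemma ee_add (x y : ℝ) : ee (x + y) = ee x * ee y := by
  unfold ee; rw [← Complex.exp_add]; push_cast; ring_nf

lemma ee_zero : ee 0 = 1 := by simp [ee]

lemma ee_norm (x : ℝ) : ‖ee x‖ = 1 := by
  unfold ee; exact Complex.norm_exp_ofReal_mul_I _

lemma ee_int (n : ℤ) : ee (n : ℝ) = 1 := by
  unfold ee
  rw [Complex.exp_eq_one_iff]
  exact ⟨n, by push_cast; ring⟩

lemma ee_neg (x : ℝ) : ee (-x) = (starRingEnd ℂ) (ee x) := by
  unfold ee
  rw [← Complex.exp_conj]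
  congr 1
  rw [map_mul, Complex.conj_ofReal, Complex.conj_I]
  push_cast
  ring

lemma ee_mul_conj (x : ℝ) : ee x * (starRingEnd ℂ) (ee x) = 1 := by
  rw [← ee_neg, ← ee_add]; simp [ee_zero]

lemma ee_sub (x y : ℝ) : ee (x - y) = ee x * (starRingEnd ℂ) (ee y) := by
  rw [sub_eq_add_neg, ee_add, ee_neg]

lemma ee_nat_mul (x : ℝ) (n : ℕ) : ee (n * x) = ee x ^ n := by
  unfold ee; rw [← Complex.exp_nat_mul]; push_cast; ring_nf

lemma ee_add_int (x : ℝ) (n : ℤ) : ee (x + n) = ee x := by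
  rw [ee_add, ee_int, mul_one]

lemma ee_congr {q : ℕ} (hq : 0 < q) {x y : ℤ} (h : x ≡ y [ZMOD q]) :
    ee ((x : ℝ) / q) = ee ((y : ℝ) / q) := by
  obtain ⟨k, hk⟩ := h.dvd
  have : (y : ℝ) / q = (x : ℝ) / q + (k : ℤ) := by
    have : (y : ℝ) = x + q * k := by
      have : y = x + q * k := by linarith
      rw [this]; push_cast; ring
    rw [this]; field_simp
  rw [this, ee_add_int]

/-- `|1 - e(x)| ≥ 4 min(x, 1-x)` for `x ∈ [0,1]`. -/
lemma ee_sub_one_lower (x : ℝ) (h0 : 0 ≤ x) (h1 : x ≤ 1) : 4 * min x (1 - x) ≤ ‖ee x - 1‖ := by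
  have key : ‖ee x - 1‖ = 2 * Real.sin (Real.pi * x) := by
    have h2 : ee x - 1 = ee (x/2) * (2 * Real.sin (Real.pi * x) * Complex.I) := by
      have e1 : ee x = ee (x/2) * ee (x/2) := by rw [← ee_add]; ring_nf
      have e2 : (1 : ℂ) = ee (x/2) * ee (-(x/2)) := by rw [← ee_add]; simp [ee_zero]
      have e3 : (2 * Real.sin (Real.pi * x) * Complex.I : ℂ) = ee (x/2) - ee (-(x/2)) := by
        unfold ee
        rw [Complex.exp_mul_I, Complex.exp_mul_I]
        have : ((2 * Real.pi * (x / 2) : ℝ)) = Real.pi * x := by ring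
        rw [this]
        have : ((2 * Real.pi * -(x / 2) : ℝ)) = -(Real.pi * x) := by ring
        rw [this]
        push_cast
        rw [Complex.cos_neg, Complex.sin_neg]
        ring
      rw [e3, mul_sub, ← e2, ← e1]
    rw [h2, norm_mul, ee_norm, one_mul]
    have hs : 0 ≤ Real.sin (Real.pi * x) :=
      Real.sin_nonneg_of_nonneg_of_le_pi (by positivity) (by nlinarith [Real.pi_pos])
    rw [norm_mul, norm_mul, Complex.norm_I, mul_one, Complex.norm_real, Real.norm_of_nonneg hs]
    simp
  rw [key]
  rcases le_total x (1/2) with h | h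
  · have := Real.mul_le_sin (x := Real.pi * x) (by positivity) (by nlinarith [Real.pi_pos])
    have e : 2 / Real.pi * (Real.pi * x) = 2 * x := by field_simp
    rw [e] at this
    have := min_le_left x (1-x)
    linarith
  · have := Real.mul_le_sin (x := Real.pi * (1 - x)) (by apply mul_nonneg Real.pi_pos.le; linarith)
      (by nlinarith [Real.pi_pos])
    have e : 2 / Real.pi * (Real.pi * (1 - x)) = 2 * (1 - x) := by field_simp
    rw [e] at this
    have e2 : Real.sin (Real.pi * (1 - x)) = Real.sin (Real.pi * x) := by
      rw [mul_sub, mul_one, Real.sin_pi_sub]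
    rw [e2] at this
    have := min_le_right x (1-x)
    linarith

/-- geometric sum bound over an integer interval, frequency `ν/g`. -/
lemma geom_bound (g : ℕ) (n : ℕ) (hn0 : 0 < n) (hng : n < g) (ν : ℤ)
    (hν : ν ≡ n [ZMOD g]) (α β : ℤ) :
    ‖∑ y ∈ Finset.Ico α β, ee ((ν : ℝ) * y / g)‖ ≤ (g : ℝ) / n + (g : ℝ) / (g - n : ℕ) := by
  have hg : 0 < g := by omega
  set θ : ℝ := (n : ℝ) / g
  have hgR : (0 : ℝ) < g := by exact_mod_cast hg
  have hnR : (0 : ℝ) < n := by exact_mod_cast hn0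
  have hngR : (n : ℝ) < g := by exact_mod_cast hng
  have hterm : ∀ y : ℤ, ee ((ν : ℝ) * y / g) = ee (θ * y) := by
    intro y
    have := ee_congr hg (hν.mul_right y)
    push_cast at this
    rw [this]; simp only [θ]; congr 1; ring
  simp_rw [hterm]
  have hsum : (∑ y ∈ Finset.Ico α β, ee (θ * y)) * (ee θ - 1) =
      if α ≤ β then ee (θ * β) - ee (θ * α) else 0 := by
    split_ifs with h
    · obtain ⟨k, rfl⟩ := Int.le.dest h
      induction k with
      | zero => simp
      | succ k ih =>
        have : Finset.Ico α (α + (k + 1 : ℕ)) = insert (α + k) (Finset.Ico α (α + k)) := by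
          ext z; simp; omega
        rw [this, Finset.sum_insert (by simp), add_mul, ih (by omega)]
        have : θ * ((α + ((k + 1 : ℕ) : ℤ) : ℤ) : ℝ) = θ * ((α + (k : ℤ) : ℤ) : ℝ) + θ := by
          push_cast; ring
        rw [this, ee_add]; ring
    · rw [Finset.Ico_eq_empty (by omega)]; simp
  have h1 : ‖∑ y ∈ Finset.Ico α β, ee (θ * y)‖ * ‖ee θ - 1‖ ≤ 2 := by
    rw [← norm_mul, hsum]
    split_ifs
    · refine (norm_sub_le _ _).trans ?_
      rw [ee_norm, ee_norm]; norm_num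
    · simp
  have hθ1 : θ ≤ 1 := by simp only [θ]; rw [div_le_one hgR]; exact hngR.le
  have h2 := ee_sub_one_lower θ (by positivity) hθ1
  have hc : ((g - n : ℕ) : ℝ) = g - n := by push_cast [hng.le]; ring
  rw [hc]
  have hmin : 0 < min θ (1 - θ) := by
    apply lt_min
    · positivity
    · simp only [θ]; rw [sub_pos, div_lt_one hgR]; exact hngR
  have h3 : ‖∑ y ∈ Finset.Ico α β, ee (θ * y)‖ ≤ 1 / min θ (1 - θ) := by
    rw [le_div_iff₀ hmin]
    nlinarith [norm_nonneg (∑ y ∈ Finset.Ico α β, ee (θ * y))]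
  refine h3.trans ?_
  have hd : 0 < (g : ℝ) - n := by linarith
  rcases min_cases θ (1 - θ) with ⟨h, _⟩ | ⟨h, _⟩
  · rw [h]
    have : 1 / θ = (g : ℝ) / n := by simp only [θ]; field_simp
    rw [this]
    have : 0 ≤ (g : ℝ) / (g - n) := by positivity
    linarith
  · rw [h]
    have : 1 / (1 - θ) = (g : ℝ) / (g - n) := by simp only [θ]; field_simp
    rw [this]
    have : 0 ≤ (g : ℝ) / n := by positivity
    linarith

end

section

/-! ### Root counting -/

def Nf (f : Polynomial ℤ) (g : ℕ) : ℕ :=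
  ((Finset.range g).filter (fun x : ℕ => (g : ℤ) ∣ f.eval (x : ℤ))).card

lemma dvd_eval_congr (f : Polynomial ℤ) (m : ℤ) {x y : ℤ} (h : x ≡ y [ZMOD m]) :
    m ∣ f.eval x ↔ m ∣ f.eval y := by
  have h1 : m ∣ f.eval y - f.eval x := h.dvd.trans (Polynomial.sub_dvd_eval_sub y x f)
  constructor
  · intro h2; have := dvd_add h1 h2; simpa using this
  · intro h2; have := dvd_sub h2 h1; simpa using this

lemma Nf_mul (f : Polynomial ℤ) {m n : ℕ} (hm : 0 < m) (hn : 0 < n) (h : m.Coprime n) :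
    Nf f (m * n) ≤ Nf f m * Nf f n := by
  unfold Nf
  rw [← Finset.card_product]
  refine Finset.card_le_card_of_injOn (fun x => (x % m, x % n)) ?_ ?_
  · intro x hx
    simp only [Finset.coe_filter, Set.mem_ofPred_eq, Finset.mem_range] at hx
    simp only [Finset.coe_product, Finset.coe_filter, Set.mem_prod, Set.mem_ofPred_eq,
      Finset.mem_range]
    have h1 : ((x % m : ℕ) : ℤ) ≡ x [ZMOD m] := by push_cast; exact Int.mod_modEq _ _
    have h2 : ((x % n : ℕ) : ℤ) ≡ x [ZMOD n] := by push_cast; exact Int.mod_modEq _ _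
    refine ⟨⟨Nat.mod_lt _ hm, ?_⟩, ⟨Nat.mod_lt _ hn, ?_⟩⟩
    · rw [dvd_eval_congr f m h1]
      exact (Dvd.intro _ (by push_cast; rfl)).trans hx.2
    · rw [dvd_eval_congr f n h2]
      exact (Dvd.intro_left _ (by push_cast; rfl)).trans hx.2
  · intro x hx y hy hxy
    simp only [Finset.coe_filter, Set.mem_ofPred_eq, Finset.mem_range] at hx hy
    simp only [Prod.mk.injEq] at hxy
    have : x ≡ y [MOD m * n] := (Nat.modEq_and_modEq_iff_modEq_mul h).1 ⟨hxy.1, hxy.2⟩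
    exact Nat.ModEq.eq_of_lt_of_lt this hx.1 hy.1

lemma Nf_prod (f : Polynomial ℤ) (s : Finset ℕ) (hs : ∀ p ∈ s, p.Prime) :
    Nf f (∏ p ∈ s, p) ≤ ∏ p ∈ s, Nf f p := by
  induction s using Finset.induction_on with
  | empty => simp [Nf]
  | insert q s hq ih =>
    rw [Finset.prod_insert hq, Finset.prod_insert hq]
    have hs' : ∀ p ∈ s, p.Prime := fun p hp => hs p (Finset.mem_insert_of_mem hp)
    have hqp : q.Prime := hs q (Finset.mem_insert_self _ _)
    refine (Nf_mul f hqp.pos (Finset.prod_pos fun p hp => (hs' p hp).pos) ?_).trans ?_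
    · refine Nat.Coprime.prod_right fun p hp => ?_
      exact (Nat.coprime_primes hqp (hs' p hp)).2 (fun h => hq (h ▸ hp))
    · exact Nat.mul_le_mul_left _ (ih hs')

def rpoly (n A b : ℤ) : Polynomial ℤ :=
  Polynomial.C n * Polynomial.X ^ 2 * (Polynomial.X + Polynomial.C b) ^ 2 +
    Polynomial.C (A * b) * (Polynomial.C 2 * Polynomial.X + Polynomial.C b)

lemma rpoly_eval (n A b x : ℤ) :
    (rpoly n A b).eval x = n * x ^ 2 * (x + b) ^ 2 + A * b * (2 * x + b) := by
  simp [rpoly]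

lemma Nf_rpoly_prime (n A b : ℤ) (p : ℕ) (hp : p.Prime) (h2 : p ≠ 2) (hA : ¬ (p : ℤ) ∣ b * A) :
    Nf (rpoly n A b) p ≤ 4 := by
  have : Fact p.Prime := ⟨hp⟩
  set F : Polynomial (ZMod p) := (rpoly n A b).map (Int.castRingHom (ZMod p)) with hF
  have hFdef : F = Polynomial.C (n : ZMod p) * Polynomial.X ^ 2 *
      (Polynomial.X + Polynomial.C (b : ZMod p)) ^ 2 +
      Polynomial.C ((A : ZMod p) * b) * (Polynomial.C 2 * Polynomial.X + Polynomial.C (b : ZMod p)) := by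
    simp only [hF, rpoly, Polynomial.map_add, Polynomial.map_mul, Polynomial.map_pow, Polynomial.map_C,
      Polynomial.map_X]
    simp only [eq_intCast (Int.castRingHom (ZMod p)), Int.cast_mul, Int.cast_ofNat]
  have hexp : F = Polynomial.C (n : ZMod p) * Polynomial.X ^ 4 +
      Polynomial.C (2 * n * b : ZMod p) * Polynomial.X ^ 3 +
      Polynomial.C (n * b ^ 2 : ZMod p) * Polynomial.X ^ 2 +
      Polynomial.C (2 * A * b : ZMod p) * Polynomial.X + Polynomial.C (A * b ^ 2 : ZMod p) := by
    rw [hFdef]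
    simp only [Polynomial.C_mul, Polynomial.C_pow, Polynomial.C_ofNat]
    ring
  have hne : F ≠ 0 := by
    intro h0
    have h1 : F.coeff 1 = (2 * A * b : ZMod p) := by
      rw [hexp]; simp only [Polynomial.coeff_add, Polynomial.coeff_C_mul, Polynomial.coeff_X_pow,
        Polynomial.coeff_X_one, Polynomial.coeff_C]; norm_num
    rw [h0, Polynomial.coeff_zero] at h1
    have h3 : ((2 * A * b : ℤ) : ZMod p) = 0 := by push_cast; exact h1.symm
    rw [ZMod.intCast_zmod_eq_zero_iff_dvd] at h3
    have hpI : Prime (p : ℤ) := Nat.prime_iff_prime_int.1 hp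
    rw [mul_assoc] at h3
    rcases hpI.dvd_or_dvd h3 with h | h
    · have : (p : ℤ) ∣ ((2 : ℕ) : ℤ) := by simpa using h
      rw [Int.natCast_dvd_natCast] at this
      exact h2 ((Nat.prime_dvd_prime_iff_eq hp Nat.prime_two).1 this)
    · exact hA (by rwa [mul_comm] at h)
  have hdeg : F.natDegree ≤ 4 := by
    rw [hexp]; compute_degree
  calc Nf (rpoly n A b) p ≤ F.roots.toFinset.card := by
        refine Finset.card_le_card_of_injOn (fun x : ℕ => (x : ZMod p)) ?_ ?_
        · intro x hx
          simp only [Finset.coe_filter, Set.mem_ofPred_eq, Finset.mem_range] at hx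
          simp only [Finset.mem_coe, Multiset.mem_toFinset]
          rw [Polynomial.mem_roots hne, Polynomial.IsRoot.def]
          have := (ZMod.intCast_zmod_eq_zero_iff_dvd _ p).2 hx.2
          rw [hF]
          have e := Polynomial.eval_intCast_map (Int.castRingHom (ZMod p)) (rpoly n A b) (x : ℤ)
          simp only [Int.cast_natCast, eq_intCast] at e
          rw [e]; exact this
        · intro x hx y hy hxy
          simp only [Finset.coe_filter, Set.mem_ofPred_eq, Finset.mem_range] at hx hy
          exact Nat.ModEq.eq_of_lt_of_lt ((ZMod.natCast_eq_natCast_iff _ _ _).1 hxy) hx.1 hy.1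
    _ ≤ F.roots.card := Multiset.toFinset_card_le _
    _ ≤ F.natDegree := Polynomial.card_roots' F
    _ ≤ 4 := hdeg

lemma Nf_rpoly (n A b : ℤ) (g : ℕ) (hg : Squarefree g) (hodd : Odd g) :
    Nf (rpoly n A b) g ≤ 4 ^ g.primeFactors.card * Int.gcd (b * A) g := by
  have hg0 : g ≠ 0 := hg.ne_zero
  have h1 : Nf (rpoly n A b) g ≤ ∏ p ∈ g.primeFactors, Nf (rpoly n A b) p := by
    conv_lhs => rw [← Nat.prod_primeFactors_of_squarefree hg]
    exact Nf_prod _ _ fun p hp => Nat.prime_of_mem_primeFactors hp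
  refine h1.trans ?_
  have h2 : ∀ p ∈ g.primeFactors, Nf (rpoly n A b) p ≤
      4 * (if (p : ℤ) ∣ b * A then p else 1) := by
    intro p hp
    have hpp := Nat.prime_of_mem_primeFactors hp
    split_ifs with h
    · refine le_trans (Finset.card_filter_le _ _) ?_
      rw [Finset.card_range]; omega
    · rw [mul_one]
      refine Nf_rpoly_prime n A b p hpp ?_ h
      rintro rfl
      have := Nat.dvd_of_mem_primeFactors hp
      exact (Nat.not_even_iff_odd.2 hodd) (even_iff_two_dvd.2 this)
  refine (Finset.prod_le_prod' h2).trans ?_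
  rw [Finset.prod_mul_distrib, Finset.prod_const]
  refine Nat.mul_le_mul_left _ ?_
  rw [Finset.prod_ite]
  simp only [Finset.prod_const_one, mul_one]
  refine Nat.le_of_dvd (Int.gcd_pos_of_ne_zero_right _ (by exact_mod_cast hg0)) ?_
  refine Finset.prod_primes_dvd _ (fun p hp => ?_) (fun p hp => ?_)
  · rw [Finset.mem_filter] at hp
    exact (Nat.prime_of_mem_primeFactors hp.1).prime
  · rw [Finset.mem_filter] at hp
    exact Int.dvd_gcd hp.2 (by exact_mod_cast Nat.dvd_of_mem_primeFactors hp.1)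

/-! ### The phase function -/

/-- `u * iv q u ≡ 1 mod q` for `u` coprime to `q`. -/
def iv (q : ℕ) (u : ℤ) : ℤ := Int.gcdA u q

lemma iv_spec {q : ℕ} {u : ℤ} (h : Int.gcd u q = 1) : u * iv q u ≡ 1 [ZMOD q] := by
  have := Int.gcd_eq_gcd_ab u q
  rw [h] at this
  unfold iv
  have e : u * Int.gcdA u q = 1 + q * (- Int.gcdB u q) := by push_cast at this; linarith
  rw [e]
  exact (Int.modEq_iff_add_fac.2 ⟨-Int.gcdB u q, rfl⟩).symm

lemma iv_uniq {q : ℕ} {u x y : ℤ} (hx : u * x ≡ 1 [ZMOD q]) (hy : u * y ≡ 1 [ZMOD q]) :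
    x ≡ y [ZMOD q] := by
  have h1 : x * (u * y) ≡ x * 1 [ZMOD q] := hy.mul_left x
  have h2 : y * (u * x) ≡ y * 1 [ZMOD q] := hx.mul_left y
  have h3 : x * (u * y) = y * (u * x) := by ring
  rw [h3] at h1
  simpa using h1.symm.trans h2

lemma gcd_sq_one {g : ℕ} {u : ℤ} (h : Int.gcd u g = 1) : Int.gcd u ((g ^ 2 : ℕ) : ℤ) = 1 := by
  rw [← Int.isCoprime_iff_gcd_eq_one] at h ⊢
  push_cast; exact h.pow_right

def kl (g : ℕ) (A u : ℤ) : ℂ :=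
  if Int.gcd u g = 1 then ee (((A * iv (g ^ 2) u : ℤ) : ℝ) / ((g ^ 2 : ℕ) : ℝ)) else 0

lemma kl_norm (g : ℕ) (A u : ℤ) : ‖kl g A u‖ ≤ 1 := by
  unfold kl; split_ifs
  · rw [ee_norm]
  · simp

lemma gcd_add_mul {g : ℕ} (u y : ℤ) : Int.gcd (u + g * y) g = Int.gcd u g := by
  rw [Int.gcd_comm, Int.gcd_comm u]; simp

lemma kl_shift (g : ℕ) (hg : 0 < g) (A u y : ℤ) (h : Int.gcd u g = 1) :
    kl g A (u + g * y) = kl g A u * ee (((-(A * iv (g ^ 2) u ^ 2) : ℤ) : ℝ) * y / g) := by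
  unfold kl
  rw [if_pos (by rw [gcd_add_mul]; exact h), if_pos h]
  set x := iv (g ^ 2) u
  have hx : u * x ≡ 1 [ZMOD (g ^ 2 : ℕ)] := iv_spec (gcd_sq_one h)
  have h2 : (u + g * y) * iv (g ^ 2) (u + g * y) ≡ 1 [ZMOD (g ^ 2 : ℕ)] :=
    iv_spec (gcd_sq_one (by rw [gcd_add_mul]; exact h))
  have h3 : (u + g * y) * (x - x ^ 2 * g * y) ≡ 1 [ZMOD (g ^ 2 : ℕ)] := by
    obtain ⟨k, hk⟩ := hx.dvd
    have e : u * x = 1 - ((g ^ 2 : ℕ) : ℤ) * k := by linarith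
    have : (u + g * y) * (x - x ^ 2 * g * y) =
        1 + ((g ^ 2 : ℕ) : ℤ) * (-k + g * y * x * k - x ^ 2 * y ^ 2) := by
      have : (u + g * y) * (x - x ^ 2 * g * y) =
        u * x + g * y * x - (u * x) * (x * g * y) - x ^ 2 * g ^ 2 * y ^ 2 := by ring
      rw [this, e]; push_cast; ring
    rw [this]
    exact (Int.modEq_iff_add_fac.2 ⟨_, rfl⟩).symm
  have h4 := (iv_uniq h2 h3).mul_left A
  rw [ee_congr (by positivity) h4, ← ee_add]
  congr 1
  have : (g : ℝ) ≠ 0 := by positivity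
  push_cast
  field_simp
  ring

end

section

lemma sum_fiber (g : ℕ) (hg : 0 < g) (α β v : ℤ) : ∃ α' β' : ℤ,
    (∀ f : ℤ → ℂ, ∑ u ∈ (Finset.Ico α β).filter (fun u => u ≡ v [ZMOD g]), f u =
      ∑ y ∈ Finset.Ico α' β', f (v + g * y)) ∧
    ∀ B : ℝ, 0 ≤ B → (β : ℝ) - α ≤ B → ((Finset.Ico α' β').card : ℝ) ≤ B / g + 1 := by
  have hgZ : (0 : ℤ) < g := by exact_mod_cast hg
  have hgR : (0 : ℝ) < g := by exact_mod_cast hg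
  refine ⟨⌈((α - v : ℤ) : ℚ) / ((g : ℤ) : ℚ)⌉, ⌈((β - v : ℤ) : ℚ) / ((g : ℤ) : ℚ)⌉, ?_, ?_⟩
  · intro f
    rw [Int.Ico_filter_modEq_eq, Int.Ico_filter_dvd_eq _ _ hgZ, Finset.sum_map, Finset.sum_map]
    refine Finset.sum_congr rfl fun y _ => ?_
    simp only [Function.Embedding.coeFn_mk]
    congr 1; ring
  · intro B hB h
    rw [Int.card_Ico]
    set x := ((β - v : ℤ) : ℚ) / ((g : ℤ) : ℚ)
    set y := ((α - v : ℤ) : ℚ) / ((g : ℤ) : ℚ)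
    have h1 : ((⌈x⌉ : ℤ) : ℝ) < ((x : ℚ) : ℝ) + 1 := by exact_mod_cast Int.ceil_lt_add_one x
    have h2 : ((y : ℚ) : ℝ) ≤ (⌈y⌉ : ℤ) := by exact_mod_cast Int.le_ceil y
    have h3 : ((x : ℚ) : ℝ) - ((y : ℚ) : ℝ) = ((β : ℝ) - α) / g := by
      simp only [x, y]; push_cast; field_simp; ring
    have h4 : ((β : ℝ) - α) / g ≤ B / g := by gcongr
    rcases le_total (⌈x⌉ - ⌈y⌉) 0 with h5 | h5
    · rw [Int.toNat_of_nonpos h5]; simp; positivity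
    · have : (((⌈x⌉ - ⌈y⌉).toNat : ℤ) : ℝ) = ((⌈x⌉ - ⌈y⌉ : ℤ) : ℝ) := by
        rw [Int.toNat_of_nonneg h5]
      rw [Int.cast_natCast] at this
      rw [this]; push_cast; linarith

lemma card_modEq_le (g : ℕ) (hg : 0 < g) (α β v : ℤ) (B : ℝ) (hB : 0 ≤ B) (h : (β : ℝ) - α ≤ B) :
    (((Finset.Ico α β).filter (fun u => u ≡ v [ZMOD g])).card : ℝ) ≤ B / g + 1 := by
  obtain ⟨α', β', h1, h2⟩ := sum_fiber g hg α β v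
  have := h1 (fun _ => 1)
  simp only [Finset.sum_const, nsmul_eq_mul, mul_one] at this
  have h3 : ((Finset.Ico α β).filter (fun u => u ≡ v [ZMOD g])).card = (Finset.Ico α' β').card := by
    exact_mod_cast this
  rw [h3]; exact h2 B hB h

/-- slope of the linearised phase -/
def nuC (g : ℕ) (A b x : ℤ) : ℤ := -(A * iv (g ^ 2) x ^ 2) + A * iv (g ^ 2) (x + b) ^ 2

def wtC (g : ℕ) (B : ℝ) (n : ℕ) : ℝ :=
  if n = 0 then B / g + 1 else (g : ℝ) / n + (g : ℝ) / (g - n : ℕ)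

lemma wtC_nonneg (g : ℕ) (B : ℝ) (hB : 0 ≤ B) (n : ℕ) : 0 ≤ wtC g B n := by
  unfold wtC; split_ifs <;> positivity

lemma corr_fiber (g : ℕ) (hg : 0 < g) (A b α β x : ℤ) (B : ℝ) (hB : 0 ≤ B) (h : (β : ℝ) - α ≤ B) :
    ‖∑ u ∈ (Finset.Ico α β).filter (fun u => u ≡ x [ZMOD g]),
      kl g A u * (starRingEnd ℂ) (kl g A (u + b))‖ ≤
    if Int.gcd x g = 1 ∧ Int.gcd (x + b) g = 1 then wtC g B (nuC g A b x % g).toNat else 0 := by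
  obtain ⟨α', β', h1, h2⟩ := sum_fiber g hg α β x
  rw [h1]
  split_ifs with hx
  · have e : ∀ y : ℤ, kl g A (x + g * y) * (starRingEnd ℂ) (kl g A (x + g * y + b)) =
        kl g A x * (starRingEnd ℂ) (kl g A (x + b)) * ee ((nuC g A b x : ℝ) * y / g) := by
      intro y
      have e1 : x + g * y + b = (x + b) + g * y := by ring
      rw [e1, kl_shift g hg A x y hx.1, kl_shift g hg A (x + b) y hx.2, map_mul, ← ee_neg]
      have : (nuC g A b x : ℝ) * y / g = ((-(A * iv (g ^ 2) x ^ 2) : ℤ) : ℝ) * y / g +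
        -(((-(A * iv (g ^ 2) (x+b) ^ 2) : ℤ) : ℝ) * y / g) := by
        unfold nuC; push_cast; ring
      rw [this, ee_add]; ring
    simp_rw [e]
    rw [← Finset.mul_sum, norm_mul, norm_mul, RCLike.norm_conj]
    have k1 := kl_norm g A x
    have k2 := kl_norm g A (x + b)
    have k3 : ‖kl g A x‖ * ‖kl g A (x + b)‖ ≤ 1 := mul_le_one₀ k1 (norm_nonneg _) k2
    refine (mul_le_of_le_one_left (norm_nonneg _) k3).trans ?_
    have hgZ : (0 : ℤ) < g := by exact_mod_cast hg
    set n := (nuC g A b x % g).toNat with hn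
    have hnn : (n : ℤ) = nuC g A b x % g := Int.toNat_of_nonneg (Int.emod_nonneg _ hgZ.ne')
    have hlt : n < g := by
      have := Int.emod_lt_of_pos (nuC g A b x) hgZ
      omega
    unfold wtC
    split_ifs with h0
    · refine le_trans (norm_sum_le _ _) ?_
      simp only [ee_norm, Finset.sum_const, nsmul_eq_mul, mul_one]
      exact h2 B hB h
    · refine geom_bound g n (Nat.pos_of_ne_zero h0) hlt _ ?_ _ _
      rw [hnn]; exact (Int.mod_modEq _ _).symm
  · refine le_of_eq ?_
    rw [norm_eq_zero]
    refine Finset.sum_eq_zero fun y _ => ?_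
    rw [not_and_or] at hx
    rcases hx with hx | hx
    · have : kl g A (x + g * y) = 0 := by
        unfold kl; rw [if_neg]; rw [gcd_add_mul]; exact hx
      rw [this, zero_mul]
    · have : kl g A (x + g * y + b) = 0 := by
        have e1 : x + g * y + b = (x + b) + g * y := by ring
        unfold kl; rw [if_neg]; rw [e1, gcd_add_mul]; exact hx
      rw [this, map_zero, mul_zero]

lemma iv_sq_spec {g : ℕ} {x : ℤ} (h : Int.gcd x g = 1) : x * iv (g ^ 2) x ≡ 1 [ZMOD g] := by
  have := iv_spec (gcd_sq_one h)
  refine this.of_dvd ?_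
  push_cast; exact Dvd.intro _ (sq _).symm

lemma nuC_root (g : ℕ) (A b x : ℤ) (n : ℤ) (hx : Int.gcd x g = 1) (hxb : Int.gcd (x + b) g = 1)
    (hn : nuC g A b x ≡ n [ZMOD g]) : (g : ℤ) ∣ (rpoly n A b).eval x := by
  rw [rpoly_eval]
  have h1 := iv_sq_spec hx
  have h2 := iv_sq_spec hxb
  set p := iv (g ^ 2) x
  set q := iv (g ^ 2) (x + b)
  have hn' : n * x ^ 2 * (x + b) ^ 2 ≡ nuC g A b x * x ^ 2 * (x + b) ^ 2 [ZMOD g] :=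
    (hn.symm.mul_right _).mul_right _
  have e : nuC g A b x * x ^ 2 * (x + b) ^ 2 =
      -(A * (x * p) ^ 2 * (x + b) ^ 2) + A * ((x + b) * q) ^ 2 * x ^ 2 := by
    unfold nuC; ring
  rw [e] at hn'
  have h3 : -(A * (x * p) ^ 2 * (x + b) ^ 2) + A * ((x + b) * q) ^ 2 * x ^ 2 ≡
      -(A * 1 ^ 2 * (x + b) ^ 2) + A * 1 ^ 2 * x ^ 2 [ZMOD g] := by
    refine Int.ModEq.add ?_ ?_
    · exact (((h1.pow 2).mul_left A).mul_right _).neg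
    · exact (((h2.pow 2).mul_left A).mul_right _)
  have h4 := (hn'.trans h3).add_right (A * b * (2 * x + b))
  have e2 : -(A * 1 ^ 2 * (x + b) ^ 2) + A * 1 ^ 2 * x ^ 2 + (A * b * (2 * x + b)) = 0 := by ring
  rw [e2] at h4
  exact Int.modEq_zero_iff_dvd.1 h4

lemma sum_wtC (g : ℕ) (hg : 0 < g) (B : ℝ) :
    ∑ n ∈ Finset.range g, wtC g B n ≤ B / g + 1 + 2 * g * (1 + Real.log g) := by
  have hh : ∑ i ∈ Finset.range g, ((g : ℝ) / (i + 1 : ℕ)) ≤ g * (1 + Real.log g) := by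
    have := harmonic_le_one_add_log g
    have e : ((harmonic g : ℚ) : ℝ) = ∑ i ∈ Finset.range g, (1 : ℝ) / (i + 1 : ℕ) := by
      unfold harmonic; push_cast; simp
    rw [e] at this
    calc ∑ i ∈ Finset.range g, ((g : ℝ) / (i + 1 : ℕ)) =
        g * ∑ i ∈ Finset.range g, (1 : ℝ) / (i + 1 : ℕ) := by
          rw [Finset.mul_sum]; refine Finset.sum_congr rfl fun i _ => by ring
      _ ≤ _ := by gcongr
  obtain ⟨k, rfl⟩ : ∃ k, g = k + 1 := ⟨g - 1, by omega⟩
  rw [Finset.sum_range_succ' ]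
  have e0 : wtC (k + 1) B 0 = B / (k + 1 : ℕ) + 1 := by simp [wtC]
  rw [e0]
  have e1 : ∀ i ∈ Finset.range k, wtC (k + 1) B (i + 1) =
      ((k + 1 : ℕ) : ℝ) / (i + 1 : ℕ) + ((k + 1 : ℕ) : ℝ) / (k - i : ℕ) := by
    intro i _
    unfold wtC
    rw [if_neg (by omega)]
    congr 3; omega
  rw [Finset.sum_congr rfl e1, Finset.sum_add_distrib]
  have e2 : ∑ i ∈ Finset.range k, ((k + 1 : ℕ) : ℝ) / (k - i : ℕ) =
      ∑ i ∈ Finset.range k, ((k + 1 : ℕ) : ℝ) / (i + 1 : ℕ) := by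
    rw [← Finset.sum_range_reflect]
    refine Finset.sum_congr rfl fun i hi => ?_
    rw [Finset.mem_range] at hi
    congr 2; omega
  rw [e2]
  have e3 : ∑ i ∈ Finset.range k, ((k + 1 : ℕ) : ℝ) / (i + 1 : ℕ) ≤
      ∑ i ∈ Finset.range (k + 1), ((k + 1 : ℕ) : ℝ) / (i + 1 : ℕ) := by
    rw [Finset.sum_range_succ];
    have : (0:ℝ) ≤ ((k + 1 : ℕ) : ℝ) / (k + 1 : ℕ) := by positivity
    linarith
  linarith

lemma corr_bound (g : ℕ) (hg : Squarefree g) (hodd : Odd g) (A b α β : ℤ) (B : ℝ) (hB : 0 ≤ B)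
    (h : (β : ℝ) - α ≤ B) :
    ‖∑ u ∈ Finset.Ico α β, kl g A u * (starRingEnd ℂ) (kl g A (u + b))‖ ≤
    4 ^ g.primeFactors.card * Int.gcd (b * A) g * (B / g + 1 + 2 * g * (1 + Real.log g)) := by
  have hg0 : 0 < g := Nat.pos_of_ne_zero hg.ne_zero
  have hgZ : (0 : ℤ) < g := by exact_mod_cast hg0
  have e1 : ∑ u ∈ Finset.Ico α β, kl g A u * (starRingEnd ℂ) (kl g A (u + b)) =
      ∑ x ∈ Finset.range g, ∑ u ∈ (Finset.Ico α β).filter (fun u => u ≡ (x : ℤ) [ZMOD g]),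
      kl g A u * (starRingEnd ℂ) (kl g A (u + b)) := by
    rw [← Finset.sum_fiberwise_of_maps_to (g := fun u : ℤ => (u % g).toNat) (t := Finset.range g)]
    · refine Finset.sum_congr rfl fun x hx => ?_
      refine Finset.sum_congr ?_ fun _ _ => rfl
      ext u
      simp only [Finset.mem_filter, and_congr_right_iff]
      intro _
      rw [Finset.mem_range] at hx
      have h1 := Int.emod_nonneg u hgZ.ne'
      unfold Int.ModEq
      have h2 : ((x : ℤ) % g) = x := Int.emod_eq_of_lt (by omega) (by omega)
      rw [h2]; omega
    · intro u _
      rw [Finset.mem_range]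
      have h1 := Int.emod_nonneg u hgZ.ne'
      have h2 := Int.emod_lt_of_pos u hgZ
      omega
  rw [e1]
  refine (norm_sum_le _ _).trans ?_
  refine (Finset.sum_le_sum fun (x : ℕ) _ => corr_fiber g hg0 A b α β (x : ℤ) B hB h).trans ?_
  rw [← Finset.sum_filter]
  rw [← Finset.sum_fiberwise_of_maps_to (g := fun x : ℕ => (nuC g A b x % g).toNat)
    (t := Finset.range g)]
  · have : ∀ n ∈ Finset.range g, ∑ x ∈ ((Finset.range g).filter (fun x : ℕ => Int.gcd x g = 1 ∧
        Int.gcd (x + b) g = 1)).filter (fun x : ℕ => (nuC g A b x % g).toNat = n),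
        wtC g B (nuC g A b x % g).toNat ≤
        (4 ^ g.primeFactors.card * Int.gcd (b * A) g : ℕ) * wtC g B n := by
      intro n hn
      have : ∀ x ∈ ((Finset.range g).filter (fun x : ℕ => Int.gcd x g = 1 ∧
        Int.gcd (x + b) g = 1)).filter (fun x : ℕ => (nuC g A b x % g).toNat = n),
        wtC g B (nuC g A b x % g).toNat = wtC g B n := by
        intro x hx; rw [Finset.mem_filter] at hx; rw [hx.2]
      rw [Finset.sum_congr rfl this, Finset.sum_const, nsmul_eq_mul]
      refine mul_le_mul_of_nonneg_right ?_ (wtC_nonneg g B hB n)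
      have h3 := Nf_rpoly (n : ℤ) A b g hg hodd
      refine le_trans ?_ (Nat.cast_le.2 h3)
      refine Nat.cast_le.2 (Finset.card_le_card ?_)
      intro x hx
      simp only [Finset.mem_filter] at hx ⊢
      refine ⟨hx.1.1, ?_⟩
      refine nuC_root g A b x n hx.1.2.1 hx.1.2.2 ?_
      have h1 := Int.emod_nonneg (nuC g A b x) hgZ.ne'
      have : (n : ℤ) = nuC g A b x % g := by omega
      rw [this]; exact (Int.mod_modEq _ _).symm
    refine (Finset.sum_le_sum this).trans ?_
    rw [← Finset.mul_sum]
    push_cast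
    exact mul_le_mul_of_nonneg_left (sum_wtC g hg0 B) (by positivity)
  · intro x _
    rw [Finset.mem_range]
    have h1 := Int.emod_nonneg (nuC g A b x) hgZ.ne'
    have h2 := Int.emod_lt_of_pos (nuC g A b x) hgZ
    omega

end

section

lemma cs_one {ι : Type*} (s : Finset ι) (f g : ι → ℂ) (hf : ∀ i ∈ s, ‖f i‖ ≤ 1) :
    ‖∑ i ∈ s, f i * g i‖ ^ 2 ≤ s.card * ∑ i ∈ s, ‖g i‖ ^ 2 := by
  have h1 : ‖∑ i ∈ s, f i * g i‖ ≤ ∑ i ∈ s, ‖g i‖ := by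
    refine (norm_sum_le _ _).trans (Finset.sum_le_sum fun i hi => ?_)
    rw [norm_mul]; exact mul_le_of_le_one_left (norm_nonneg _) (hf i hi)
  refine (pow_le_pow_left₀ (norm_nonneg _) h1 2).trans ?_
  exact sq_sum_le_card_mul_sum_sq

lemma normsq_sum {ι : Type*} (s : Finset ι) (c : ι → ℂ) :
    ((‖∑ i ∈ s, c i‖ ^ 2 : ℝ) : ℂ) = ∑ i ∈ s, ∑ j ∈ s, c i * (starRingEnd ℂ) (c j) := by
  push_cast
  rw [← Complex.mul_conj', map_sum, Finset.sum_mul_sum]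

lemma sum_normsq_le {ι κ : Type*} (s : Finset ι) (t : Finset κ) (c : κ → ι → ℂ) :
    ∑ u ∈ s, ‖∑ k ∈ t, c k u‖ ^ 2 ≤
      ∑ k ∈ t, ∑ k' ∈ t, ‖∑ u ∈ s, c k u * (starRingEnd ℂ) (c k' u)‖ := by
  have h : ((∑ u ∈ s, ‖∑ k ∈ t, c k u‖ ^ 2 : ℝ) : ℂ) =
      ∑ k ∈ t, ∑ k' ∈ t, ∑ u ∈ s, c k u * (starRingEnd ℂ) (c k' u) := by
    rw [Complex.ofReal_sum]
    simp_rw [normsq_sum]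
    rw [Finset.sum_comm]
    refine Finset.sum_congr rfl fun k _ => ?_
    rw [Finset.sum_comm]
  have h0 : 0 ≤ ∑ u ∈ s, ‖∑ k ∈ t, c k u‖ ^ 2 := Finset.sum_nonneg fun _ _ => by positivity
  calc ∑ u ∈ s, ‖∑ k ∈ t, c k u‖ ^ 2 = ‖((∑ u ∈ s, ‖∑ k ∈ t, c k u‖ ^ 2 : ℝ) : ℂ)‖ := by
        rw [Complex.norm_real, Real.norm_of_nonneg h0]
    _ ≤ _ := by
        rw [h]
        refine (norm_sum_le _ _).trans (Finset.sum_le_sum fun k _ => ?_)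
        exact norm_sum_le _ _

/-- sum of gcds over an interval -/
lemma sum_gcd_le (g N : ℕ) (hg : 0 < g) :
    ∑ n ∈ Finset.Icc 1 N, Nat.gcd n g ≤ N * g.divisors.card := by
  have h1 : ∀ n ∈ Finset.Icc 1 N, Nat.gcd n g ≤ ∑ e ∈ g.divisors, if e ∣ n then e else 0 := by
    intro n _
    have : (if Nat.gcd n g ∣ n then Nat.gcd n g else 0) ≤
      ∑ e ∈ g.divisors, if e ∣ n then e else 0 := by
      refine Finset.single_le_sum (f := fun e => if e ∣ n then e else 0) (fun _ _ => Nat.zero_le _) ?_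
      rw [Nat.mem_divisors]; exact ⟨Nat.gcd_dvd_right _ _, hg.ne'⟩
    rwa [if_pos (Nat.gcd_dvd_left _ _)] at this
  refine (Finset.sum_le_sum h1).trans ?_
  rw [Finset.sum_comm]
  have h2 : ∀ e ∈ g.divisors, (∑ n ∈ Finset.Icc 1 N, if e ∣ n then e else 0) ≤ N := by
    intro e he
    rw [← Finset.sum_filter, Finset.sum_const, smul_eq_mul]
    have : ((Finset.Icc 1 N).filter (fun n => e ∣ n)).card = N / e := by
      rw [← Nat.Ioc_filter_dvd_card_eq_div]; rfl
    rw [this]; exact Nat.div_mul_le_self _ _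
  refine (Finset.sum_le_sum h2).trans ?_
  simp [mul_comm]

lemma sum_gcd_diff (g K k : ℕ) (hg : 0 < g) (hk : k < K) :
    ∑ k' ∈ (Finset.range K).erase k, Int.gcd ((k' : ℤ) - k) g ≤ 2 * K * g.divisors.card := by
  have h1 : ∑ k' ∈ (Finset.range K).erase k, Int.gcd ((k' : ℤ) - k) g =
      ∑ k' ∈ Finset.range k, Int.gcd ((k' : ℤ) - k) g +
      ∑ k' ∈ Finset.Ico (k+1) K, Int.gcd ((k' : ℤ) - k) g := by
    rw [← Finset.sum_union]
    · congr 1; ext x; simp; omega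
    · rw [Finset.disjoint_left]; intro x; simp; omega
  have h2 : ∑ k' ∈ Finset.range k, Int.gcd ((k' : ℤ) - k) g ≤
      ∑ n ∈ Finset.Icc 1 K, Nat.gcd n g := by
    have : ∑ k' ∈ Finset.range k, Int.gcd ((k' : ℤ) - k) g =
      ∑ n ∈ (Finset.range k).image (fun k' => k - k'), Nat.gcd n g := by
      rw [Finset.sum_image]
      · refine Finset.sum_congr rfl fun x hx => ?_
        rw [Finset.mem_range] at hx
        have : (x : ℤ) - k = -((k - x : ℕ) : ℤ) := by omega
        rw [this, Int.neg_gcd, Int.gcd_natCast_natCast]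
      · intro x hx y hy h; simp at hx hy h; omega
    rw [this]
    refine Finset.sum_le_sum_of_subset ?_
    intro n; simp; intro x hx hn; omega
  have h3 : ∑ k' ∈ Finset.Ico (k+1) K, Int.gcd ((k' : ℤ) - k) g ≤
      ∑ n ∈ Finset.Icc 1 K, Nat.gcd n g := by
    have : ∑ k' ∈ Finset.Ico (k+1) K, Int.gcd ((k' : ℤ) - k) g =
      ∑ n ∈ (Finset.Ico (k+1) K).image (fun k' => k' - k), Nat.gcd n g := by
      rw [Finset.sum_image]
      · refine Finset.sum_congr rfl fun x hx => ?_
        rw [Finset.mem_Ico] at hx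
        have : (x : ℤ) - k = ((x - k : ℕ) : ℤ) := by omega
        rw [this, Int.gcd_natCast_natCast]
      · intro x hx y hy h; simp at hx hy h; omega
    rw [this]
    refine Finset.sum_le_sum_of_subset ?_
    intro n; simp; intro x hx _ hn; omega
  have := sum_gcd_le g K hg
  rw [h1]; nlinarith

lemma gcd_mul_le (m : ℕ) (g : ℕ) (hg : 0 < g) (hm : m.Coprime g) (c A : ℤ) :
    Int.gcd (c * m * A) g ≤ Int.gcd c g * Int.gcd A g := by
  have h0 : Int.gcd (c * m * A) g ∣ Int.gcd c g * Int.gcd A g := by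
    have e : Int.gcd (c * m * A) g = Nat.gcd (m * (c.natAbs * A.natAbs)) g := by
      unfold Int.gcd; rw [Int.natAbs_mul, Int.natAbs_mul]; simp; congr 1; ring
    rw [e, Nat.Coprime.gcd_mul_left_cancel _ hm]
    have : Nat.gcd g (c.natAbs * A.natAbs) ∣ Nat.gcd g c.natAbs * Nat.gcd g A.natAbs :=
      gcd_mul_dvd_mul_gcd g c.natAbs A.natAbs
    unfold Int.gcd
    simp only [Int.natAbs_natCast]
    rwa [Nat.gcd_comm g, Nat.gcd_comm g, Nat.gcd_comm g] at this
  refine Nat.le_of_dvd ?_ h0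
  exact Nat.mul_pos (Int.gcd_pos_of_ne_zero_right _ (by exact_mod_cast hg.ne'))
    (Int.gcd_pos_of_ne_zero_right _ (by exact_mod_cast hg.ne'))

lemma sum_shift_subset (G : ℤ → ℂ) (α β M s : ℤ) (hs0 : 0 ≤ s) (hsM : s ≤ M) :
    ∑ u ∈ Finset.Ico α β, G u =
    ∑ u ∈ Finset.Ico (α - M) β, if u + s ∈ Finset.Ico α β then G (u + s) else 0 := by
  rw [← Finset.sum_filter]
  refine Finset.sum_nbij' (fun u => u - s) (fun u => u + s) ?_ ?_ ?_ ?_ ?_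
  · intro u hu; simp at hu ⊢; omega
  · intro u hu; simp at hu ⊢; omega
  · intro u _; ring
  · intro u _; ring
  · intro u _; simp

lemma vdC_pre (g : ℕ) (hg : Squarefree g) (hodd : Odd g) (m : ℕ) (hm0 : 0 < m) (hm : m.Coprime g)
    (F1 : ℤ → ℂ) (hF : ∀ u, ‖F1 u‖ ≤ 1) (hper : ∀ u, F1 (u + m) = F1 u) (A α β : ℤ) (B : ℝ)
    (hαβ : α ≤ β) (h : (β : ℝ) - α ≤ B) (K : ℕ) (hK : 0 < K) (hKm : (K : ℝ) * m ≤ B) :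
    (K : ℝ) ^ 2 * ‖∑ u ∈ Finset.Ico α β, F1 u * kl g A u‖ ^ 2 ≤
      2 * B * (K * B + 2 * K ^ 2 * g.divisors.card * 4 ^ g.primeFactors.card * Int.gcd A g *
        (B / g + 1 + 2 * g * (1 + Real.log g))) := by
  have hg0 : 0 < g := Nat.pos_of_ne_zero hg.ne_zero
  have hB : 0 ≤ B := by have : (α : ℝ) ≤ β := by exact_mod_cast hαβ
                        linarith
  have hperk : ∀ (k : ℕ) u, F1 (u + k * m) = F1 u := by
    intro k; induction k with
    | zero => intro u; simp
    | succ k ih => intro u; have := hper (u + k * m); rw [ih] at this; rw [← this]; congr 1; push_cast; ring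
  set I := Finset.Ico α β
  set I2 := Finset.Ico (α - K * m) β
  set c : ℕ → ℤ → ℂ := fun k u => if u + k * m ∈ I then kl g A (u + k * m) else 0
  have e1 : (K : ℂ) * ∑ u ∈ I, F1 u * kl g A u = ∑ u ∈ I2, F1 u * ∑ k ∈ Finset.range K, c k u := by
    have : ∀ k ∈ Finset.range K, ∑ u ∈ I, F1 u * kl g A u = ∑ u ∈ I2, F1 u * c k u := by
      intro k hk
      rw [Finset.mem_range] at hk
      have hk2 : (k : ℤ) * m ≤ K * m := by gcongr
      rw [sum_shift_subset (fun u => F1 u * kl g A u) α β (K * m) (k * m) (by positivity) hk2]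
      refine Finset.sum_congr rfl fun u _ => ?_
      simp only [c, I]
      split_ifs
      · rw [hperk]
      · simp
    have h2 : ∑ k ∈ Finset.range K, ∑ u ∈ I, F1 u * kl g A u =
      ∑ k ∈ Finset.range K, ∑ u ∈ I2, F1 u * c k u := Finset.sum_congr rfl this
    rw [Finset.sum_const, Finset.card_range, nsmul_eq_mul] at h2
    rw [h2, Finset.sum_comm]
    simp_rw [Finset.mul_sum]
  have e2 : (K : ℝ) ^ 2 * ‖∑ u ∈ I, F1 u * kl g A u‖ ^ 2 =
      ‖∑ u ∈ I2, F1 u * ∑ k ∈ Finset.range K, c k u‖ ^ 2 := by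
    rw [← e1, norm_mul, mul_pow]; simp
  rw [e2]
  refine (cs_one I2 F1 _ fun u _ => hF u).trans ?_
  have hcard : (I2.card : ℝ) ≤ 2 * B := by
    simp only [I2]
    rw [Int.card_Ico]
    have h5 : 0 ≤ β - (α - K * m) := by
      have : (0 : ℤ) ≤ K * m := by positivity
      linarith
    have : (((β - (α - K * m)).toNat : ℤ) : ℝ) = ((β - (α - K * m) : ℤ) : ℝ) := by
      rw [Int.toNat_of_nonneg h5]
    rw [Int.cast_natCast] at this
    rw [this]; push_cast; linarith
  have hIcard : (I.card : ℝ) ≤ B := by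
    simp only [I]
    rw [Int.card_Ico]
    have : (((β - α).toNat : ℤ) : ℝ) = ((β - α : ℤ) : ℝ) := by
      rw [Int.toNat_of_nonneg (by linarith)]
    rw [Int.cast_natCast] at this
    rw [this]; push_cast; linarith
  refine mul_le_mul hcard ?_ (Finset.sum_nonneg fun _ _ => by positivity) (by positivity)
  refine (sum_normsq_le I2 (Finset.range K) c).trans ?_
  set M : ℝ := B / g + 1 + 2 * g * (1 + Real.log g) with hM
  have hM0 : 0 ≤ M := by
    have : 0 ≤ Real.log g := Real.log_natCast_nonneg g
    positivity
  -- each pair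
  have hpair : ∀ k ∈ Finset.range K, ∀ k' ∈ Finset.range K,
      ‖∑ u ∈ I2, c k u * (starRingEnd ℂ) (c k' u)‖ ≤
      4 ^ g.primeFactors.card * Int.gcd (((k' : ℤ) - k) * m * A) g * M := by
    intro k hk k' hk'
    rw [Finset.mem_range] at hk hk'
    have hk2 : (k : ℤ) * m ≤ K * m := by gcongr
    have hk3 : (0 : ℤ) ≤ k * m := by positivity
    have e3 : ∑ u ∈ I2, c k u * (starRingEnd ℂ) (c k' u) =
        ∑ u ∈ Finset.Ico (max α (α - (k' - k) * m)) (min β (β - (k' - k) * m)),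
          kl g A u * (starRingEnd ℂ) (kl g A (u + ((k' : ℤ) - k) * m)) := by
      have e4 : ∀ u ∈ I2, c k u * (starRingEnd ℂ) (c k' u) =
          if u + k * m ∈ Finset.Ico (max α (α - (k' - k) * m)) (min β (β - (k' - k) * m)) then
          kl g A (u + k * m) * (starRingEnd ℂ) (kl g A (u + k * m + ((k' : ℤ) - k) * m)) else 0 := by
        intro u _
        have e5 : u + k * m + ((k' : ℤ) - k) * m = u + k' * m := by ring
        simp only [c, I]
        rw [e5]
        have e6 : (u + k * m ∈ Finset.Ico (max α (α - ((k' : ℤ) - k) * m))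
            (min β (β - ((k' : ℤ) - k) * m))) ↔
            (u + k * m ∈ Finset.Ico α β ∧ u + k' * m ∈ Finset.Ico α β) := by
          simp only [Finset.mem_Ico, max_le_iff, lt_min_iff]
          have : ((k' : ℤ) - k) * m = k' * m - k * m := by ring
          rw [this]
          constructor <;> intro h <;> refine ⟨⟨?_, ?_⟩, ?_, ?_⟩ <;> linarith [h.1.1, h.1.2, h.2.1, h.2.2]
        by_cases h1 : u + k * m ∈ Finset.Ico α β <;> by_cases h2 : u + k' * m ∈ Finset.Ico α β <;>
          simp only [e6, h1, h2, if_true, if_false, and_self, and_true, and_false, map_zero, mul_zero, zero_mul]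
      rw [Finset.sum_congr rfl e4, ← Finset.sum_filter]
      refine Finset.sum_nbij' (fun u => u + k * m) (fun u => u - k * m) ?_ ?_ ?_ ?_ ?_
      · intro u hu; exact (Finset.mem_filter.1 hu).2
      · intro u hu
        simp only [I2, Finset.mem_filter, Finset.mem_Ico, max_le_iff, lt_min_iff] at hu ⊢
        have e7 : u - k * m + k * m = u := by ring
        rw [e7]
        exact ⟨⟨by linarith [hu.1.1], by linarith [hu.2.1]⟩, hu⟩
      · intro u _; ring
      · intro u _; ring
      · intro u _; rfl
    rw [e3]
    refine corr_bound g hg hodd A _ _ _ B hB ?_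
    have h1 : (((min β (β - ((k' : ℤ) - k) * m) : ℤ)) : ℝ) ≤ β := by exact_mod_cast min_le_left _ _
    have h2 : (α : ℝ) ≤ ((max α (α - ((k' : ℤ) - k) * m) : ℤ) : ℝ) := by exact_mod_cast le_max_left _ _
    linarith
  have hdiag : ∀ k ∈ Finset.range K, ‖∑ u ∈ I2, c k u * (starRingEnd ℂ) (c k u)‖ ≤ B := by
    intro k hk
    rw [Finset.mem_range] at hk
    have hk2 : (k : ℤ) * m ≤ K * m := by gcongr
    have e8 := sum_shift_subset (fun u => ((‖kl g A u‖ ^ 2 : ℝ) : ℂ)) α β (K * m) (k * m) (by positivity) hk2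
    have e9 : ∑ u ∈ I2, c k u * (starRingEnd ℂ) (c k u) = ∑ u ∈ I, ((‖kl g A u‖ ^ 2 : ℝ) : ℂ) := by
      rw [e8]
      refine Finset.sum_congr rfl fun u _ => ?_
      simp only [c, I]
      split_ifs
      · rw [Complex.mul_conj']; push_cast; rfl
      · simp
    rw [e9]
    refine (norm_sum_le _ _).trans ?_
    refine le_trans (Finset.sum_le_card_nsmul I _ 1 fun u _ => ?_) (by simpa using hIcard)
    rw [Complex.norm_real, Real.norm_of_nonneg (by positivity)]
    exact pow_le_one₀ (norm_nonneg _) (kl_norm g A u)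
  have hrow : ∀ k ∈ Finset.range K, ∑ k' ∈ Finset.range K, ‖∑ u ∈ I2, c k u * (starRingEnd ℂ) (c k' u)‖ ≤
      B + 2 * K * g.divisors.card * 4 ^ g.primeFactors.card * Int.gcd A g * M := by
    intro k hk
    rw [← Finset.add_sum_erase _ _ hk]
    refine add_le_add (hdiag k hk) ?_
    have h1 : ∀ k' ∈ (Finset.range K).erase k, ‖∑ u ∈ I2, c k u * (starRingEnd ℂ) (c k' u)‖ ≤
        (Int.gcd ((k' : ℤ) - k) g : ℝ) * (4 ^ g.primeFactors.card * Int.gcd A g * M) := by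
      intro k' hk'
      refine (hpair k hk k' (Finset.mem_of_mem_erase hk')).trans ?_
      have : (Int.gcd (((k' : ℤ) - k) * m * A) g : ℝ) ≤ Int.gcd ((k' : ℤ) - k) g * Int.gcd A g := by
        exact_mod_cast gcd_mul_le m g hg0 hm _ A
      calc (4 : ℝ) ^ g.primeFactors.card * Int.gcd (((k' : ℤ) - k) * m * A) g * M
          ≤ 4 ^ g.primeFactors.card * (Int.gcd ((k' : ℤ) - k) g * Int.gcd A g) * M := by gcongr
        _ = _ := by ring
    refine (Finset.sum_le_sum h1).trans ?_
    rw [← Finset.sum_mul]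
    have h2 : (∑ k' ∈ (Finset.range K).erase k, (Int.gcd ((k' : ℤ) - k) g : ℝ)) ≤ 2 * K * g.divisors.card := by
      exact_mod_cast sum_gcd_diff g K k hg0 (Finset.mem_range.1 hk)
    calc _ ≤ (2 * K * g.divisors.card : ℝ) * (4 ^ g.primeFactors.card * Int.gcd A g * M) := by gcongr
      _ = _ := by ring
  refine (Finset.sum_le_card_nsmul _ _ _ hrow).trans ?_
  rw [Finset.card_range, nsmul_eq_mul]
  refine le_of_eq ?_
  ring

lemma vdC (g : ℕ) (hg : Squarefree g) (hodd : Odd g) (m : ℕ) (hm0 : 0 < m) (hm : m.Coprime g)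
    (F1 : ℤ → ℂ) (hF : ∀ u, ‖F1 u‖ ≤ 1) (hper : ∀ u, F1 (u + m) = F1 u) (A α β : ℤ) (B : ℝ)
    (hαβ : α ≤ β) (h : (β : ℝ) - α ≤ B) (hmB : (m : ℝ) ≤ B) (L : ℝ) (hL1 : 1 ≤ L)
    (hLt : (g.divisors.card : ℝ) ≤ L) (hLl : 1 + Real.log g ≤ L) :
    ‖∑ u ∈ Finset.Ico α β, F1 u * kl g A u‖ ^ 2 ≤
      12 * L ^ 4 * Int.gcd A g * (B * m + B ^ 2 / g + B * g) := by
  have hg0 : 0 < g := Nat.pos_of_ne_zero hg.ne_zero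
  have hgR : (1 : ℝ) ≤ g := by exact_mod_cast hg0
  have hmR : (1 : ℝ) ≤ m := by exact_mod_cast hm0
  set K := ⌊B / m⌋₊ with hKdef
  have hBm : 1 ≤ B / m := by rw [le_div_iff₀ (by positivity)]; linarith
  have hK : 0 < K := Nat.floor_pos.2 hBm
  have hKR : (1 : ℝ) ≤ K := by exact_mod_cast hK
  have hB : 0 < B := by linarith
  have hKle : (K : ℝ) ≤ B / m := Nat.floor_le (by positivity)
  have hKm : (K : ℝ) * m ≤ B := by rwa [le_div_iff₀ (by positivity)] at hKle
  have hKlt : B / m < K + 1 := Nat.lt_floor_add_one _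
  have hBK : B ≤ 2 * K * m := by
    rw [div_lt_iff₀ (by positivity)] at hKlt
    nlinarith
  have hpre := vdC_pre g hg hodd m hm0 hm F1 hF hper A α β B hαβ h K hK hKm
  set S := ‖∑ u ∈ Finset.Ico α β, F1 u * kl g A u‖ ^ 2
  set G : ℝ := (Int.gcd A g : ℝ)
  have hG : 1 ≤ G := by
    have : 0 < Int.gcd A g := Int.gcd_pos_of_ne_zero_right _ (by exact_mod_cast hg0.ne')
    have h' : (1 : ℝ) ≤ (Int.gcd A g : ℝ) := by exact_mod_cast this
    exact h'
  have h4 : (4 : ℝ) ^ g.primeFactors.card ≤ L ^ 2 := by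
    have : g.divisors.card = 2 ^ g.primeFactors.card := by
      rw [Nat.card_divisors hg0.ne']
      rw [← Finset.prod_const]
      refine Finset.prod_congr rfl fun p hp => ?_
      rw [Nat.factorization_eq_one_of_squarefree hg (Nat.prime_of_mem_primeFactors hp)
        (Nat.dvd_of_mem_primeFactors hp)]
    have e : (4 : ℝ) ^ g.primeFactors.card = (g.divisors.card : ℝ) ^ 2 := by
      rw [this]; push_cast; rw [← pow_mul, mul_comm, pow_mul]; norm_num
    rw [e]; gcongr
  have hlog : 0 ≤ Real.log g := Real.log_natCast_nonneg g
  have hM : B / g + 1 + 2 * g * (1 + Real.log g) ≤ L * (B / g + 3 * g) := by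
    have h1 : B / g ≤ L * (B / g) := le_mul_of_one_le_left (by positivity) hL1
    have h2 : 2 * g * (1 + Real.log g) ≤ 2 * g * L := by gcongr
    nlinarith
  have hKpos : (0 : ℝ) < K ^ 2 := by positivity
  rw [← mul_le_mul_iff_right₀ hKpos]
  refine hpre.trans ?_
  have h5 : 2 * (K:ℝ) ^ 2 * g.divisors.card * 4 ^ g.primeFactors.card * G *
        (B / g + 1 + 2 * g * (1 + Real.log g)) ≤ 2 * (K:ℝ) ^ 2 * L * L ^ 2 * G * (L * (B / g + 3 * g)) := by
    gcongr
  have h6 : K * B ≤ K * (2 * K * m) := by gcongr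
  have h7 : K * (2 * K * m) ≤ 2 * (K:ℝ) ^ 2 * (L ^ 4 * G * m) := by
    have : (1:ℝ) ≤ L ^ 4 * G := one_le_mul_of_one_le_of_one_le (one_le_pow₀ hL1) hG
    calc K * (2 * K * m) = 2 * (K:ℝ) ^ 2 * (1 * m) := by ring
      _ ≤ _ := by gcongr
  calc 2 * B * (K * B + 2 * K ^ 2 * g.divisors.card * 4 ^ g.primeFactors.card * G *
        (B / g + 1 + 2 * g * (1 + Real.log g)))
      ≤ 2 * B * (2 * (K:ℝ) ^ 2 * (L ^ 4 * G * m) + 2 * (K:ℝ) ^ 2 * L * L ^ 2 * G * (L * (B / g + 3 * g))) := by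
        refine mul_le_mul_of_nonneg_left (add_le_add (h6.trans h7) h5) (by positivity)
    _ = (K:ℝ)^2 * (4 * L ^ 4 * G * (B * m + B ^ 2 / g + 3 * (B * g))) := by
        field_simp; ring
    _ ≤ (K:ℝ)^2 * (12 * L ^ 4 * G * (B * m + B ^ 2 / g + B * g)) := by
        have : 0 ≤ L ^ 4 * G * (B * m + B^2 / g) := by positivity
        gcongr ?_ * ?_
        nlinarith

end

section

/-- nonzero frequencies -/
def Hs (H : ℕ) : Finset ℤ := (Finset.Icc (-(H : ℤ)) H).erase 0

lemma Hs_card (H : ℕ) : (Hs H).card = 2 * H := by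
  unfold Hs
  rw [Finset.card_erase_of_mem (by simp), Int.card_Icc]; omega

lemma mem_Hs {H : ℕ} {h : ℤ} : h ∈ Hs H ↔ h ≠ 0 ∧ -(H : ℤ) ≤ h ∧ h ≤ H := by
  simp [Hs]

def om (P : Finset (ℕ × ℕ)) (H : ℕ) : Finset ((ℕ × ℕ) × ℤ) := P ×ˢ Hs H

def ph2 (x : (ℕ × ℕ) × ℤ) : ℤ := x.2 * ((x.1.1 * x.1.2 : ℕ) : ℤ) ^ 2

structure PData (P : Finset (ℕ × ℕ)) (H : ℕ) (N Lim L : ℝ) : Prop where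
  pos : ∀ p ∈ P, 0 < p.1 ∧ 0 < p.2
  le : ∀ p ∈ P, ((p.1 * p.2 : ℕ) : ℝ) ≤ N
  card : (P.card : ℝ) ≤ N
  N1 : 1 ≤ N
  L1 : 1 ≤ L
  lim : (H : ℝ) * N ^ 2 ≤ Lim
  tau : ∀ n : ℕ, 0 < n → (n : ℝ) ≤ Lim → (n.divisors.card : ℝ) ≤ L

variable {P : Finset (ℕ × ℕ)} {H : ℕ} {N Lim L : ℝ}

lemma PData.om_card (d : PData P H N Lim L) : ((om P H).card : ℝ) ≤ 2 * H * N := by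
  unfold om
  rw [Finset.card_product, Hs_card]
  push_cast
  have := d.card
  nlinarith [Nat.cast_nonneg (α := ℝ) H]

lemma PData.ph2_ne (d : PData P H N Lim L) {x} (hx : x ∈ om P H) : ph2 x ≠ 0 := by
  unfold om at hx
  rw [Finset.mem_product, mem_Hs] at hx
  have := d.pos _ hx.1
  unfold ph2
  have h2 : ((x.1.1 * x.1.2 : ℕ) : ℤ) ≠ 0 := by
    exact_mod_cast (Nat.mul_pos this.1 this.2).ne'
  exact mul_ne_zero hx.2.1 (pow_ne_zero _ h2)

lemma PData.ph2_le (d : PData P H N Lim L) {x} (hx : x ∈ om P H) : |(ph2 x : ℝ)| ≤ H * N ^ 2 := by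
  unfold om at hx
  rw [Finset.mem_product, mem_Hs] at hx
  have := d.le _ hx.1
  unfold ph2
  push_cast at this ⊢
  have h1 : |(x.2 : ℝ)| ≤ H := by
    rw [abs_le]; constructor
    · exact_mod_cast hx.2.2.1
    · exact_mod_cast hx.2.2.2
  rw [abs_mul, abs_of_nonneg (a := ((x.1.1 : ℝ) * x.1.2) ^ 2) (by positivity)]
  have h0 : (0:ℝ) ≤ (x.1.1 : ℝ) * x.1.2 := by positivity
  gcongr

lemma PData.fiber (d : PData P H N Lim L) (M : ℤ) :
    (((om P H).filter (fun y => ph2 y = M)).card : ℝ) ≤ L ^ 2 := by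
  by_cases hemp : ((om P H).filter (fun y => ph2 y = M)) = ∅
  · rw [hemp]; simp; positivity
  obtain ⟨y0, hy0⟩ := Finset.nonempty_iff_ne_empty.2 hemp
  rw [Finset.mem_filter] at hy0
  have hM0 : M ≠ 0 := hy0.2 ▸ d.ph2_ne hy0.1
  have hMle : |(M : ℝ)| ≤ Lim := by
    rw [← hy0.2]; exact (d.ph2_le hy0.1).trans d.lim
  have hτ : (M.natAbs.divisors.card : ℝ) ≤ L := by
    refine d.tau _ (Int.natAbs_pos.2 hM0) ?_
    rw [Nat.cast_natAbs]; push_cast; exact hMle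
  have : ((om P H).filter (fun y => ph2 y = M)).card ≤
      (M.natAbs.divisors ×ˢ M.natAbs.divisors).card := by
    refine Finset.card_le_card_of_injOn (fun y => y.1) ?_ ?_
    · intro y hy
      rw [Finset.mem_coe, Finset.mem_filter] at hy
      have hdvd : ∀ n : ℕ, n ∣ y.1.1 * y.1.2 → n ∣ M.natAbs := by
        intro n hn
        rw [← Int.natCast_dvd, ← hy.2]
        unfold ph2
        exact Dvd.dvd.mul_left (Dvd.dvd.pow (by exact_mod_cast hn) (by norm_num)) _
      rw [Finset.mem_coe, Finset.mem_product, Nat.mem_divisors, Nat.mem_divisors]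
      exact ⟨⟨hdvd _ (Dvd.intro _ rfl), Int.natAbs_ne_zero.2 hM0⟩,
        ⟨hdvd _ (Dvd.intro_left _ rfl), Int.natAbs_ne_zero.2 hM0⟩⟩
    · intro y hy y' hy' h
      rw [Finset.mem_coe, Finset.mem_filter] at hy hy'
      have hp := d.pos _ (Finset.mem_product.1 hy.1).1
      have h1 : ph2 y = ph2 y' := hy.2.trans hy'.2.symm
      have h' : y.1 = y'.1 := h
      unfold ph2 at h1
      rw [← h'] at h1
      have h2 : ((y.1.1 * y.1.2 : ℕ) : ℤ) ^ 2 ≠ 0 :=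
        pow_ne_zero _ (by exact_mod_cast (Nat.mul_pos hp.1 hp.2).ne')
      exact Prod.ext h' (mul_right_cancel₀ h2 h1)
  calc _ ≤ ((M.natAbs.divisors ×ˢ M.natAbs.divisors).card : ℝ) := by exact_mod_cast this
    _ = (M.natAbs.divisors.card : ℝ) ^ 2 := by rw [Finset.card_product]; push_cast; ring
    _ ≤ L ^ 2 := by gcongr

lemma PData.diag (d : PData P H N Lim L) :
    ∑ x ∈ om P H, (((om P H).filter (fun y => ph2 x - ph2 y = 0)).card : ℝ) ≤ 2 * H * N * L ^ 2 := by
  have : ∀ x ∈ om P H, (((om P H).filter (fun y => ph2 x - ph2 y = 0)).card : ℝ) ≤ L ^ 2 := by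
    intro x _
    refine le_trans (le_of_eq ?_) (d.fiber (ph2 x))
    congr 2; ext y; simp only [Finset.mem_filter]; constructor <;> rintro ⟨h1, h2⟩ <;> exact ⟨h1, by omega⟩
  refine (Finset.sum_le_card_nsmul _ _ _ this).trans ?_
  rw [nsmul_eq_mul]
  have := d.om_card
  gcongr

lemma PData.cnt2 (d : PData P H N Lim L) (e : ℕ) (he : 0 < e) :
    ∑ x ∈ om P H, (((om P H).filter (fun y => ph2 x - ph2 y ≠ 0 ∧ (e : ℤ) ∣ ph2 x - ph2 y)).card : ℝ)
      ≤ 2 * H * N * (4 * H * N ^ 2 / e * L ^ 2) := by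
  have heR : (0 : ℝ) < e := by exact_mod_cast he
  have hL1 := d.L1
  have key : ∀ x ∈ om P H, (((om P H).filter
      (fun y => ph2 x - ph2 y ≠ 0 ∧ (e : ℤ) ∣ ph2 x - ph2 y)).card : ℝ) ≤ 4 * H * N ^ 2 / e * L ^ 2 := by
    intro x hx
    set k0 : ℕ := ⌊2 * H * N ^ 2 / e⌋₊
    have hk0 : (k0 : ℝ) ≤ 2 * H * N ^ 2 / e := Nat.floor_le (by positivity)
    have hsub : (om P H).filter (fun y => ph2 x - ph2 y ≠ 0 ∧ (e : ℤ) ∣ ph2 x - ph2 y) ⊆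
        (Hs k0).biUnion (fun k => (om P H).filter (fun y => ph2 y = ph2 x - e * k)) := by
      intro y hy
      rw [Finset.mem_filter] at hy
      obtain ⟨hy1, hy2, k, hk⟩ := hy
      rw [Finset.mem_biUnion]
      refine ⟨k, ?_, Finset.mem_filter.2 ⟨hy1, by linarith⟩⟩
      rw [mem_Hs]
      have hk1 : k ≠ 0 := by rintro rfl; simp at hk; exact hy2 hk
      have h1 : |(k : ℝ)| ≤ 2 * H * N ^ 2 / e := by
        rw [le_div_iff₀ heR]
        have h2 := d.ph2_le hx
        have h3 := d.ph2_le hy1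
        have h4 : (ph2 x : ℝ) - ph2 y = e * k := by exact_mod_cast hk
        have h5 : |(k : ℝ)| * e = |(ph2 x : ℝ) - ph2 y| := by
          rw [h4, abs_mul, abs_of_pos heR, mul_comm]
        rw [h5]
        have := abs_sub (ph2 x : ℝ) (ph2 y)
        linarith
      have h2 : (k.natAbs : ℝ) ≤ 2 * H * N ^ 2 / e := by
        rw [Nat.cast_natAbs]; push_cast; exact h1
      have h3 : k.natAbs ≤ k0 := Nat.le_floor h2
      exact ⟨hk1, by omega, by omega⟩
    have h1 := (Finset.card_le_card hsub).trans Finset.card_biUnion_le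
    calc _ ≤ ((∑ k ∈ Hs k0, ((om P H).filter (fun y => ph2 y = ph2 x - e * k)).card : ℕ) : ℝ) := by
          exact_mod_cast h1
      _ ≤ ∑ k ∈ Hs k0, L ^ 2 := by
          push_cast; exact Finset.sum_le_sum fun k _ => d.fiber _
      _ = 2 * k0 * L ^ 2 := by rw [Finset.sum_const, Hs_card, nsmul_eq_mul]; push_cast; ring
      _ ≤ 2 * (2 * H * N ^ 2 / e) * L ^ 2 := by gcongr
      _ = _ := by ring
  refine (Finset.sum_le_card_nsmul _ _ _ key).trans ?_
  rw [nsmul_eq_mul]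
  have := d.om_card
  gcongr

lemma PData.cnt1 (d : PData P H N Lim L) (e : ℕ) (he : 0 < e)
    (hc : ∀ p ∈ P, (p.1 * p.2).Coprime e) :
    ∑ x ∈ om P H, (((om P H).filter (fun y => ph2 x - ph2 y ≠ 0 ∧ (e : ℤ) ∣ ph2 x - ph2 y)).card : ℝ)
      ≤ 2 * H * N * (N * ((2 * H + 1) / e + 1)) := by
  have heR : (0 : ℝ) < e := by exact_mod_cast he
  have hN := d.N1
  have key : ∀ x ∈ om P H, (((om P H).filter
      (fun y => ph2 x - ph2 y ≠ 0 ∧ (e : ℤ) ∣ ph2 x - ph2 y)).card : ℝ) ≤ N * ((2 * H + 1) / e + 1) := by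
    intro x hx
    have hsub : (om P H).filter (fun y => ph2 x - ph2 y ≠ 0 ∧ (e : ℤ) ∣ ph2 x - ph2 y) ⊆
        P.biUnion (fun p => ((Finset.Ico (-(H : ℤ)) (H + 1)).filter
          (fun h => h ≡ ph2 x * iv e (((p.1 * p.2 : ℕ) : ℤ) ^ 2) [ZMOD e])).image (fun h => (p, h))) := by
      intro y hy
      rw [Finset.mem_filter] at hy
      obtain ⟨hy1, _, hk⟩ := hy
      have hy3 := Finset.mem_product.1 hy1
      have hy4 := mem_Hs.1 hy3.2
      rw [Finset.mem_biUnion]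
      refine ⟨y.1, hy3.1, ?_⟩
      rw [Finset.mem_image]
      refine ⟨y.2, Finset.mem_filter.2 ⟨Finset.mem_Ico.2 ⟨hy4.2.1, by omega⟩, ?_⟩, rfl⟩
      have hinv : (((y.1.1 * y.1.2 : ℕ) : ℤ) ^ 2) * iv e (((y.1.1 * y.1.2 : ℕ) : ℤ) ^ 2) ≡ 1 [ZMOD e] := by
        refine iv_spec ?_
        rw [← Int.isCoprime_iff_gcd_eq_one]
        exact (Nat.isCoprime_iff_coprime.2 (hc _ hy3.1)).pow_left
      have h1 : ph2 y ≡ ph2 x [ZMOD e] := Int.modEq_iff_dvd.2 hk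
      have h2 := h1.mul_right (iv e (((y.1.1 * y.1.2 : ℕ) : ℤ) ^ 2))
      have h3 := hinv.mul_left y.2
      refine Int.ModEq.trans ?_ h2
      unfold ph2
      rw [mul_one] at h3
      rw [mul_assoc]; exact h3.symm
    have h1 := (Finset.card_le_card hsub).trans Finset.card_biUnion_le
    calc _ ≤ ((∑ p ∈ P, (((Finset.Ico (-(H : ℤ)) (H + 1)).filter
          (fun h => h ≡ ph2 x * iv e (((p.1 * p.2 : ℕ) : ℤ) ^ 2) [ZMOD e])).image (fun h => (p, h))).card : ℕ) : ℝ) := by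
          exact_mod_cast h1
      _ ≤ ∑ p ∈ P, ((2 * H + 1 : ℝ) / e + 1) := by
          push_cast
          refine Finset.sum_le_sum fun p _ => ?_
          refine le_trans (Nat.cast_le.2 Finset.card_image_le) ?_
          refine card_modEq_le e he _ _ _ _ (by positivity) ?_
          push_cast; linarith
      _ = P.card * ((2 * H + 1 : ℝ) / e + 1) := by rw [Finset.sum_const, nsmul_eq_mul]
      _ ≤ _ := by have := d.card; gcongr
  refine (Finset.sum_le_card_nsmul _ _ _ key).trans ?_
  rw [nsmul_eq_mul]
  have := d.om_card
  gcongr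

lemma PData.cnt (d : PData P H N Lim L) (e : ℕ) (he : 0 < e)
    (hc : ∀ p ∈ P, (p.1 * p.2).Coprime e) :
    Real.sqrt e * ∑ x ∈ om P H, (((om P H).filter (fun y => ph2 x - ph2 y ≠ 0 ∧ (e : ℤ) ∣ ph2 x - ph2 y)).card : ℝ)
      ≤ 8 * L ^ 2 * N ^ 2 * (H ^ 2 + H * N) := by
  have heR : (1 : ℝ) ≤ e := by exact_mod_cast he
  have hN := d.N1
  have hL := d.L1
  have hL2 : 1 ≤ L ^ 2 := one_le_pow₀ hL
  set s := Real.sqrt e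
  have hs1 : 1 ≤ s := Real.one_le_sqrt.2 heR
  have hss : s * s = e := Real.mul_self_sqrt (by linarith)
  have hH : (H : ℝ) ≤ H ^ 2 := by exact_mod_cast Nat.le_self_pow (by norm_num) H
  rcases le_total s N with hsN | hsN
  · refine (mul_le_mul_of_nonneg_left (d.cnt1 e he hc) (by positivity)).trans ?_
    have e1 : s * (2 * H * N * (N * ((2 * H + 1) / e + 1))) =
        N ^ 2 * (2 * H * ((2 * H + 1) / s + s)) := by
      rw [← hss]; field_simp
    rw [e1]
    have h1 : (2 * H + 1 : ℝ) / s ≤ 2 * H + 1 := div_le_self (by positivity) hs1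
    calc N ^ 2 * (2 * H * ((2 * H + 1) / s + s)) ≤ N ^ 2 * (2 * H * ((2 * H + 1) + N)) := by gcongr
      _ ≤ N ^ 2 * (8 * 1 * (H ^ 2 + H * N)) := by
        have : (0:ℝ) ≤ H * N := by positivity
        gcongr ?_ * ?_
        nlinarith
      _ ≤ N ^ 2 * (8 * L ^ 2 * (H ^ 2 + H * N)) := by gcongr
      _ = _ := by ring
  · refine (mul_le_mul_of_nonneg_left (d.cnt2 e he) (by positivity)).trans ?_
    have e1 : s * (2 * H * N * (4 * H * N ^ 2 / e * L ^ 2)) =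
        8 * L ^ 2 * N ^ 2 * (H ^ 2 * (N / s)) := by
      rw [← hss]; field_simp; ring
    rw [e1]
    have h1 : N / s ≤ 1 := (div_le_one (by positivity)).2 hsN
    have : (H:ℝ) ^ 2 * (N / s) ≤ H ^ 2 + H * N := by
      have : (0:ℝ) ≤ H * N := by positivity
      nlinarith [sq_nonneg (H:ℝ)]
    gcongr

lemma PData.sumgcd (d : PData P H N Lim L) (g : ℕ) (hg : 0 < g) (hgL : (g : ℝ) ≤ Lim)
    (hc : ∀ p ∈ P, (p.1 * p.2).Coprime g) :
    ∑ x ∈ om P H, ∑ y ∈ (om P H).filter (fun y => ph2 x - ph2 y ≠ 0),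
      Real.sqrt (Int.gcd (ph2 x - ph2 y) g)
      ≤ 8 * L ^ 3 * N ^ 2 * (H ^ 2 + H * N) := by
  have hN := d.N1
  have hL := d.L1
  have h1 : ∀ x ∈ om P H, ∀ y ∈ (om P H).filter (fun y => ph2 x - ph2 y ≠ 0),
      Real.sqrt (Int.gcd (ph2 x - ph2 y) g) ≤
      ∑ e ∈ g.divisors, if (e : ℤ) ∣ ph2 x - ph2 y then Real.sqrt e else 0 := by
    intro x _ y _
    have hmem : Int.gcd (ph2 x - ph2 y) g ∈ g.divisors := by
      rw [Nat.mem_divisors]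
      exact ⟨by exact_mod_cast Int.gcd_dvd_right (ph2 x - ph2 y) (g : ℤ), hg.ne'⟩
    have := Finset.single_le_sum (f := fun e : ℕ => if (e : ℤ) ∣ ph2 x - ph2 y then Real.sqrt e else 0)
      (fun e _ => by split_ifs <;> positivity) hmem
    rwa [if_pos (Int.gcd_dvd_left _ _)] at this
  calc _ ≤ ∑ x ∈ om P H, ∑ y ∈ (om P H).filter (fun y => ph2 x - ph2 y ≠ 0),
        ∑ e ∈ g.divisors, (if (e : ℤ) ∣ ph2 x - ph2 y then Real.sqrt e else 0) :=
        Finset.sum_le_sum fun x hx => Finset.sum_le_sum fun y hy => h1 x hx y hy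
    _ = ∑ e ∈ g.divisors, Real.sqrt e * ∑ x ∈ om P H,
        (((om P H).filter (fun y => ph2 x - ph2 y ≠ 0 ∧ (e : ℤ) ∣ ph2 x - ph2 y)).card : ℝ) := by
        have : ∀ x ∈ om P H, ∑ y ∈ (om P H).filter (fun y => ph2 x - ph2 y ≠ 0),
          ∑ e ∈ g.divisors, (if (e : ℤ) ∣ ph2 x - ph2 y then Real.sqrt e else 0) =
          ∑ e ∈ g.divisors, Real.sqrt e *
          (((om P H).filter (fun y => ph2 x - ph2 y ≠ 0 ∧ (e : ℤ) ∣ ph2 x - ph2 y)).card : ℝ) := by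
          intro x _
          rw [Finset.sum_comm]
          refine Finset.sum_congr rfl fun e _ => ?_
          rw [← Finset.sum_filter, Finset.filter_filter, Finset.sum_const, nsmul_eq_mul, mul_comm]
        rw [Finset.sum_congr rfl this, Finset.sum_comm]
        simp_rw [Finset.mul_sum]
    _ ≤ ∑ e ∈ g.divisors, 8 * L ^ 2 * N ^ 2 * (H ^ 2 + H * N) := by
        refine Finset.sum_le_sum fun e he => ?_
        have he' := Nat.dvd_of_mem_divisors he
        exact d.cnt e (Nat.pos_of_dvd_of_pos he' hg) fun p hp => (hc p hp).coprime_dvd_right he'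
    _ = g.divisors.card * (8 * L ^ 2 * N ^ 2 * (H ^ 2 + H * N)) := by
        rw [Finset.sum_const, nsmul_eq_mul]
    _ ≤ L * (8 * L ^ 2 * N ^ 2 * (H ^ 2 + H * N)) := by
        have := d.tau g hg hgL
        gcongr
    _ = _ := by ring

end

section

lemma modEq_of_eq {n a b : ℤ} (h : a = b) : a ≡ b [ZMOD n] := h ▸ rfl

lemma kl_congr_u (g : ℕ) (hg : 0 < g) (A : ℤ) {u u' : ℤ} (h : u ≡ u' [ZMOD (g ^ 2 : ℕ)]) :
    kl g A u = kl g A u' := by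
  have h1 : u ≡ u' [ZMOD g] := h.of_dvd (by push_cast; exact Dvd.intro _ (sq _).symm)
  have hgcd : Int.gcd u g = Int.gcd u' g := by
    obtain ⟨k, hk⟩ := h1.dvd
    have : u' = u + g * k := by linarith
    rw [this, gcd_add_mul]
  unfold kl
  rw [hgcd]
  split_ifs with h2
  · have hu := iv_spec (gcd_sq_one (hgcd.trans h2))
    have hu' := iv_spec (gcd_sq_one h2)
    have h3 : u * iv (g ^ 2) u' ≡ 1 [ZMOD (g ^ 2 : ℕ)] := (h.mul_right _).trans hu'
    exact ee_congr (by positivity) ((iv_uniq hu h3).mul_left A)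
  · rfl

lemma kl_mul_conj (g : ℕ) (A A' u : ℤ) :
    kl g A u * (starRingEnd ℂ) (kl g A' u) = kl g (A - A') u := by
  unfold kl
  split_ifs with h
  · rw [← ee_sub]; congr 1; push_cast; ring
  · simp

lemma gcd_mul_one {g1 g2 : ℕ} {u : ℤ} : Int.gcd u ((g1 * g2 : ℕ) : ℤ) = 1 ↔
    Int.gcd u g1 = 1 ∧ Int.gcd u g2 = 1 := by
  rw [← Int.isCoprime_iff_gcd_eq_one, ← Int.isCoprime_iff_gcd_eq_one, ← Int.isCoprime_iff_gcd_eq_one]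
  push_cast
  exact IsCoprime.mul_right_iff

lemma cop_sq {g1 g2 : ℕ} (h : g1.Coprime g2) : Int.gcd ((g2 : ℤ) ^ 2) ((g1 ^ 2 : ℕ) : ℤ) = 1 := by
  rw [← Int.isCoprime_iff_gcd_eq_one]
  push_cast
  exact ((Nat.isCoprime_iff_coprime.2 h.symm)).pow

/-- a phase modulo `(g1 g2)^2` splits. -/
lemma ee_split {g1 g2 : ℕ} (h1 : 0 < g1) (h2 : 0 < g2) (h : g1.Coprime g2) (x : ℤ) :
    ee ((x : ℝ) / (((g1 * g2) ^ 2 : ℕ) : ℝ)) =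
    ee (((x * iv (g1 ^ 2) ((g2 : ℤ) ^ 2) : ℤ) : ℝ) / ((g1 ^ 2 : ℕ) : ℝ)) *
    ee (((x * iv (g2 ^ 2) ((g1 : ℤ) ^ 2) : ℤ) : ℝ) / ((g2 ^ 2 : ℕ) : ℝ)) := by
  rw [← ee_add]
  set i1 := iv (g1 ^ 2) ((g2 : ℤ) ^ 2)
  set i2 := iv (g2 ^ 2) ((g1 : ℤ) ^ 2)
  have e1 : (g2 : ℤ) ^ 2 * i1 ≡ 1 [ZMOD (g1 ^ 2 : ℕ)] := iv_spec (cop_sq h)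
  have e2 : (g1 : ℤ) ^ 2 * i2 ≡ 1 [ZMOD (g2 ^ 2 : ℕ)] := iv_spec (cop_sq h.symm)
  have e3 : (g2 : ℤ) ^ 2 * i1 + (g1 : ℤ) ^ 2 * i2 ≡ 1 [ZMOD ((g1 * g2) ^ 2 : ℕ)] := by
    have hc : IsCoprime (((g1 ^ 2 : ℕ) : ℤ)) ((g2 ^ 2 : ℕ) : ℤ) := by
      push_cast; exact ((Nat.isCoprime_iff_coprime.2 h)).pow
    have f1 : (g2 : ℤ) ^ 2 * i1 + (g1 : ℤ) ^ 2 * i2 ≡ 1 + 0 [ZMOD (g1 ^ 2 : ℕ)] := by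
      refine e1.add ?_
      rw [Int.modEq_zero_iff_dvd]; push_cast; exact Dvd.intro _ rfl
    have f2 : (g2 : ℤ) ^ 2 * i1 + (g1 : ℤ) ^ 2 * i2 ≡ 0 + 1 [ZMOD (g2 ^ 2 : ℕ)] := by
      refine Int.ModEq.add ?_ e2
      rw [Int.modEq_zero_iff_dvd]; push_cast; exact Dvd.intro _ rfl
    rw [add_zero] at f1
    rw [zero_add] at f2
    rw [Int.modEq_iff_dvd] at f1 f2 ⊢
    have := hc.mul_dvd f1 f2
    have e : (((g1 * g2) ^ 2 : ℕ) : ℤ) = ((g1 ^ 2 : ℕ) : ℤ) * ((g2 ^ 2 : ℕ) : ℤ) := by push_cast; ring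
    rw [e]; exact this
  have e4 := ee_congr (q := (g1 * g2) ^ 2) (by positivity) (e3.mul_left x)
  rw [mul_one] at e4
  rw [← e4]
  congr 1
  have : (g1 : ℝ) ≠ 0 := by positivity
  have : (g2 : ℝ) ≠ 0 := by positivity
  push_cast
  field_simp

/-- evaluation of `kl` through any solution `c` of `u c ≡ a`. -/
lemma kl_eval {g : ℕ} (hg : 0 < g) {a c u : ℤ} (B : ℤ) (hu : Int.gcd u g = 1)
    (hc : u * c ≡ a [ZMOD (g ^ 2 : ℕ)]) :
    kl g (B * a) u = ee (((B * c : ℤ) : ℝ) / ((g ^ 2 : ℕ) : ℝ)) := by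
  unfold kl
  rw [if_pos hu]
  refine ee_congr (by positivity) ?_
  have h1 := iv_spec (gcd_sq_one hu)
  set x := iv (g ^ 2) u
  have h2 : B * a * x ≡ B * (u * c) * x [ZMOD (g ^ 2 : ℕ)] := ((hc.symm.mul_left B).mul_right x)
  have h3 : B * (u * c) * x ≡ B * c [ZMOD (g ^ 2 : ℕ)] := by
    have : B * (u * c) * x = B * c * (u * x) := by ring
    rw [this]
    simpa using h1.mul_left (B * c)
  exact h2.trans h3

lemma kl_split {g1 g2 : ℕ} (h1 : 0 < g1) (h2 : 0 < g2) (h : g1.Coprime g2) (A u : ℤ) :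
    kl (g1 * g2) A u = kl g1 (A * iv (g1 ^ 2) ((g2 : ℤ) ^ 2)) u *
      kl g2 (A * iv (g2 ^ 2) ((g1 : ℤ) ^ 2)) u := by
  by_cases hu : Int.gcd u ((g1 * g2 : ℕ) : ℤ) = 1
  · have hu' := gcd_mul_one.1 hu
    have hc := iv_spec (gcd_sq_one hu)
    set c := iv ((g1 * g2) ^ 2) u
    have hc1 : u * c ≡ 1 [ZMOD (g1 ^ 2 : ℕ)] := hc.of_dvd (by push_cast; exact ⟨(g2:ℤ) ^ 2, by ring⟩)
    have hc2 : u * c ≡ 1 [ZMOD (g2 ^ 2 : ℕ)] := hc.of_dvd (by push_cast; exact ⟨(g1:ℤ) ^ 2, by ring⟩)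
    have e1 := kl_eval h1 (A * iv (g1 ^ 2) ((g2 : ℤ) ^ 2)) hu'.1 hc1
    have e2 := kl_eval h2 (A * iv (g2 ^ 2) ((g1 : ℤ) ^ 2)) hu'.2 hc2
    rw [mul_one] at e1 e2
    rw [e1, e2]
    unfold kl
    rw [if_pos hu, ee_split h1 h2 h]
    congr 3 <;> push_cast <;> ring
  · have hu' : ¬ (Int.gcd u g1 = 1 ∧ Int.gcd u g2 = 1) := fun h => hu (gcd_mul_one.2 h)
    have e : kl (g1 * g2) A u = 0 := by unfold kl; rw [if_neg hu]
    rw [e]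
    rw [not_and_or] at hu'
    rcases hu' with h | h
    · have : ∀ B, kl g1 B u = 0 := fun B => by unfold kl; rw [if_neg h]
      rw [this, zero_mul]
    · have : ∀ B, kl g2 B u = 0 := fun B => by unfold kl; rw [if_neg h]
      rw [this, mul_zero]

/-- the bilinear phase: `ρ` modulus attached to `u1`, `t` modulus attached to `u2` -/
def phs (a : ℤ) (ρ t : ℕ) (h u1 u2 : ℤ) : ℂ :=
  kl ρ (h * iv (ρ ^ 2) ((t : ℤ) ^ 2) * a) u1 * kl t (h * iv (t ^ 2) ((ρ : ℤ) ^ 2) * a) u2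

lemma phs_eval {a : ℤ} {ρ t : ℕ} (hρ : 0 < ρ) (ht : 0 < t) (hc : ρ.Coprime t) (h : ℤ) {u1 u2 c : ℤ}
    (h1 : Int.gcd u1 ρ = 1) (h2 : Int.gcd u2 t = 1) (e1 : u1 * c ≡ a [ZMOD (ρ ^ 2 : ℕ)])
    (e2 : u2 * c ≡ a [ZMOD (t ^ 2 : ℕ)]) :
    phs a ρ t h u1 u2 = ee (((h * c : ℤ) : ℝ) / (((ρ * t) ^ 2 : ℕ) : ℝ)) := by
  unfold phs
  rw [kl_eval hρ _ h1 e1, kl_eval ht _ h2 e2, ee_split hρ ht hc]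
  congr 3 <;> push_cast <;> ring

/-- the amplitude with respect to `g` -/
def Ag (a : ℤ) (G g z t : ℕ) (h : ℤ) : ℤ :=
  h * iv ((g * (G * z)) ^ 2) ((t : ℤ) ^ 2) * a * iv (g ^ 2) (((G * z : ℕ) : ℤ) ^ 2)

def Fg (a : ℤ) (G g z t : ℕ) (h s u : ℤ) : ℂ :=
  kl (G * z) (h * iv ((g * (G * z)) ^ 2) ((t : ℤ) ^ 2) * a * iv ((G * z) ^ 2) ((g : ℤ) ^ 2)) u *
    kl t (h * iv (t ^ 2) (((g * (G * z) : ℕ) : ℤ) ^ 2) * a) (u + s)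

lemma phs_factor (a : ℤ) (G g z t : ℕ) (h s u : ℤ) (hg : 0 < g) (hGz : 0 < G * z)
    (hc : g.Coprime (G * z)) :
    phs a (g * (G * z)) t h u (u + s) = Fg a G g z t h s u * kl g (Ag a G g z t h) u := by
  unfold phs Fg Ag
  rw [kl_split hg hGz hc]; ring

lemma Fg_norm (a : ℤ) (G g z t : ℕ) (h s u : ℤ) : ‖Fg a G g z t h s u‖ ≤ 1 := by
  unfold Fg
  rw [norm_mul]
  exact mul_le_one₀ (kl_norm _ _ _) (norm_nonneg _) (kl_norm _ _ _)

lemma Fg_per (a : ℤ) (G g z t : ℕ) (h s u : ℤ) (hGz : 0 < G * z) (ht : 0 < t) (m : ℕ)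
    (hm : (G * z * t) ^ 2 ∣ m) : Fg a G g z t h s (u + m) = Fg a G g z t h s u := by
  unfold Fg
  congr 1
  · refine kl_congr_u _ hGz _ ?_
    have : (((G * z) ^ 2 : ℕ) : ℤ) ∣ (m : ℤ) := by
      have h1 : (G * z) ^ 2 ∣ m := (Dvd.intro (t ^ 2) (by ring)).trans hm
      exact_mod_cast h1
    have h2 : u + (m : ℤ) ≡ u + 0 [ZMOD ((G * z) ^ 2 : ℕ)] :=
      Int.ModEq.add_left _ (Int.modEq_zero_iff_dvd.2 this)
    simpa using h2
  · refine kl_congr_u _ ht _ ?_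
    have : ((t ^ 2 : ℕ) : ℤ) ∣ (m : ℤ) := by
      have h1 : t ^ 2 ∣ m := (Dvd.intro_left ((G * z) ^ 2) (by ring)).trans hm
      exact_mod_cast h1
    have h2 : u + s + (m : ℤ) ≡ u + s + 0 [ZMOD (t ^ 2 : ℕ)] :=
      Int.ModEq.add_left _ (Int.modEq_zero_iff_dvd.2 this)
    have e : u + m + s = u + s + m := by ring
    rw [e]; simpa using h2

lemma Ag_spec (a : ℤ) (G g z t : ℕ) (h : ℤ) (hc : g.Coprime (G * z)) (ht : (g * (G * z)).Coprime t) :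
    Ag a G g z t h * ((G * z * t : ℕ) : ℤ) ^ 2 ≡ h * a [ZMOD g] := by
  have e1 : (t : ℤ) ^ 2 * iv ((g * (G * z)) ^ 2) ((t : ℤ) ^ 2) ≡ 1 [ZMOD g] := by
    refine (iv_spec (cop_sq ht)).of_dvd ?_
    push_cast; exact ⟨(g : ℤ) * (G * z) ^ 2, by ring⟩
  have e2 : (((G * z : ℕ) : ℤ) ^ 2) * iv (g ^ 2) (((G * z : ℕ) : ℤ) ^ 2) ≡ 1 [ZMOD g] := by
    refine (iv_spec (cop_sq hc)).of_dvd ?_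
    push_cast; exact ⟨(g : ℤ), by ring⟩
  have e3 := (e1.mul e2).mul_left (h * a)
  unfold Ag
  refine Int.ModEq.trans ?_ (by simpa using e3)
  refine modEq_of_eq ?_
  push_cast; ring

lemma gcd_Ag_le (a : ℤ) (G g z t z' t' : ℕ) (h h' : ℤ) (hg : 0 < g)
    (hc : g.Coprime (G * z)) (ht : (g * (G * z)).Coprime t)
    (hc' : g.Coprime (G * z')) (ht' : (g * (G * z')).Coprime t') (ha : Int.gcd a g = 1) :
    Int.gcd (Ag a G g z t h - Ag a G g z' t' h') g ≤
      Int.gcd (h * ((z' * t' : ℕ) : ℤ) ^ 2 - h' * ((z * t : ℕ) : ℤ) ^ 2) g := by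
  have s1 := Ag_spec a G g z t h hc ht
  have s2 := Ag_spec a G g z' t' h' hc' ht'
  set A := Ag a G g z t h
  set A' := Ag a G g z' t' h'
  set Δ := h * ((z' * t' : ℕ) : ℤ) ^ 2 - h' * ((z * t : ℕ) : ℤ) ^ 2 with hΔ
  have h1 : (A - A') * (((G * z * t : ℕ) : ℤ) ^ 2 * ((G * z' * t' : ℕ) : ℤ) ^ 2) ≡
      (a * (G : ℤ) ^ 2) * Δ [ZMOD g] := by
    have f1 := s1.mul_right (((G * z' * t' : ℕ) : ℤ) ^ 2)
    have f2 := s2.mul_right (((G * z * t : ℕ) : ℤ) ^ 2)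
    have f3 := f1.sub f2
    refine Int.ModEq.trans (modEq_of_eq ?_) (f3.trans (modEq_of_eq ?_))
    · ring
    · rw [hΔ]; push_cast; ring
  set e := Int.gcd (A - A') g
  have he1 : (e : ℤ) ∣ A - A' := Int.gcd_dvd_left _ _
  have he2 : (e : ℤ) ∣ g := Int.gcd_dvd_right _ _
  have h2 : (e : ℤ) ∣ (a * (G : ℤ) ^ 2) * Δ := by
    have := (h1.of_dvd he2)
    rw [← Int.modEq_zero_iff_dvd]
    refine this.symm.trans ?_
    rw [Int.modEq_zero_iff_dvd]
    exact he1.mul_right _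
  have hcop : IsCoprime (e : ℤ) (a * (G : ℤ) ^ 2) := by
    refine IsCoprime.of_isCoprime_of_dvd_left ?_ he2
    refine IsCoprime.mul_right ?_ ?_
    · exact (Int.isCoprime_iff_gcd_eq_one.2 ha).symm
    · exact (Nat.isCoprime_iff_coprime.2 (Nat.Coprime.coprime_mul_right_right hc)).pow_right
  have h3 : (e : ℤ) ∣ Δ := hcop.dvd_of_dvd_mul_left h2
  exact Nat.le_of_dvd (Int.gcd_pos_of_ne_zero_right _ (by exact_mod_cast hg.ne')) (Int.dvd_gcd h3 he2)

lemma swap_sum (P : Finset (ℕ × ℕ)) (H : ℕ) (b : ((ℕ × ℕ) × ℤ) → ((ℕ × ℕ) × ℤ) → ℝ) :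
    ∑ p ∈ om P H, ∑ p' ∈ om P H, b (p'.1, p.2) (p.1, p'.2) = ∑ x ∈ om P H, ∑ y ∈ om P H, b x y := by
  rw [← Finset.sum_product', ← Finset.sum_product']
  refine Finset.sum_nbij' (fun x => ((x.2.1, x.1.2), (x.1.1, x.2.2)))
    (fun x => ((x.2.1, x.1.2), (x.1.1, x.2.2))) ?_ ?_ ?_ ?_ ?_
  · rintro ⟨⟨p, h⟩, ⟨p', h'⟩⟩ hx; simp [om] at hx ⊢; tauto
  · rintro ⟨⟨p, h⟩, ⟨p', h'⟩⟩ hx; simp [om] at hx ⊢; tauto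
  · intro x _; rfl
  · intro x _; rfl
  · intro x _; rfl

structure CData (P : Finset (ℕ × ℕ)) (g G : ℕ) : Prop where
  sq : Squarefree g
  odd : Odd g
  Gpos : 0 < G
  c1 : ∀ p ∈ P, g.Coprime (G * p.1)
  c2 : ∀ p ∈ P, (g * (G * p.1)).Coprime p.2

lemma core {P : Finset (ℕ × ℕ)} {H : ℕ} {N Lim L : ℝ} (d : PData P H N Lim L) {g G : ℕ}
    (cd : CData P g G) (a : ℤ) (ha : Int.gcd a g = 1) (ω : (ℕ × ℕ) × ℤ → ℂ)
    (hω : ∀ x ∈ om P H, ‖ω x‖ ≤ 1) (s α β : ℤ) (B : ℝ) (hαβ : α ≤ β) (h : (β : ℝ) - α ≤ B)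
    (hmB : ((G : ℝ) * N ^ 2) ^ 2 ≤ B) (hgL : (g : ℝ) ≤ Lim) (hlog : 1 + Real.log g ≤ L) :
    ∑ u ∈ Finset.Ico α β, ‖∑ x ∈ om P H, ω x * phs a (g * (G * x.1.1)) x.1.2 x.2 u (u + s)‖ ^ 2 ≤
    2 * H * N * L ^ 2 * B + 32 * L ^ 5 * N ^ 2 * (H ^ 2 + H * N) *
      Real.sqrt (B * ((G : ℝ) * N ^ 2) ^ 2 + B ^ 2 / g + B * g) := by
  have hg0 : 0 < g := Nat.pos_of_ne_zero cd.sq.ne_zero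
  have hN := d.N1
  have hL := d.L1
  have hB : 0 ≤ B := by
    have : (α : ℝ) ≤ β := by exact_mod_cast hαβ
    linarith
  set T : ℝ := B * ((G : ℝ) * N ^ 2) ^ 2 + B ^ 2 / g + B * g with hT
  have hT0 : 0 ≤ T := by positivity
  refine (sum_normsq_le _ _ _).trans ?_
  set b : ((ℕ × ℕ) × ℤ) → ((ℕ × ℕ) × ℤ) → ℝ := fun x y =>
    (if ph2 x - ph2 y = 0 then B else 0) +
    (if ph2 x - ph2 y ≠ 0 then Real.sqrt (Int.gcd (ph2 x - ph2 y) g) * (4 * L ^ 2 * Real.sqrt T) else 0)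
    with hb
  have key : ∀ p ∈ om P H, ∀ p' ∈ om P H, ‖∑ u ∈ Finset.Ico α β,
      ω p * phs a (g * (G * p.1.1)) p.1.2 p.2 u (u + s) * (starRingEnd ℂ)
      (ω p' * phs a (g * (G * p'.1.1)) p'.1.2 p'.2 u (u + s))‖ ≤ b (p'.1, p.2) (p.1, p'.2) := by
    intro p hp p' hp'
    have hpP := (Finset.mem_product.1 hp).1
    have hpP' := (Finset.mem_product.1 hp').1
    have q1 := cd.c1 _ hpP
    have q2 := cd.c2 _ hpP
    have q1' := cd.c1 _ hpP'
    have q2' := cd.c2 _ hpP'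
    have hpos := d.pos _ hpP
    have hpos' := d.pos _ hpP'
    have hGz : 0 < G * p.1.1 := Nat.mul_pos cd.Gpos hpos.1
    have hGz' : 0 < G * p'.1.1 := Nat.mul_pos cd.Gpos hpos'.1
    set F1 : ℤ → ℂ := fun u => Fg a G g p.1.1 p.1.2 p.2 s u *
      (starRingEnd ℂ) (Fg a G g p'.1.1 p'.1.2 p'.2 s u) with hF1
    set A := Ag a G g p.1.1 p.1.2 p.2 - Ag a G g p'.1.1 p'.1.2 p'.2 with hA
    have e1 : ∀ u, ω p * phs a (g * (G * p.1.1)) p.1.2 p.2 u (u + s) * (starRingEnd ℂ)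
      (ω p' * phs a (g * (G * p'.1.1)) p'.1.2 p'.2 u (u + s)) =
      (ω p * (starRingEnd ℂ) (ω p')) * (F1 u * kl g A u) := by
      intro u
      rw [phs_factor a G g _ _ _ _ _ hg0 hGz q1, phs_factor a G g _ _ _ _ _ hg0 hGz' q1', hA,
        ← kl_mul_conj, hF1]
      simp only [map_mul]; ring
    simp_rw [e1]
    rw [← Finset.mul_sum, norm_mul, norm_mul, RCLike.norm_conj]
    refine (mul_le_of_le_one_left (norm_nonneg _)
      (mul_le_one₀ (hω p hp) (norm_nonneg _) (hω p' hp'))).trans ?_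
    have hF1n : ∀ u, ‖F1 u‖ ≤ 1 := fun u => by
      rw [hF1]; simp only [norm_mul, RCLike.norm_conj]
      exact mul_le_one₀ (Fg_norm _ _ _ _ _ _ _ _) (norm_nonneg _) (Fg_norm _ _ _ _ _ _ _ _)
    set m : ℕ := (G * (p.1.1 * p.1.2) * (p'.1.1 * p'.1.2)) ^ 2 with hm
    have hm0 : 0 < m := pow_pos (Nat.mul_pos (Nat.mul_pos cd.Gpos (Nat.mul_pos hpos.1 hpos.2))
      (Nat.mul_pos hpos'.1 hpos'.2)) 2
    have hper : ∀ u, F1 (u + m) = F1 u := by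
      intro u
      rw [hF1]; simp only
      rw [Fg_per a G g _ _ _ _ _ hGz hpos.2 m ⟨(p'.1.1 * p'.1.2) ^ 2, by rw [hm]; ring⟩,
        Fg_per a G g _ _ _ _ _ hGz' hpos'.2 m ⟨(p.1.1 * p.1.2) ^ 2, by rw [hm]; ring⟩]
    have hmc : m.Coprime g := by
      refine Nat.Coprime.pow_left 2 ?_
      refine Nat.Coprime.mul_left (Nat.Coprime.mul_left ?_ (Nat.Coprime.mul_left ?_ ?_))
        (Nat.Coprime.mul_left ?_ ?_)
      · exact (Nat.Coprime.coprime_mul_right_right q1).symm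
      · exact (Nat.Coprime.coprime_mul_left_right q1).symm
      · exact (Nat.Coprime.coprime_mul_right q2).symm
      · exact (Nat.Coprime.coprime_mul_left_right q1').symm
      · exact (Nat.Coprime.coprime_mul_right q2').symm
    have hmR : (m : ℝ) ≤ ((G : ℝ) * N ^ 2) ^ 2 := by
      have l1 := d.le _ hpP
      have l2 := d.le _ hpP'
      rw [hm]; push_cast at l1 l2 ⊢
      have h0 : (0:ℝ) ≤ (p.1.1 : ℝ) * p.1.2 := by positivity
      have h0' : (0:ℝ) ≤ (p'.1.1 : ℝ) * p'.1.2 := by positivity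
      calc ((G : ℝ) * (p.1.1 * p.1.2) * (p'.1.1 * p'.1.2)) ^ 2 ≤ ((G : ℝ) * N * N) ^ 2 := by gcongr
        _ = _ := by ring
    rw [hb]
    simp only
    have hΔ : ph2 (p'.1, p.2) - ph2 (p.1, p'.2) =
      p.2 * ((p'.1.1 * p'.1.2 : ℕ) : ℤ) ^ 2 - p'.2 * ((p.1.1 * p.1.2 : ℕ) : ℤ) ^ 2 := rfl
    by_cases h0 : ph2 (p'.1, p.2) - ph2 (p.1, p'.2) = 0
    · rw [if_pos h0, if_neg (by simpa using h0), add_zero]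
      refine (norm_sum_le _ _).trans ?_
      refine (Finset.sum_le_card_nsmul _ _ 1 fun u _ => ?_).trans ?_
      · rw [norm_mul]; exact mul_le_one₀ (hF1n u) (norm_nonneg _) (kl_norm _ _ _)
      · rw [Int.card_Ico, nsmul_eq_mul, mul_one]
        have : (((β - α).toNat : ℤ) : ℝ) = ((β - α : ℤ) : ℝ) := by
          rw [Int.toNat_of_nonneg (by linarith)]
        rw [Int.cast_natCast] at this
        rw [this]; push_cast; linarith
    · rw [if_neg h0, if_pos h0, zero_add]
      have hv := vdC g cd.sq cd.odd m hm0 hmc F1 hF1n hper A α β B hαβ h (hmR.trans hmB) L hL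
        (d.tau g hg0 hgL) hlog
      have hgc := gcd_Ag_le a G g p.1.1 p.1.2 p'.1.1 p'.1.2 p.2 p'.2 hg0 q1 q2 q1' q2' ha
      rw [← hΔ, ← hA] at hgc
      have hgc' : (Int.gcd A g : ℝ) ≤ Int.gcd (ph2 (p'.1, p.2) - ph2 (p.1, p'.2)) g := by
        exact_mod_cast hgc
      refine abs_le_of_sq_le_sq' ?_ (by positivity) |>.2
      refine hv.trans ?_
      have e5 : (Real.sqrt (Int.gcd (ph2 (p'.1, p.2) - ph2 (p.1, p'.2)) g) *
          (4 * L ^ 2 * Real.sqrt T)) ^ 2 =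
          (Int.gcd (ph2 (p'.1, p.2) - ph2 (p.1, p'.2)) g) * (16 * L ^ 4 * T) := by
        rw [mul_pow, mul_pow, Real.sq_sqrt (by positivity), Real.sq_sqrt hT0]; ring
      rw [e5]
      calc 12 * L ^ 4 * (Int.gcd A g : ℝ) * (B * m + B ^ 2 / g + B * g)
          ≤ 16 * L ^ 4 * (Int.gcd (ph2 (p'.1, p.2) - ph2 (p.1, p'.2)) g : ℝ) * T := by
            rw [hT]; gcongr; norm_num
        _ = _ := by ring
  refine (Finset.sum_le_sum fun p hp => Finset.sum_le_sum fun p' hp' => key p hp p' hp').trans ?_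
  rw [swap_sum P H b, hb]
  simp only [Finset.sum_add_distrib]
  refine add_le_add ?_ ?_
  · have : ∑ x ∈ om P H, ∑ y ∈ om P H, (if ph2 x - ph2 y = 0 then B else 0) =
      (∑ x ∈ om P H, (((om P H).filter (fun y => ph2 x - ph2 y = 0)).card : ℝ)) * B := by
      rw [Finset.sum_mul]
      refine Finset.sum_congr rfl fun x _ => ?_
      rw [← Finset.sum_filter, Finset.sum_const, nsmul_eq_mul]
    rw [this]
    exact mul_le_mul_of_nonneg_right d.diag hB
  · have : ∑ x ∈ om P H, ∑ y ∈ om P H, (if ph2 x - ph2 y ≠ 0 then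
        Real.sqrt (Int.gcd (ph2 x - ph2 y) g) * (4 * L ^ 2 * Real.sqrt T) else 0) =
      (∑ x ∈ om P H, ∑ y ∈ (om P H).filter (fun y => ph2 x - ph2 y ≠ 0),
      Real.sqrt (Int.gcd (ph2 x - ph2 y) g)) * (4 * L ^ 2 * Real.sqrt T) := by
      rw [Finset.sum_mul]
      refine Finset.sum_congr rfl fun x _ => ?_
      rw [← Finset.sum_filter, Finset.sum_mul]
    rw [this]
    have hcop : ∀ p ∈ P, (p.1 * p.2).Coprime g := fun p hp =>
      Nat.Coprime.mul_left (Nat.Coprime.coprime_mul_left_right (cd.c1 p hp)).symm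
        (Nat.Coprime.coprime_mul_right (cd.c2 p hp)).symm
    refine (mul_le_mul_of_nonneg_right (d.sumgcd g hg0 hgL hcop) (by positivity)).trans ?_
    refine le_of_eq ?_
    ring

end

section

/-- the Fejer weight -/
def fw (J Λ : ℕ) (v0 v : ℤ) : ℝ :=
  ‖∑ j ∈ Finset.range J, ee ((j : ℝ) * (v - v0) / (Λ * J))‖ ^ 2 / (J : ℝ) ^ 2

lemma fw_nonneg (J Λ : ℕ) (v0 v : ℤ) : 0 ≤ fw J Λ v0 v := by unfold fw; positivity

lemma ee_re_lower (x : ℝ) (h : |x| ≤ 1 / 8) : 3 / 4 - 1 / 20 ≤ (ee x).re := by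
  have : (ee x).re = Real.cos (2 * Real.pi * x) := by
    unfold ee; rw [Complex.exp_ofReal_mul_I_re]
  rw [this]
  have h1 : Real.cos (Real.pi / 4) ≤ Real.cos |2 * Real.pi * x| := by
    refine Real.cos_le_cos_of_nonneg_of_le_pi (abs_nonneg _) (by linarith [Real.pi_pos]) ?_
    rw [abs_mul, abs_of_pos (by positivity : (0:ℝ) < 2 * Real.pi)]
    nlinarith [Real.pi_pos]
  rw [Real.cos_abs, Real.cos_pi_div_four] at h1
  have h2 : (1.4 : ℝ) ≤ Real.sqrt 2 := by
    rw [Real.le_sqrt (by norm_num) (by norm_num)]; norm_num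
  linarith

lemma fw_lower (J Λ : ℕ) (hJ : 0 < J) (hΛ : 0 < Λ) (v0 v : ℤ) (h : 8 * |(v : ℝ) - v0| ≤ Λ) :
    49 / 100 ≤ fw J Λ v0 v := by
  unfold fw
  have hJR : (0 : ℝ) < J := by exact_mod_cast hJ
  have hΛR : (0 : ℝ) < Λ := by exact_mod_cast hΛ
  have h1 : (7 / 10) * (J : ℝ) ≤ ‖∑ j ∈ Finset.range J, ee ((j : ℝ) * (v - v0) / (Λ * J))‖ := by
    refine le_trans ?_ (Complex.re_le_norm _)
    rw [Complex.re_sum]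
    have : ∀ j ∈ Finset.range J, (7 / 10 : ℝ) ≤ (ee ((j : ℝ) * (v - v0) / (Λ * J))).re := by
      intro j hj
      have hj' : (j : ℝ) ≤ J := by exact_mod_cast (Finset.mem_range.1 hj).le
      refine le_trans (by norm_num) (ee_re_lower _ ?_)
      rw [abs_div, abs_mul, abs_of_nonneg (by positivity : (0:ℝ) ≤ j),
        abs_of_pos (by positivity : (0:ℝ) < Λ * J), div_le_iff₀ (by positivity)]
      have := abs_nonneg ((v : ℝ) - v0)
      nlinarith
    have := Finset.card_nsmul_le_sum _ _ _ this
    simp only [Finset.card_range, nsmul_eq_mul] at this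
    linarith
  rw [le_div_iff₀ (by positivity)]
  nlinarith [norm_nonneg (∑ j ∈ Finset.range J, ee ((j : ℝ) * (v - v0) / (Λ * J)))]

lemma fib_sum (M q : ℕ) (hq : 0 < q) (c : ℤ) (f : ℤ → ℂ) :
    ∑ v ∈ (Finset.Ico (0 : ℤ) (M * q : ℕ)).filter (fun v => v ≡ c [ZMOD q]), f v =
    ∑ y ∈ Finset.range M, f (c % q + q * y) := by
  have hqZ : (0 : ℤ) < q := by exact_mod_cast hq
  have h0 := Int.emod_nonneg c hqZ.ne'
  have h1 := Int.emod_lt_of_pos c hqZ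
  symm
  refine Finset.sum_bij (fun y _ => c % q + q * y) ?_ ?_ ?_ ?_
  · intro y hy
    have hy := Finset.mem_range.1 hy
    rw [Finset.mem_filter, Finset.mem_Ico]
    refine ⟨⟨by positivity, ?_⟩, ?_⟩
    · push_cast
      have : (y : ℤ) + 1 ≤ M := by exact_mod_cast hy
      nlinarith
    · have : c % q + q * y ≡ c % q [ZMOD q] := by
        simp [Int.ModEq]
      exact this.trans (Int.mod_modEq c q)
  · intro y _ y' _ h
    have : (q : ℤ) * y = q * y' := by linarith
    exact_mod_cast mul_left_cancel₀ hqZ.ne' this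
  · intro v hv
    rw [Finset.mem_filter, Finset.mem_Ico] at hv
    obtain ⟨⟨h2, h3⟩, h4⟩ := hv
    refine ⟨(v / q).toNat, ?_, ?_⟩
    · rw [Finset.mem_range]
      have : v / q < M := Int.ediv_lt_of_lt_mul hqZ (by exact_mod_cast h3)
      have h9 : 0 ≤ v / q := Int.ediv_nonneg h2 hqZ.le
      omega
    · rw [Int.toNat_of_nonneg (Int.ediv_nonneg h2 hqZ.le)]
      have h5 : c % q = v % q := h4.symm
      rw [h5]; exact Int.emod_add_mul_ediv v q
  · intro _ _; rfl

lemma char_sum (M q : ℕ) (hq : 0 < q) (hM : 0 < M) (c v0 n : ℤ) :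
    ∑ v ∈ (Finset.Ico (0 : ℤ) (M * q : ℕ)).filter (fun v => v ≡ c [ZMOD q]),
      ee ((n : ℝ) * (v - v0) / (M * q)) =
    if (M : ℤ) ∣ n then (M : ℂ) * ee (((n / M * (c - v0) : ℤ) : ℝ) / q) else 0 := by
  have hqR : (0 : ℝ) < q := by exact_mod_cast hq
  have hMR : (0 : ℝ) < M := by exact_mod_cast hM
  split_ifs with h
  · obtain ⟨h, rfl⟩ := h
    rw [Int.mul_ediv_cancel_left _ (by exact_mod_cast hM.ne')]
    have : ∀ v ∈ (Finset.Ico (0 : ℤ) (M * q : ℕ)).filter (fun v => v ≡ c [ZMOD q]),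
      ee (((M * h : ℤ) : ℝ) * (v - v0) / (M * q)) = ee (((h * (c - v0) : ℤ) : ℝ) / q) := by
      intro v hv
      have hv := (Finset.mem_filter.1 hv).2
      have e : ((M * h : ℤ) : ℝ) * (v - v0) / (M * q) = ((h * (v - v0) : ℤ) : ℝ) / q := by
        push_cast; field_simp
      rw [e]
      exact ee_congr hq ((hv.sub_right _).mul_left _)
    rw [Finset.sum_congr rfl this, fib_sum M q hq c (fun _ => _)]
    simp
  · rw [fib_sum M q hq]
    have e : ∀ y : ℕ, ee ((n : ℝ) * ((c % q + q * y : ℤ) - v0) / (M * q)) =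
      ee ((n : ℝ) * ((c % q : ℤ) - v0) / (M * q)) * ee ((n : ℝ) / M) ^ y := by
      intro y
      rw [← ee_nat_mul, ← ee_add]; congr 1
      push_cast; field_simp; ring
    simp_rw [e]
    rw [← Finset.mul_sum]
    have h1 : ee ((n : ℝ) / M) ^ M = 1 := by
      rw [← ee_nat_mul]
      have : (M : ℝ) * (n / M) = (n : ℤ) := by field_simp
      rw [this, ee_int]
    have h2 : ee ((n : ℝ) / M) ≠ 1 := by
      intro h3
      unfold ee at h3
      rw [Complex.exp_eq_one_iff] at h3
      obtain ⟨k, hk⟩ := h3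
      apply h
      refine ⟨k, ?_⟩
      have h4 : ((2 * Real.pi * (n / M) : ℝ) : ℂ) = ((k * (2 * Real.pi) : ℝ) : ℂ) := by
        have h5 : ((2 * Real.pi * (n / M) : ℝ) : ℂ) * Complex.I = ((k * (2 * Real.pi) : ℝ) : ℂ) * Complex.I := by
          rw [hk]; push_cast; ring
        exact mul_right_cancel₀ Complex.I_ne_zero h5
      have h6 := Complex.ofReal_injective h4
      have h7 : (n : ℝ) / M = k := by
        have := Real.pi_pos
        have h8 : (2 * Real.pi) * ((n : ℝ) / M) = (2 * Real.pi) * k := by linarith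
        exact mul_left_cancel₀ (by positivity) h8
      rw [div_eq_iff hMR.ne'] at h7
      have : n = k * M := by exact_mod_cast h7
      rw [this]; ring
    have h3 := mul_neg_geom_sum (ee ((n : ℝ) / M)) M
    rw [h1, sub_self] at h3
    rcases mul_eq_zero.1 h3 with h4 | h4
    · exact absurd (sub_eq_zero.1 h4).symm h2
    · rw [h4, mul_zero]

/-- coefficient -/
def fc (J M : ℕ) (h : ℤ) : ℝ :=
  (((Finset.range J ×ˢ Finset.range J).filter (fun x => (x.1 : ℤ) - x.2 = h * M)).card : ℝ) / J

lemma fc_nonneg (J M : ℕ) (h : ℤ) : 0 ≤ fc J M h := by unfold fc; positivity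

lemma fc_le (J M : ℕ) (h : ℤ) : fc J M h ≤ 1 := by
  unfold fc
  refine div_le_one_of_le₀ ?_ (by positivity)
  have : ((Finset.range J ×ˢ Finset.range J).filter (fun x => (x.1 : ℤ) - x.2 = h * M)).card ≤
      (Finset.range J).card := by
    refine Finset.card_le_card_of_injOn (fun x => x.1) ?_ ?_
    · intro x hx
      simp at hx ⊢; exact hx.1.1
    · intro x hx y hy hxy
      simp at hx hy hxy
      refine Prod.ext hxy ?_
      have h1 := hx.2
      have h2 := hy.2
      rw [hxy] at h1
      have : (x.2 : ℤ) = y.2 := by linarith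
      exact_mod_cast this
  rw [Finset.card_range] at this
  exact_mod_cast this

lemma fc_zero (J M : ℕ) (hJ : 0 < J) : fc J M 0 = 1 := by
  unfold fc
  have : (Finset.range J ×ˢ Finset.range J).filter (fun x => (x.1 : ℤ) - x.2 = 0 * M) =
    (Finset.range J).image (fun j => (j, j)) := by
    ext ⟨x, y⟩
    simp only [Finset.mem_filter, Finset.mem_product, Finset.mem_image, Finset.mem_range]
    constructor
    · rintro ⟨⟨h1, h2⟩, h3⟩
      refine ⟨x, h1, ?_⟩
      have : x = y := by omega
      rw [this]
    · rintro ⟨j, hj, h⟩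
      obtain ⟨rfl, rfl⟩ := Prod.mk.inj h
      exact ⟨⟨hj, hj⟩, by ring⟩
  rw [this, Finset.card_image_of_injective _ (fun a b h => (Prod.mk.inj h).1), Finset.card_range]
  have : (J : ℝ) ≠ 0 := by exact_mod_cast hJ.ne'
  field_simp

/-- weighted count in a residue class -/
lemma fw_class (J Λ q M' H : ℕ) (hJ : 0 < J) (hΛ : 0 < Λ) (hq : q * M' = J) (hH : q ≤ Λ * (H + 1))
    (v0 c : ℤ) :
    ∑ v ∈ (Finset.Ico (0 : ℤ) (Λ * J : ℕ)).filter (fun v => v ≡ c [ZMOD q]), (fw J Λ v0 v : ℂ) =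
    ((Λ : ℂ) / q) * (1 + ∑ h ∈ Hs H, (fc J (Λ * M') h : ℂ) * ee (((h * (c - v0) : ℤ) : ℝ) / q)) := by
  have hq0 : 0 < q := Nat.pos_of_ne_zero (by rintro rfl; simp at hq; omega)
  have hM'0 : 0 < M' := Nat.pos_of_ne_zero (by rintro rfl; simp at hq; omega)
  set M := Λ * M' with hM
  have hM0 : 0 < M := Nat.mul_pos hΛ hM'0
  have hQ : Λ * J = M * q := by rw [hM, ← hq]; ring
  have hQR : (Λ : ℝ) * J = M * q := by exact_mod_cast hQ
  have e1 : ∀ v : ℤ, (fw J Λ v0 v : ℂ) = (1 / (J : ℂ) ^ 2) * ∑ x ∈ Finset.range J ×ˢ Finset.range J,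
      ee ((((x.1 : ℤ) - x.2 : ℤ) : ℝ) * (v - v0) / (M * q)) := by
    intro v
    unfold fw
    rw [Complex.ofReal_div, normsq_sum, Finset.sum_product]
    rw [div_eq_mul_one_div, mul_comm]
    push_cast
    congr 1
    refine Finset.sum_congr rfl fun i _ => Finset.sum_congr rfl fun j _ => ?_
    rw [← ee_sub, ← hQR]; congr 1; ring
  simp_rw [e1]
  rw [← Finset.mul_sum, Finset.sum_comm, hQ]
  simp_rw [char_sum M q hq0 hM0 c v0]
  have e2 : ∀ x ∈ Finset.range J ×ˢ Finset.range J,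
      (if (M : ℤ) ∣ ((x.1 : ℤ) - x.2) then (M : ℂ) * ee (((((x.1 : ℤ) - x.2) / M * (c - v0) : ℤ) : ℝ) / q) else 0)
      = ∑ h ∈ Finset.Icc (-(H : ℤ)) H,
        if (x.1 : ℤ) - x.2 = h * M then (M : ℂ) * ee (((h * (c - v0) : ℤ) : ℝ) / q) else 0 := by
    intro x hx
    have hMZ : (0 : ℤ) < M := by exact_mod_cast hM0
    rw [Finset.mem_product, Finset.mem_range, Finset.mem_range] at hx
    by_cases hd : (M : ℤ) ∣ ((x.1 : ℤ) - x.2)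
    · obtain ⟨k, hk⟩ := hd
      rw [if_pos ⟨k, hk⟩, hk, Int.mul_ediv_cancel_left _ hMZ.ne']
      have hJM : (J : ℤ) ≤ M * (H + 1) := by
        have : J ≤ M * (H + 1) := by
          rw [← hq, hM]
          calc q * M' ≤ (Λ * (H + 1)) * M' := Nat.mul_le_mul_right _ hH
            _ = _ := by ring
        exact_mod_cast this
      have b1 : (M : ℤ) * k < M * (H + 1) := by omega
      have b2 : (M : ℤ) * (-k) < M * (H + 1) := by
        rw [mul_neg]; omega
      have b3 := lt_of_mul_lt_mul_left b1 hMZ.le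
      have b4 := lt_of_mul_lt_mul_left b2 hMZ.le
      rw [Finset.sum_eq_single k]
      · rw [if_pos (by ring)]
      · intro b _ hb
        rw [if_neg]
        intro h
        apply hb
        rw [mul_comm] at h
        exact (mul_right_cancel₀ hMZ.ne' h).symm
      · intro h
        exfalso; apply h
        rw [Finset.mem_Icc]; omega
    · rw [if_neg hd, Finset.sum_eq_zero]
      intro h _
      rw [if_neg]
      intro e
      exact hd ⟨h, by rw [e]; ring⟩
  rw [Finset.sum_congr rfl e2, Finset.sum_comm]
  have e3 : ∀ h : ℤ, (∑ x ∈ Finset.range J ×ˢ Finset.range J,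
      if (x.1 : ℤ) - x.2 = h * M then (M : ℂ) * ee (((h * (c - v0) : ℤ) : ℝ) / q) else 0) =
      (J * M : ℂ) * ((fc J M h : ℂ) * ee (((h * (c - v0) : ℤ) : ℝ) / q)) := by
    intro h
    rw [← Finset.sum_filter, Finset.sum_const, nsmul_eq_mul]
    unfold fc
    have : (J : ℂ) ≠ 0 := by exact_mod_cast hJ.ne'
    push_cast
    field_simp
  simp_rw [e3]
  rw [← Finset.mul_sum]
  have h0 : (0 : ℤ) ∈ Finset.Icc (-(H : ℤ)) H := by rw [Finset.mem_Icc]; omega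
  rw [← Finset.add_sum_erase _ _ h0, fc_zero J M hJ]
  have e4 : (Λ : ℂ) / q = 1 / (J : ℂ) ^ 2 * (J * M) := by
    have hJC : (J : ℂ) ≠ 0 := by exact_mod_cast hJ.ne'
    have hqC : (q : ℂ) ≠ 0 := by exact_mod_cast hq0.ne'
    have : (Λ : ℂ) * J = M * q := by exact_mod_cast hQ
    field_simp
    rw [this]; ring
  rw [e4]
  simp only [zero_mul, Int.cast_zero, zero_div, ee_zero, Complex.ofReal_one, mul_one]
  unfold Hs
  ring

end

section

lemma sum_cover {ι κ : Type*} (A : Finset ι) (B : Finset κ) (φ : κ → ι) (f : ι → ℝ)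
    (hf : ∀ i, 0 ≤ f i) (h : ∀ i ∈ A, ∃ k ∈ B, φ k = i) : ∑ i ∈ A, f i ≤ ∑ k ∈ B, f (φ k) := by
  rcases A.eq_empty_or_nonempty with rfl | ⟨i0, hi0⟩
  · simpa using Finset.sum_nonneg fun k _ => hf (φ k)
  haveI : Nonempty κ := ⟨(h i0 hi0).choose⟩
  choose! ψ h1 h2 using h
  have e : ∑ i ∈ A, f i = ∑ i ∈ A, f (φ (ψ i)) := Finset.sum_congr rfl fun i hi => by rw [h2 i hi]
  rw [e]
  have hinj : Set.InjOn ψ A := by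
    intro i hi j hj hij
    rw [← h2 i hi, ← h2 j hj, hij]
  rw [← Finset.sum_image (f := fun k => f (φ k)) hinj]
  refine Finset.sum_le_sum_of_subset_of_nonneg ?_ fun k _ _ => hf _
  intro k hk
  obtain ⟨i, hi, rfl⟩ := Finset.mem_image.1 hk
  exact h1 i hi

def Ipr (Y : ℝ) (j p : ℕ) : Prop := p.Prime ∧ (2 : ℝ) ^ j * Y < p ∧ (p : ℝ) ≤ (2 : ℝ) ^ (j + 1) * Y

lemma Ipr.inj {Y : ℝ} {j k p : ℕ} (hY : 0 < Y) (h1 : Ipr Y j p) (h2 : Ipr Y k p) : j = k := by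
  have key : ∀ j k : ℕ, Ipr Y j p → Ipr Y k p → k ≤ j := by
    intro j k h1 h2
    have h3 := lt_of_lt_of_le h2.2.1 h1.2.2
    have h4 : (2 : ℝ) ^ k < 2 ^ (j + 1) := lt_of_mul_lt_mul_right h3 hY.le
    have h5 := (pow_lt_pow_iff_right₀ (by norm_num : (1:ℝ) < 2)).1 h4
    omega
  exact le_antisymm (key k j h2 h1) (key j k h1 h2)

def DJ (Y : ℝ) (J : Finset ℕ) : Finset ℕ :=
  (Finset.Icc 1 ⌊∏ j ∈ J, ((2 : ℝ) ^ (j + 1) * Y)⌋₊).filter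
    (fun d => ∃ p : ℕ → ℕ, (∀ j ∈ J, Ipr Y j (p j)) ∧ d = ∏ j ∈ J, p j)

lemma mem_DJ {Y : ℝ} (hY : 0 < Y) {J : Finset ℕ} {d : ℕ} :
    d ∈ DJ Y J ↔ ∃ p : ℕ → ℕ, (∀ j ∈ J, Ipr Y j (p j)) ∧ d = ∏ j ∈ J, p j := by
  unfold DJ
  rw [Finset.mem_filter]
  refine ⟨fun h => h.2, fun h => ⟨?_, h⟩⟩
  obtain ⟨p, hp, rfl⟩ := h
  rw [Finset.mem_Icc]
  refine ⟨Finset.prod_pos fun j hj => (hp j hj).1.pos, ?_⟩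
  refine Nat.le_floor ?_
  push_cast
  exact Finset.prod_le_prod (fun j _ => by positivity) fun j hj => (hp j hj).2.2

/-- the constant -/
def cK (K : ℕ) : ℝ := 2 ^ (K * K)

lemma cK_one (K : ℕ) : 1 ≤ cK K := one_le_pow₀ (by norm_num)

lemma prod_le_cK {Y : ℝ} (hY : 0 < Y) {J : Finset ℕ} {K : ℕ} (hJ : J ⊆ Finset.range K) :
    ∏ j ∈ J, ((2 : ℝ) ^ (j + 1) * Y) ≤ cK K * Y ^ J.card := by
  rw [Finset.prod_mul_distrib, Finset.prod_const]
  refine mul_le_mul_of_nonneg_right ?_ (by positivity)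
  calc ∏ j ∈ J, (2 : ℝ) ^ (j + 1) ≤ ∏ j ∈ J, (2 : ℝ) ^ K := by
        refine Finset.prod_le_prod (fun j _ => by positivity) fun j hj => ?_
        exact pow_le_pow_right₀ (by norm_num) (Finset.mem_range.1 (hJ hj))
    _ = (2 : ℝ) ^ (K * J.card) := by rw [Finset.prod_const, ← pow_mul]
    _ ≤ _ := by
        unfold cK
        refine pow_le_pow_right₀ (by norm_num) (Nat.mul_le_mul_left _ ?_)
        simpa using Finset.card_le_card hJ

section
variable {Y : ℝ} {J J' : Finset ℕ} {K d e : ℕ}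

lemma DJ_pos (h : d ∈ DJ Y J) : 0 < d := by
  have := (Finset.mem_Icc.1 (Finset.mem_filter.1 h).1).1
  omega

lemma DJ_le (hY : 0 < Y) (hJ : J ⊆ Finset.range K) (h : d ∈ DJ Y J) : (d : ℝ) ≤ cK K * Y ^ J.card := by
  refine le_trans ?_ (prod_le_cK hY hJ)
  have h1 := (Finset.mem_Icc.1 (Finset.mem_filter.1 h).1).2
  exact (Nat.le_floor_iff (Finset.prod_nonneg fun j _ => by positivity)).1 h1

lemma DJ_card (hY : 0 < Y) (hJ : J ⊆ Finset.range K) : ((DJ Y J).card : ℝ) ≤ cK K * Y ^ J.card := by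
  refine le_trans ?_ (prod_le_cK hY hJ)
  refine (Nat.cast_le.2 (Finset.card_filter_le _ _)).trans ?_
  rw [Nat.card_Icc]
  simp only [add_tsub_cancel_right]
  exact Nat.floor_le (Finset.prod_nonneg fun j _ => by positivity)

lemma DJ_ge (hY : 0 < Y) (h : d ∈ DJ Y J) : Y ^ J.card ≤ d := by
  obtain ⟨p, hp, rfl⟩ := (mem_DJ hY).1 h
  rw [← Finset.prod_const]
  push_cast
  refine Finset.prod_le_prod (fun j _ => hY.le) fun j hj => ?_
  refine le_trans ?_ (hp j hj).2.1.le
  exact le_mul_of_one_le_left hY.le (one_le_pow₀ (by norm_num))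

lemma DJ_prime (hY : 0 < Y) (h : d ∈ DJ Y J) {q : ℕ} (hq : q.Prime) (hqd : q ∣ d) : ∃ j ∈ J, Ipr Y j q := by
  obtain ⟨p, hp, rfl⟩ := (mem_DJ hY).1 h
  obtain ⟨j, hj, hqj⟩ := (hq.prime.dvd_finsetProd_iff _).1 hqd
  have : q = p j := (Nat.prime_dvd_prime_iff_eq hq (hp j hj).1).1 hqj
  exact ⟨j, hj, this ▸ hp j hj⟩

lemma DJ_prime_gt (hY : 0 < Y) (h : d ∈ DJ Y J) {q : ℕ} (hq : q.Prime) (hqd : q ∣ d) : Y < q := by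
  obtain ⟨j, _, h1⟩ := DJ_prime hY h hq hqd
  refine lt_of_le_of_lt ?_ h1.2.1
  exact le_mul_of_one_le_left hY.le (one_le_pow₀ (by norm_num))

lemma DJ_coprime (hY : 0 < Y) (hd : d ∈ DJ Y J) (he : e ∈ DJ Y J') (hJ : Disjoint J J') : d.Coprime e := by
  rw [Nat.coprime_iff_gcd_eq_one]
  by_contra hne
  obtain ⟨q, hq, hqg⟩ := Nat.exists_prime_and_dvd hne
  obtain ⟨j, hj, h1⟩ := DJ_prime hY hd hq (hqg.trans (Nat.gcd_dvd_left _ _))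
  obtain ⟨k, hk, h2⟩ := DJ_prime hY he hq (hqg.trans (Nat.gcd_dvd_right _ _))
  have := Ipr.inj hY h1 h2
  subst this
  exact (Finset.disjoint_left.1 hJ) hj hk

lemma DJ_sqf (hY : 0 < Y) (h : d ∈ DJ Y J) : Squarefree d := by
  obtain ⟨p, hp, rfl⟩ := (mem_DJ hY).1 h
  refine Finset.squarefree_prod_of_pairwise_isCoprime ?_ fun j hj => (hp j hj).1.prime.squarefree
  intro j hj k hk hjk
  simp only [Function.onFun]
  refine Nat.coprime_iff_isRelPrime.1 ?_
  refine (Nat.coprime_primes (hp j hj).1 (hp k hk).1).2 ?_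
  intro heq
  exact hjk (Ipr.inj hY (hp j hj) (heq ▸ hp k hk))

lemma DJ_odd (hY : 2 ≤ Y) (h : d ∈ DJ Y J) : Odd d := by
  rw [← Nat.not_even_iff_odd, even_iff_two_dvd]
  intro h2
  have := DJ_prime_gt (by linarith) h Nat.prime_two h2
  push_cast at this; linarith

lemma DJ_cop_a (hY : 0 < Y) (h : d ∈ DJ Y J) (a : ℤ) (ha : a ≠ 0) (haY : |(a : ℝ)| ≤ Y) : Int.gcd a d = 1 := by
  by_contra hne
  obtain ⟨q, hq, hqg⟩ := Nat.exists_prime_and_dvd hne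
  have h1 : (q : ℤ) ∣ a := (Int.natCast_dvd_natCast.2 hqg).trans (Int.gcd_dvd_left _ _)
  have h2 : q ∣ d := by
    have := (Int.natCast_dvd_natCast.2 hqg).trans (Int.gcd_dvd_right a (d : ℤ))
    exact_mod_cast this
  have h3 := DJ_prime_gt hY h hq h2
  have h4 := Int.le_of_dvd (abs_pos.2 ha) ((dvd_abs _ _).2 h1)
  have h5 : (q : ℝ) ≤ |(a : ℝ)| := by exact_mod_cast h4
  linarith

lemma DJ_mul (hY : 0 < Y) (hd : d ∈ DJ Y J) (he : e ∈ DJ Y J') (hJ : Disjoint J J') :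
    d * e ∈ DJ Y (J ∪ J') := by
  obtain ⟨p, hp, rfl⟩ := (mem_DJ hY).1 hd
  obtain ⟨p', hp', rfl⟩ := (mem_DJ hY).1 he
  refine (mem_DJ hY).2 ⟨fun j => if j ∈ J then p j else p' j, ?_, ?_⟩
  · intro j hj
    by_cases h : j ∈ J
    · simp only [if_pos h]; exact hp j h
    · simp only [if_neg h]; exact hp' j ((Finset.mem_union.1 hj).resolve_left h)
  · rw [Finset.prod_union hJ]
    congr 1
    · exact Finset.prod_congr rfl fun j hj => by rw [if_pos hj]
    · exact Finset.prod_congr rfl fun j hj => by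
        rw [if_neg (Finset.disjoint_right.1 hJ hj)]

lemma DJ_split (hY : 0 < Y) (hd : d ∈ DJ Y J) (hJ : J' ⊆ J) :
    ∃ r ∈ DJ Y J', ∃ s ∈ DJ Y (J \ J'), d = r * s := by
  obtain ⟨p, hp, rfl⟩ := (mem_DJ hY).1 hd
  refine ⟨∏ j ∈ J', p j, (mem_DJ hY).2 ⟨p, fun j hj => hp j (hJ hj), rfl⟩, ∏ j ∈ J \ J', p j,
    (mem_DJ hY).2 ⟨p, fun j hj => hp j (Finset.sdiff_subset hj), rfl⟩, ?_⟩
  rw [mul_comm]; exact (Finset.prod_sdiff hJ).symm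

lemma DJ_empty (hY : 0 < Y) : DJ Y ∅ = {1} := by
  ext d; rw [mem_DJ hY]; simp

lemma DJ_pair (hY : 0 < Y) (hd : d ∈ DJ Y J) (he : e ∈ DJ Y J) : ∃ J0 ⊆ J, ∃ s0 ∈ DJ Y J0,
    ∃ t1 ∈ DJ Y (J \ J0), ∃ t2 ∈ DJ Y (J \ J0), t1.Coprime t2 ∧ d = s0 * t1 ∧ e = s0 * t2 := by
  obtain ⟨p, hp, rfl⟩ := (mem_DJ hY).1 hd
  obtain ⟨p', hp', rfl⟩ := (mem_DJ hY).1 he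
  refine ⟨J.filter (fun j => p j = p' j), Finset.filter_subset _ _, ?_⟩
  set J0 := J.filter (fun j => p j = p' j) with hJ0
  have hs : J0 ⊆ J := Finset.filter_subset _ _
  refine ⟨∏ j ∈ J0, p j, (mem_DJ hY).2 ⟨p, fun j hj => hp j (hs hj), rfl⟩,
    ∏ j ∈ J \ J0, p j, (mem_DJ hY).2 ⟨p, fun j hj => hp j (Finset.sdiff_subset hj), rfl⟩,
    ∏ j ∈ J \ J0, p' j, (mem_DJ hY).2 ⟨p', fun j hj => hp' j (Finset.sdiff_subset hj), rfl⟩, ?_, ?_, ?_⟩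
  · refine Nat.Coprime.prod_left fun j hj => Nat.Coprime.prod_right fun k hk => ?_
    have hj' := Finset.sdiff_subset hj
    have hk' := Finset.sdiff_subset hk
    refine (Nat.coprime_primes (hp j hj').1 (hp' k hk').1).2 ?_
    intro heq
    have := Ipr.inj hY (hp j hj') (heq ▸ hp' k hk')
    subst this
    exact (Finset.mem_sdiff.1 hj).2 (Finset.mem_filter.2 ⟨hj', heq⟩)
  · rw [mul_comm]; exact (Finset.prod_sdiff hs).symm
  · have : ∏ j ∈ J0, p j = ∏ j ∈ J0, p' j :=
      Finset.prod_congr rfl fun j hj => (Finset.mem_filter.1 hj).2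
    rw [this, mul_comm]; exact (Finset.prod_sdiff hs).symm

lemma sum_DJ_split (hY : 0 < Y) (hJ : J' ⊆ J) (f : ℕ → ℝ) (hf : ∀ i, 0 ≤ f i) :
    ∑ d ∈ DJ Y J, f d ≤ ∑ r ∈ DJ Y J', ∑ s ∈ DJ Y (J \ J'), f (r * s) := by
  rw [← Finset.sum_product']
  refine sum_cover _ _ (fun x : ℕ × ℕ => x.1 * x.2) f hf fun d hd => ?_
  obtain ⟨r, hr, s, hs, rfl⟩ := DJ_split hY hd hJ
  exact ⟨(r, s), Finset.mem_product.2 ⟨hr, hs⟩, rfl⟩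

lemma sum_DJ_pair (hY : 0 < Y) (f : ℕ → ℕ → ℝ) (hf : ∀ i j, 0 ≤ f i j) :
    ∑ d ∈ DJ Y J, ∑ e ∈ DJ Y J, f d e ≤ ∑ J0 ∈ J.powerset, ∑ s0 ∈ DJ Y J0,
      ∑ t1 ∈ DJ Y (J \ J0), ∑ t2 ∈ (DJ Y (J \ J0)).filter (fun t2 => t1.Coprime t2),
      f (s0 * t1) (s0 * t2) := by
  rw [← Finset.sum_product']
  have e : ∀ J0 s0, ∑ t1 ∈ DJ Y (J \ J0), ∑ t2 ∈ (DJ Y (J \ J0)).filter (fun t2 => t1.Coprime t2),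
      f (s0 * t1) (s0 * t2) = ∑ x ∈ (DJ Y (J \ J0) ×ˢ DJ Y (J \ J0)).filter (fun x => x.1.Coprime x.2),
      f (s0 * x.1) (s0 * x.2) := by
    intro J0 s0
    rw [Finset.sum_filter, Finset.sum_product]
    refine Finset.sum_congr rfl fun t1 _ => ?_
    rw [Finset.sum_filter]
  simp_rw [e]
  rw [Finset.sum_sigma', Finset.sum_sigma']
  refine sum_cover (DJ Y J ×ˢ DJ Y J) _
    (fun x : (Σ _ : (Σ _ : Finset ℕ, ℕ), ℕ × ℕ) => (x.1.2 * x.2.1, x.1.2 * x.2.2))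
    (fun x => f x.1 x.2) (fun x => hf _ _) ?_
  rintro ⟨d, e⟩ hde
  obtain ⟨hd, he⟩ := Finset.mem_product.1 hde
  obtain ⟨J0, hJ0, s0, hs0, t1, ht1, t2, ht2, hc, h1, h2⟩ := DJ_pair hY hd he
  refine ⟨⟨⟨J0, s0⟩, (t1, t2)⟩, ?_, ?_⟩
  · simp only [Finset.mem_sigma, Finset.mem_powerset, Finset.mem_filter, Finset.mem_product]
    exact ⟨⟨hJ0, hs0⟩, ⟨ht1, ht2⟩, hc⟩
  · simp only [Prod.mk.injEq]; exact ⟨h1.symm, h2.symm⟩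
end

end

section

lemma exists_phase (z : ℂ) : ∃ c : ℂ, ‖c‖ ≤ 1 ∧ (‖z‖ : ℂ) = c * z := by
  by_cases hz : z = 0
  · exact ⟨0, by simp, by simp [hz]⟩
  · refine ⟨(starRingEnd ℂ) z / ‖z‖, ?_, ?_⟩
    · rw [norm_div, RCLike.norm_conj, Complex.norm_real, norm_norm]
      exact div_self_le_one _
    · have : (‖z‖ : ℂ) ≠ 0 := by exact_mod_cast (norm_ne_zero_iff.2 hz)
      field_simp
      rw [mul_comm, Complex.mul_conj']

lemma sum_norm_eq {ι : Type*} (s : Finset ι) (f : ι → ℂ) : ∃ c : ι → ℂ, (∀ i, ‖c i‖ ≤ 1) ∧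
    ((∑ i ∈ s, ‖f i‖ : ℝ) : ℂ) = ∑ i ∈ s, c i * f i := by
  choose c h1 h2 using fun i => exists_phase (f i)
  refine ⟨c, h1, ?_⟩
  push_cast
  exact Finset.sum_congr rfl fun i _ => h2 i

lemma ell_sum (𝓤 : Finset ℤ) (α β : ℤ) (h𝓤 : 𝓤 ⊆ Finset.Ico α β) (m M : ℕ) (hm : 0 < m)
    (hM : β - α ≤ m * (M + 1)) (u : ℤ) (hu : u ∈ 𝓤) (F : ℤ → ℂ) :
    ∑ u2 ∈ 𝓤.filter (fun u2 => u2 ≡ u [ZMOD m]), F u2 =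
    ∑ l ∈ Finset.Icc (-(M : ℤ)) M, if u + l * m ∈ 𝓤 then F (u + l * m) else 0 := by
  have hmZ : (0 : ℤ) < m := by exact_mod_cast hm
  rw [← Finset.sum_filter]
  symm
  refine Finset.sum_bij (fun l _ => u + l * m) ?_ ?_ ?_ ?_
  · intro l hl
    have := (Finset.mem_filter.1 hl).2
    rw [Finset.mem_filter]
    refine ⟨this, ?_⟩
    simp [Int.ModEq]
  · intro l _ l' _ h
    have : l * m = l' * (m : ℤ) := by linarith
    exact mul_right_cancel₀ hmZ.ne' this
  · intro u2 hu2
    obtain ⟨h1, h2⟩ := Finset.mem_filter.1 hu2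
    obtain ⟨k, hk⟩ := h2.symm.dvd
    have hA := Finset.mem_Ico.1 (h𝓤 hu)
    have hB := Finset.mem_Ico.1 (h𝓤 h1)
    have e : u + k * m = u2 := by linarith
    refine ⟨k, ?_, e⟩
    rw [Finset.mem_filter, e]
    refine ⟨?_, h1⟩
    have b1 : (m : ℤ) * k < m * (M + 1) := by linarith
    have b2 : (m : ℤ) * (-k) < m * (M + 1) := by linarith
    have b3 := lt_of_mul_lt_mul_left b1 hmZ.le
    have b4 := lt_of_mul_lt_mul_left b2 hmZ.le
    rw [Finset.mem_Icc]; omega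
  · intro _ _; rfl

lemma exp_abs {P : Finset (ℕ × ℕ)} {H : ℕ} {N Lim L : ℝ} (d : PData P H N Lim L) {g G : ℕ}
    (cd : CData P g G) (a : ℤ) (ha : Int.gcd a g = 1) (ω : ℕ × ℕ → ℤ → ℂ)
    (hω : ∀ p h, ‖ω p h‖ ≤ 1) (𝓤 : Finset ℤ) (α β : ℤ) (B : ℝ) (h𝓤 : 𝓤 ⊆ Finset.Ico α β)
    (hαβ : α ≤ β) (h : (β : ℝ) - α ≤ B)
    (hmB : ((G : ℝ) * N ^ 2) ^ 2 ≤ B) (hgL : (g : ℝ) ≤ Lim) (hlog : 1 + Real.log g ≤ L)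
    (A : ℤ → ℤ → ℂ) (hA : ∀ u1 u2, ‖A u1 u2‖ ≤ 1) (m ρ : ℕ) (hm : 0 < m) (hρ : g * G = ρ) :
    ∑ p ∈ P, ‖∑ u1 ∈ 𝓤, ∑ u2 ∈ 𝓤.filter (fun u2 => u2 ≡ u1 [ZMOD m]), A u1 u2 *
      ∑ h ∈ Hs H, ω p h * phs a (ρ * p.1) p.2 h u1 u2‖ ≤
    (2 * B / m + 1) * Real.sqrt (B * (2 * H * N * L ^ 2 * B + 32 * L ^ 5 * N ^ 2 * (H ^ 2 + H * N) *
      Real.sqrt (B * ((G : ℝ) * N ^ 2) ^ 2 + B ^ 2 / g + B * g))) := by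
  set Co : ℝ := 2 * H * N * L ^ 2 * B + 32 * L ^ 5 * N ^ 2 * (H ^ 2 + H * N) *
      Real.sqrt (B * ((G : ℝ) * N ^ 2) ^ 2 + B ^ 2 / g + B * g) with hCo
  obtain ⟨c, hc1, hc2⟩ := sum_norm_eq P (fun p => ∑ u1 ∈ 𝓤,
    ∑ u2 ∈ 𝓤.filter (fun u2 => u2 ≡ u1 [ZMOD m]), A u1 u2 *
      ∑ h ∈ Hs H, ω p h * phs a (ρ * p.1) p.2 h u1 u2)
  have hBn : 0 ≤ B := by
    have : (α : ℝ) ≤ β := by exact_mod_cast hαβ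
    linarith
  have hmR : (0 : ℝ) < m := by exact_mod_cast hm
  set M : ℕ := ⌊B / m⌋₊ with hM
  have hMB : (β : ℤ) - α ≤ m * (M + 1) := by
    have h1 : B / m < M + 1 := Nat.lt_floor_add_one _
    rw [div_lt_iff₀ hmR] at h1
    have : ((β - α : ℤ) : ℝ) ≤ ((m * (M + 1) : ℤ) : ℝ) := by push_cast; linarith
    exact_mod_cast this
  set f : ℤ → ℤ → ℂ := fun l u => if u ∈ 𝓤 ∧ u + l * m ∈ 𝓤 then A u (u + l * m) else 0 with hf
  have hf1 : ∀ l u, ‖f l u‖ ≤ 1 := by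
    intro l u; rw [hf]; simp only; split_ifs
    · exact hA _ _
    · simp
  set S : ℤ → ℤ → ℂ := fun l u => ∑ x ∈ om P H, (c x.1 * ω x.1 x.2) *
    phs a (g * (G * x.1.1)) x.1.2 x.2 u (u + l * m) with hS
  have e1 : ∑ p ∈ P, c p * (∑ u1 ∈ 𝓤,
    ∑ u2 ∈ 𝓤.filter (fun u2 => u2 ≡ u1 [ZMOD m]), A u1 u2 *
      ∑ h ∈ Hs H, ω p h * phs a (ρ * p.1) p.2 h u1 u2) =
      ∑ l ∈ Finset.Icc (-(M : ℤ)) M, ∑ u ∈ Finset.Ico α β, f l u * S l u := by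
    have e2 : ∀ l u, f l u * S l u = ∑ p ∈ P, c p * (f l u * ∑ h ∈ Hs H, ω p h *
        phs a (ρ * p.1) p.2 h u (u + l * m)) := by
      intro l u
      rw [hS]; simp only
      unfold om
      rw [Finset.sum_product, Finset.mul_sum]
      refine Finset.sum_congr rfl fun p _ => ?_
      simp only [Finset.mul_sum]
      refine Finset.sum_congr rfl fun h _ => ?_
      rw [← hρ, mul_assoc g G p.1]; ring
    have e3 : ∀ p, ∑ u1 ∈ 𝓤,
      ∑ u2 ∈ 𝓤.filter (fun u2 => u2 ≡ u1 [ZMOD m]), A u1 u2 *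
      ∑ h ∈ Hs H, ω p h * phs a (ρ * p.1) p.2 h u1 u2 =
      ∑ l ∈ Finset.Icc (-(M : ℤ)) M, ∑ u ∈ Finset.Ico α β, f l u * ∑ h ∈ Hs H, ω p h *
        phs a (ρ * p.1) p.2 h u (u + l * m) := by
      intro p
      rw [Finset.sum_comm, ← Finset.inter_eq_right.2 h𝓤, ← Finset.filter_mem_eq_inter, Finset.sum_filter]
      refine Finset.sum_congr rfl fun u _ => ?_
      rw [Finset.filter_mem_eq_inter, Finset.inter_eq_right.2 h𝓤]
      split_ifs with hu
      · rw [ell_sum 𝓤 α β h𝓤 m M hm hMB u hu]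
        refine Finset.sum_congr rfl fun l _ => ?_
        rw [hf]; simp only [hu, true_and]
        split_ifs
        · rfl
        · rw [zero_mul]
      · symm; refine Finset.sum_eq_zero fun l _ => ?_
        rw [hf]; simp only [hu, false_and, if_false, zero_mul]
    simp_rw [e2, e3, Finset.mul_sum]
    rw [Finset.sum_comm]
    refine Finset.sum_congr rfl fun l _ => ?_
    rw [Finset.sum_comm]
  rw [e1] at hc2
  have h3 := congrArg norm hc2
  rw [Complex.norm_real, Real.norm_of_nonneg (Finset.sum_nonneg fun _ _ => norm_nonneg _)] at h3
  rw [h3]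
  have h4 : ∀ l ∈ Finset.Icc (-(M : ℤ)) M, ‖∑ u ∈ Finset.Ico α β, f l u * S l u‖ ≤ Real.sqrt (B * Co) := by
    intro l _
    refine Real.le_sqrt_of_sq_le ?_
    refine (cs_one _ _ _ fun u _ => hf1 l u).trans ?_
    have hcore := core d cd a ha (fun x => c x.1 * ω x.1 x.2) (fun x _ => by
      rw [norm_mul]; exact mul_le_one₀ (hc1 _) (norm_nonneg _) (hω _ _)) (l * m) α β B hαβ h hmB hgL hlog
    have hcard : ((Finset.Ico α β).card : ℝ) ≤ B := by
      rw [Int.card_Ico]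
      have : (((β - α).toNat : ℤ) : ℝ) = ((β - α : ℤ) : ℝ) := by
        rw [Int.toNat_of_nonneg (by linarith)]
      rw [Int.cast_natCast] at this
      rw [this]; push_cast; linarith
    exact mul_le_mul hcard hcore (Finset.sum_nonneg fun _ _ => by positivity) hBn
  refine (norm_sum_le _ _).trans ((Finset.sum_le_sum h4).trans ?_)
  rw [Finset.sum_const, nsmul_eq_mul]
  refine mul_le_mul_of_nonneg_right ?_ (Real.sqrt_nonneg _)
  rw [Int.card_Icc]
  have e5 : ((M : ℤ) + 1 - -(M : ℤ)).toNat = 2 * M + 1 := by omega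
  rw [e5]; push_cast
  have : (M : ℝ) ≤ B / m := Nat.floor_le (by positivity)
  have e6 : 2 * B / m = 2 * (B / m) := by ring
  rw [e6]; linarith

lemma exp_lemma {Y : ℝ} (hY : 2 ≤ Y) {K : ℕ} {Jr J1 Jz Jg : Finset ℕ} (hJr : Jr ⊆ Finset.range K)
    (hJ1 : J1 ⊆ Finset.range K) (hdis : Disjoint Jr J1) (hJz : Jz ⊆ J1) (hJg : Jg ⊆ Jr ∪ (J1 \ Jz))
    {rt : ℕ} (hrt : rt ∈ DJ Y Jr) (a : ℤ) (ha0 : a ≠ 0) (haY : |(a : ℝ)| ≤ Y) (H : ℕ) (N Lim L Gm B : ℝ)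
    (hN : N = cK K ^ 2 * Y ^ (Jz.card + J1.card))
    (hGm : Gm = cK K * Y ^ ((Jr ∪ (J1 \ Jz)) \ Jg).card) (hL1 : 1 ≤ L)
    (htau : ∀ n : ℕ, 0 < n → (n : ℝ) ≤ Lim → (n.divisors.card : ℝ) ≤ L)
    (hlim : (H : ℝ) * N ^ 2 ≤ Lim) (hgLim : cK K * Y ^ Jg.card ≤ Lim) (hlog : 1 + Real.log Lim ≤ L)
    (𝓤 : Finset ℤ) (α β : ℤ) (h𝓤 : 𝓤 ⊆ Finset.Ico α β)
    (hαβ : α ≤ β) (h : (β : ℝ) - α ≤ B) (hmB : (Gm * N ^ 2) ^ 2 ≤ B)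
    (A : ℤ → ℤ → ℂ) (hA : ∀ u1 u2, ‖A u1 u2‖ ≤ 1) (ω : ℕ → ℕ → ℤ → ℂ) (hω : ∀ t1 t2 h, ‖ω t1 t2 h‖ ≤ 1) :
    ∑ t1 ∈ DJ Y J1, ∑ t2 ∈ (DJ Y J1).filter (fun t2 => t1.Coprime t2),
      ‖∑ u1 ∈ 𝓤, ∑ u2 ∈ 𝓤.filter (fun u2 => u2 ≡ u1 [ZMOD (rt ^ 2 : ℕ)]), A u1 u2 *
      ∑ h ∈ Hs H, ω t1 t2 h * phs a (rt * t1) t2 h u1 u2‖ ≤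
    cK K * Y ^ (J1 \ Jz).card * ((2 * B / (rt ^ 2 : ℕ) + 1) *
    Real.sqrt (B * (2 * H * N * L ^ 2 * B + 32 * L ^ 5 * N ^ 2 * (H ^ 2 + H * N) *
      Real.sqrt (B * (Gm * N ^ 2) ^ 2 + B ^ 2 / Y ^ Jg.card + B * (cK K * Y ^ Jg.card))))) := by
  have hY0 : 0 < Y := by linarith
  have hY1 : 1 ≤ Y := by linarith
  have hBn : 0 ≤ B := by
    have : (α : ℝ) ≤ β := by exact_mod_cast hαβ
    linarith
  have hrt0 := DJ_pos hrt
  set T : ℕ → ℕ → ℝ := fun t1 t2 => ‖∑ u1 ∈ 𝓤, ∑ u2 ∈ 𝓤.filter (fun u2 => u2 ≡ u1 [ZMOD (rt ^ 2 : ℕ)]), A u1 u2 *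
      ∑ h ∈ Hs H, ω t1 t2 h * phs a (rt * t1) t2 h u1 u2‖ with hT
  have hT0 : ∀ t1 t2, 0 ≤ T t1 t2 := fun _ _ => norm_nonneg _
  set Bd := ((2 * B / (rt ^ 2 : ℕ) + 1) *
    Real.sqrt (B * (2 * H * N * L ^ 2 * B + 32 * L ^ 5 * N ^ 2 * (H ^ 2 + H * N) *
      Real.sqrt (B * (Gm * N ^ 2) ^ 2 + B ^ 2 / Y ^ Jg.card + B * (cK K * Y ^ Jg.card))))) with hBd
  have hJw : J1 \ Jz ⊆ J1 := Finset.sdiff_subset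
  have s1 := sum_DJ_split hY0 hJw (fun t1 => ∑ t2 ∈ (DJ Y J1).filter (fun t2 => t1.Coprime t2), T t1 t2)
    (fun _ => Finset.sum_nonneg fun _ _ => hT0 _ _)
  rw [Finset.sdiff_sdiff_eq_self hJz] at s1
  refine s1.trans ?_
  have key : ∀ w ∈ DJ Y (J1 \ Jz), ∑ z ∈ DJ Y Jz, ∑ t2 ∈ (DJ Y J1).filter (fun t2 => (w * z).Coprime t2),
      T (w * z) t2 ≤ Bd := by
    intro w hw
    have hdw : Disjoint Jr (J1 \ Jz) := Finset.disjoint_of_subset_right hJw hdis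
    have hρ := DJ_mul hY0 hrt hw hdw
    obtain ⟨g, hg, G, hG, hgG⟩ := DJ_split hY0 hρ hJg
    set P : Finset (ℕ × ℕ) := (DJ Y Jz ×ˢ DJ Y J1).filter (fun x => (w * x.1).Coprime x.2) with hP
    have e1 : ∑ z ∈ DJ Y Jz, ∑ t2 ∈ (DJ Y J1).filter (fun t2 => (w * z).Coprime t2), T (w * z) t2 =
        ∑ p ∈ P, T (w * p.1) p.2 := by
      rw [hP, Finset.sum_filter, Finset.sum_product]
      refine Finset.sum_congr rfl fun z _ => ?_
      rw [Finset.sum_filter]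
    have memP : ∀ p ∈ P, p.1 ∈ DJ Y Jz ∧ p.2 ∈ DJ Y J1 ∧ (w * p.1).Coprime p.2 := by
      intro p hp
      rw [hP, Finset.mem_filter, Finset.mem_product] at hp
      tauto
    have hJzK : Jz ⊆ Finset.range K := hJz.trans hJ1
    have hN' : N = (cK K * Y ^ Jz.card) * (cK K * Y ^ J1.card) := by rw [hN, pow_add]; ring
    have hc1 := cK_one K
    have p1 : 1 ≤ cK K * Y ^ Jz.card := one_le_mul_of_one_le_of_one_le hc1 (one_le_pow₀ hY1)
    have p2 : 1 ≤ cK K * Y ^ J1.card := one_le_mul_of_one_le_of_one_le hc1 (one_le_pow₀ hY1)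
    have hJρ : Jr ∪ (J1 \ Jz) ⊆ Finset.range K := Finset.union_subset hJr (hJw.trans hJ1)
    have hgR : (g : ℝ) ≤ cK K * Y ^ Jg.card := DJ_le hY0 (hJg.trans hJρ) hg
    have hgR' : Y ^ Jg.card ≤ g := DJ_ge hY0 hg
    have hGR : (G : ℝ) ≤ Gm := by
      rw [hGm]; exact DJ_le hY0 (Finset.sdiff_subset.trans hJρ) hG
    have d : PData P H N Lim L := by
      refine ⟨?_, ?_, ?_, ?_, hL1, hlim, htau⟩
      · intro p hp
        exact ⟨DJ_pos (memP p hp).1, DJ_pos (memP p hp).2.1⟩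
      · intro p hp
        rw [hN']; push_cast
        exact mul_le_mul (DJ_le hY0 hJzK (memP p hp).1) (DJ_le hY0 hJ1 (memP p hp).2.1) (by positivity)
          (by linarith)
      · refine (Nat.cast_le.2 (Finset.card_filter_le _ _)).trans ?_
        rw [Finset.card_product, hN']; push_cast
        exact mul_le_mul (DJ_card hY0 hJzK) (DJ_card hY0 hJ1) (by positivity) (by linarith)
      · rw [hN']; exact one_le_mul_of_one_le_of_one_le p1 p2
    have hdz : Disjoint (Jr ∪ (J1 \ Jz)) Jz := by
      rw [Finset.disjoint_union_left]
      exact ⟨Finset.disjoint_of_subset_right hJz hdis, Finset.sdiff_disjoint⟩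
    have cd : CData P g G := by
      refine ⟨DJ_sqf hY0 hg, DJ_odd hY hg, DJ_pos hG, ?_, ?_⟩
      · intro p hp
        refine Nat.Coprime.mul_right ?_ ?_
        · exact DJ_coprime hY0 hg hG Finset.disjoint_sdiff
        · exact DJ_coprime hY0 hg (memP p hp).1 (Finset.disjoint_of_subset_left hJg hdz)
      · intro p hp
        rw [← mul_assoc, ← hgG, mul_assoc]
        exact Nat.Coprime.mul_left (DJ_coprime hY0 hrt (memP p hp).2.1 hdis) (memP p hp).2.2
    have hg0 : 0 < g := DJ_pos hg
    have hgp : (0 : ℝ) < g := by exact_mod_cast hg0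
    have m1 : ((G : ℝ) * N ^ 2) ^ 2 ≤ (Gm * N ^ 2) ^ 2 := by gcongr
    have main := exp_abs d cd a (DJ_cop_a hY0 hg a ha0 haY) (fun p h => ω (w * p.1) p.2 h)
      (fun _ _ => hω _ _ _) 𝓤 α β B h𝓤 hαβ h (m1.trans hmB)
      (hgR.trans hgLim) (le_trans (by gcongr; exact hgR.trans hgLim) hlog) A hA (rt ^ 2) (rt * w)
      (by positivity) hgG.symm
    rw [e1, hT]
    simp only [← mul_assoc]
    refine main.trans ?_
    rw [hBd]
    have hN0 := d.N1
    simp only [← mul_assoc]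
    have m2 : B ^ 2 / (g : ℝ) ≤ B ^ 2 / Y ^ Jg.card := by gcongr
    have m3 : B * (g : ℝ) ≤ B * (cK K) * Y ^ Jg.card := by
      rw [mul_assoc]; gcongr
    have m4 : B * ((G : ℝ) * N ^ 2) ^ 2 ≤ B * (Gm * N ^ 2) ^ 2 := by gcongr
    gcongr
  refine (Finset.sum_le_sum key).trans ?_
  rw [Finset.sum_const, nsmul_eq_mul]
  refine mul_le_mul_of_nonneg_right (DJ_card hY0 (hJw.trans hJ1)) ?_
  rw [hBd]; positivity

end

section

def dv (a : ℤ) (d : ℕ) (u v : ℤ) : ℂ := if ((d ^ 2 : ℕ) : ℤ) ∣ u * v - a then 1 else 0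

lemma cancel_unit {q : ℕ} {u x y : ℤ} (hu : Int.gcd u q = 1) (h : u * x ≡ u * y [ZMOD q]) :
    x ≡ y [ZMOD q] := by
  rw [Int.modEq_iff_dvd] at h ⊢
  have h1 : (q : ℤ) ∣ u * (y - x) := by rw [mul_sub]; exact h
  exact (Int.isCoprime_iff_gcd_eq_one.2 hu).symm.dvd_of_dvd_mul_left h1

lemma modEq_mul_cop {m n : ℕ} (hc : m.Coprime n) {x y : ℤ} (h1 : x ≡ y [ZMOD m]) (h2 : x ≡ y [ZMOD n]) :
    x ≡ y [ZMOD (m * n : ℕ)] := by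
  rw [Int.modEq_iff_dvd] at h1 h2 ⊢
  push_cast
  exact (Nat.isCoprime_iff_coprime.2 hc).mul_dvd h1 h2

lemma int_crt {m n : ℕ} (hc : m.Coprime n) (c1 c2 : ℤ) : ∃ c : ℤ, c ≡ c1 [ZMOD m] ∧ c ≡ c2 [ZMOD n] := by
  obtain ⟨x, y, h⟩ := Nat.isCoprime_iff_coprime.2 hc
  refine ⟨c2 * (x * m) + c1 * (y * n), ?_, ?_⟩
  · have e : c2 * (x * m) + c1 * (y * n) = c1 + m * (x * (c2 - c1)) := by
      have : y * n = 1 - x * m := by linarith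
      rw [this]; ring
    rw [e]; simp [Int.ModEq]
  · have e : c2 * (x * m) + c1 * (y * n) = c2 + n * (y * (c1 - c2)) := by
      have : x * m = 1 - y * n := by linarith
      rw [this]; ring
    rw [e]; simp [Int.ModEq]

lemma dvd_iff_modEq {q : ℕ} {x a : ℤ} : (q : ℤ) ∣ x - a ↔ x ≡ a [ZMOD q] := by
  rw [Int.modEq_comm, Int.modEq_iff_dvd]

lemma dv_eq (a : ℤ) (d : ℕ) (u v : ℤ) : dv a d u v = if u * v ≡ a [ZMOD (d ^ 2 : ℕ)] then 1 else 0 := by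
  unfold dv
  simp only [dvd_iff_modEq]

lemma pair_sum {a : ℤ} {J Λ M' H : ℕ} (hJ : 0 < J) (hΛ : 0 < Λ) (v0 : ℤ) {d0 e1 e2 : ℕ}
    (p0 : 0 < d0) (p1 : 0 < e1) (p2 : 0 < e2) (c1 : (d0 * e1).Coprime e2) (c2 : d0.Coprime e2)
    (hq : (d0 * e1 * e2) ^ 2 * M' = J) (hH : (d0 * e1 * e2) ^ 2 ≤ Λ * (H + 1))
    (ha : Int.gcd a d0 = 1) {u1 u2 : ℤ} (h1 : Int.gcd u1 (d0 * e1 : ℕ) = 1) (h2 : Int.gcd u2 (d0 * e2 : ℕ) = 1) :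
    ∑ v ∈ Finset.Ico (0 : ℤ) (Λ * J : ℕ), (fw J Λ v0 v : ℂ) * (dv a (d0 * e1) u1 v * dv a (d0 * e2) u2 v) =
    if u2 ≡ u1 [ZMOD (d0 ^ 2 : ℕ)] then ((Λ : ℂ) / ((d0 * e1 * e2) ^ 2 : ℕ)) * (1 + ∑ h ∈ Hs H,
      ((fc J (Λ * M') h : ℂ) * ee (-((h * v0 : ℤ) : ℝ) / ((d0 * e1 * e2) ^ 2 : ℕ))) * phs a (d0 * e1) e2 h u1 u2)
    else 0 := by
  have h1' := gcd_mul_one.1 h1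
  have h2' := gcd_mul_one.1 h2
  have dd1 : ((d0 ^ 2 : ℕ) : ℤ) ∣ (((d0 * e1) ^ 2 : ℕ) : ℤ) := by
    push_cast; exact ⟨(e1 : ℤ) ^ 2, by ring⟩
  have dd2 : ((d0 ^ 2 : ℕ) : ℤ) ∣ (((d0 * e2) ^ 2 : ℕ) : ℤ) := by
    push_cast; exact ⟨(e2 : ℤ) ^ 2, by ring⟩
  have de2 : ((e2 ^ 2 : ℕ) : ℤ) ∣ (((d0 * e2) ^ 2 : ℕ) : ℤ) := by
    push_cast; exact ⟨(d0 : ℤ) ^ 2, by ring⟩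
  split_ifs with hu
  · obtain ⟨c, hc1, hc2⟩ := int_crt (m := (d0 * e1) ^ 2) (n := e2 ^ 2) (Nat.Coprime.pow 2 2 c1)
      (a * iv ((d0 * e1) ^ 2) u1) (a * iv (e2 ^ 2) u2)
    have g1 : u1 * c ≡ a [ZMOD ((d0 * e1) ^ 2 : ℕ)] := by
      refine (hc1.mul_left u1).trans ?_
      have := (iv_spec (gcd_sq_one h1)).mul_left a
      rw [mul_one] at this
      exact (modEq_of_eq (by ring)).trans this
    have g2 : u2 * c ≡ a [ZMOD (e2 ^ 2 : ℕ)] := by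
      refine (hc2.mul_left u2).trans ?_
      have := (iv_spec (gcd_sq_one h2'.2)).mul_left a
      rw [mul_one] at this
      exact (modEq_of_eq (by ring)).trans this
    have key : ∀ v : ℤ, dv a (d0 * e1) u1 v * dv a (d0 * e2) u2 v =
        if v ≡ c [ZMOD ((d0 * e1 * e2) ^ 2 : ℕ)] then 1 else 0 := by
      intro v
      rw [dv_eq, dv_eq]
      by_cases hv : v ≡ c [ZMOD ((d0 * e1 * e2) ^ 2 : ℕ)]
      · have k1 : u1 * v ≡ a [ZMOD ((d0 * e1) ^ 2 : ℕ)] := by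
          refine Int.ModEq.trans ?_ g1
          refine (hv.of_dvd ?_).mul_left u1
          push_cast; exact ⟨(e2 : ℤ) ^ 2, by ring⟩
        have k2 : u2 * v ≡ a [ZMOD (e2 ^ 2 : ℕ)] := by
          refine Int.ModEq.trans ?_ g2
          refine (hv.of_dvd ?_).mul_left u2
          push_cast; exact ⟨((d0 : ℤ) * e1) ^ 2, by ring⟩
        have k3 : u2 * v ≡ a [ZMOD (d0 ^ 2 : ℕ)] := (hu.mul_right v).trans (k1.of_dvd dd1)
        have k4 : u2 * v ≡ a [ZMOD ((d0 * e2) ^ 2 : ℕ)] := by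
          rw [mul_pow]; exact modEq_mul_cop (Nat.Coprime.pow 2 2 c2) k3 k2
        rw [if_pos k1, if_pos k4, if_pos hv, one_mul]
      · rw [if_neg hv]
        by_cases k1 : u1 * v ≡ a [ZMOD ((d0 * e1) ^ 2 : ℕ)]
        · by_cases k4 : u2 * v ≡ a [ZMOD ((d0 * e2) ^ 2 : ℕ)]
          · exfalso; apply hv
            rw [mul_pow]
            refine modEq_mul_cop (Nat.Coprime.pow 2 2 c1) ?_ ?_
            · exact cancel_unit (gcd_sq_one h1) (k1.trans g1.symm)
            · exact cancel_unit (gcd_sq_one h2'.2) ((k4.of_dvd de2).trans g2.symm)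
          · rw [if_neg k4, mul_zero]
        · rw [if_neg k1, zero_mul]
    simp_rw [key, mul_ite, mul_one, mul_zero]
    rw [← Finset.sum_filter, fw_class J Λ ((d0 * e1 * e2) ^ 2) M' H hJ hΛ hq hH v0 c]
    congr 2
    refine Finset.sum_congr rfl fun h _ => ?_
    rw [phs_eval (Nat.mul_pos p0 p1) p2 c1 h h1 h2'.2 g1 g2, mul_assoc (fc J (Λ * M') h : ℂ), ← ee_add]
    congr 2
    push_cast; ring
  · refine Finset.sum_eq_zero fun v _ => ?_
    rw [dv_eq, dv_eq]
    by_cases k1 : u1 * v ≡ a [ZMOD ((d0 * e1) ^ 2 : ℕ)]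
    · by_cases k4 : u2 * v ≡ a [ZMOD ((d0 * e2) ^ 2 : ℕ)]
      · exfalso; apply hu
        have l1 := k1.of_dvd dd1
        have l2 := k4.of_dvd dd2
        have hv : Int.gcd v (d0 ^ 2 : ℕ) = 1 := by
          rw [← Int.isCoprime_iff_gcd_eq_one]
          have hac := Int.isCoprime_iff_gcd_eq_one.2 (gcd_sq_one ha)
          obtain ⟨k, hk⟩ := l1.dvd
          have e : a = v * u1 + (d0 ^ 2 : ℕ) * k := by linarith
          rw [e] at hac
          exact (IsCoprime.add_mul_left_left_iff.1 hac).of_mul_left_left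
        have l3 := l2.trans l1.symm
        rw [mul_comm u2, mul_comm u1] at l3
        exact cancel_unit hv l3
      · rw [if_neg k4, mul_zero, mul_zero]
    · rw [if_neg k1, zero_mul, mul_zero]

lemma Hs_zero : Hs 0 = ∅ := by
  unfold Hs; simp

/-- the arithmetic term -/
def tm (a : ℤ) (r s : ℕ) (u v : ℤ) : ℂ :=
  (if Int.gcd u (r * s : ℕ) = 1 then 1 else 0) * (dv a r u v * (dv a s u v - 1 / (s : ℂ) ^ 2))

lemma dv_conj (a : ℤ) (d : ℕ) (u v : ℤ) : (starRingEnd ℂ) (dv a d u v) = dv a d u v := by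
  unfold dv; split_ifs <;> simp

lemma tm_conj (a : ℤ) (r s : ℕ) (u v : ℤ) : (starRingEnd ℂ) (tm a r s u v) = tm a r s u v := by
  unfold tm
  simp only [map_mul, map_sub, dv_conj, map_div₀, map_one, map_pow, Complex.conj_natCast]
  congr 1
  split_ifs <;> simp

lemma dv_mul {a : ℤ} {r s : ℕ} (hc : r.Coprime s) (u v : ℤ) : dv a r u v * dv a s u v = dv a (r * s) u v := by
  unfold dv
  have : (((r * s) ^ 2 : ℕ) : ℤ) ∣ u * v - a ↔ ((r ^ 2 : ℕ) : ℤ) ∣ u * v - a ∧ ((s ^ 2 : ℕ) : ℤ) ∣ u * v - a := by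
    have hcop : IsCoprime ((r ^ 2 : ℕ) : ℤ) ((s ^ 2 : ℕ) : ℤ) :=
      Nat.isCoprime_iff_coprime.2 (Nat.Coprime.pow 2 2 hc)
    constructor
    · intro h
      refine ⟨Dvd.dvd.trans ?_ h, Dvd.dvd.trans ?_ h⟩
      · push_cast; exact ⟨(s : ℤ) ^ 2, by ring⟩
      · push_cast; exact ⟨(r : ℤ) ^ 2, by ring⟩
    · rintro ⟨h1, h2⟩
      have := hcop.mul_dvd h1 h2
      push_cast at this ⊢
      rw [mul_pow]; exact this
  by_cases h1 : ((r ^ 2 : ℕ) : ℤ) ∣ u * v - a <;> by_cases h2 : ((s ^ 2 : ℕ) : ℤ) ∣ u * v - a <;>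
    simp only [this, h1, h2, and_true, and_false, if_true, if_false] <;> simp

structure TData (a : ℤ) (J Λ H r s0 t1 t2 : ℕ) : Prop where
  hJ : 0 < J
  hΛ : 0 < Λ
  r0 : 0 < r
  s00 : 0 < s0
  t10 : 0 < t1
  t20 : 0 < t2
  crs : r.Coprime s0
  cr1 : r.Coprime t1
  cr2 : r.Coprime t2
  cs1 : s0.Coprime t1
  cs2 : s0.Coprime t2
  c12 : t1.Coprime t2
  hq : (r * s0 * t1 * t2) ^ 2 ∣ J
  hH : (r * s0 * t1 * t2) ^ 2 ≤ Λ * (H + 1)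
  b1 : (r * (s0 * t1)) ^ 2 ≤ Λ
  b2 : (r * (s0 * t2)) ^ 2 ≤ Λ
  har : Int.gcd a r = 1
  has : Int.gcd a s0 = 1

lemma TT_eval {a : ℤ} {J Λ H r s0 t1 t2 : ℕ} (d : TData a J Λ H r s0 t1 t2) (v0 : ℤ) : ∃ ω : ℤ → ℂ,
    (∀ h, ‖ω h‖ ≤ 1) ∧ ∀ u1 u2 : ℤ,
    ∑ v ∈ Finset.Ico (0 : ℤ) (Λ * J : ℕ), (fw J Λ v0 v : ℂ) * (tm a r (s0 * t1) u1 v * tm a r (s0 * t2) u2 v) =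
    (if u2 ≡ u1 [ZMOD ((r * s0) ^ 2 : ℕ)] then ((Λ : ℂ) / ((r * s0 * t1 * t2) ^ 2 : ℕ)) * ∑ h ∈ Hs H,
      ω h * phs a (r * s0 * t1) t2 h u1 u2 else 0) +
    (if Int.gcd u1 (r * (s0 * t1) : ℕ) = 1 ∧ Int.gcd u2 (r * (s0 * t2) : ℕ) = 1 then
      (if u2 ≡ u1 [ZMOD ((r * s0) ^ 2 : ℕ)] then ((Λ : ℂ) / ((r * s0 * t1 * t2) ^ 2 : ℕ)) else 0) -
      (if u2 ≡ u1 [ZMOD (r ^ 2 : ℕ)] then ((Λ : ℂ) / ((r * (s0 * t1) * (s0 * t2)) ^ 2 : ℕ)) else 0) else 0) := by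
  obtain ⟨M', hM'⟩ := d.hq
  refine ⟨fun h => (fc J (Λ * M') h : ℂ) * ee (-((h * v0 : ℤ) : ℝ) / ((r * s0 * t1 * t2) ^ 2 : ℕ)), ?_, ?_⟩
  · intro h
    rw [norm_mul, ee_norm, mul_one, Complex.norm_real, Real.norm_of_nonneg (fc_nonneg _ _ _)]
    exact fc_le _ _ _
  intro u1 u2
  by_cases hc : Int.gcd u1 (r * (s0 * t1) : ℕ) = 1 ∧ Int.gcd u2 (r * (s0 * t2) : ℕ) = 1
  · obtain ⟨hc1, hc2⟩ := hc
    have hr1 := (gcd_mul_one.1 hc1).1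
    have hr2 := (gcd_mul_one.1 hc2).1
    have crs1 : r.Coprime (s0 * t1) := Nat.Coprime.mul_right d.crs d.cr1
    have crs2 : r.Coprime (s0 * t2) := Nat.Coprime.mul_right d.crs d.cr2
    have q1 := d.r0
    have q2 := d.s00
    have q3 := d.t10
    have q4 := d.t20
    have expand : ∀ v, (fw J Λ v0 v : ℂ) * (tm a r (s0 * t1) u1 v * tm a r (s0 * t2) u2 v) =
        (fw J Λ v0 v : ℂ) * (dv a (r * s0 * t1) u1 v * dv a (r * s0 * t2) u2 v) -
        1 / ((s0 * t2 : ℕ) : ℂ) ^ 2 * ((fw J Λ v0 v : ℂ) * (dv a (r * (s0 * t1)) u1 v * dv a (r * 1) u2 v)) -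
        1 / ((s0 * t1 : ℕ) : ℂ) ^ 2 * ((fw J Λ v0 v : ℂ) * (dv a (r * 1) u1 v * dv a (r * (s0 * t2)) u2 v)) +
        1 / ((s0 * t1 : ℕ) : ℂ) ^ 2 * (1 / ((s0 * t2 : ℕ) : ℂ) ^ 2) *
          ((fw J Λ v0 v : ℂ) * (dv a (r * 1) u1 v * dv a (r * 1) u2 v)) := by
      intro v
      unfold tm
      rw [if_pos hc1, if_pos hc2, mul_assoc r s0, mul_assoc r s0, ← dv_mul crs1, ← dv_mul crs2, mul_one]
      ring
    simp_rw [expand]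
    rw [Finset.sum_add_distrib, Finset.sum_sub_distrib, Finset.sum_sub_distrib, ← Finset.mul_sum,
      ← Finset.mul_sum, ← Finset.mul_sum]
    have hars : Int.gcd a (r * s0 : ℕ) = 1 := gcd_mul_one.2 ⟨d.har, d.has⟩
    rw [pair_sum (M' := M') (H := H) d.hJ d.hΛ v0 (Nat.mul_pos q1 q2) q3 q4
      (Nat.Coprime.mul_left (Nat.Coprime.mul_left d.cr2 d.cs2) d.c12) (Nat.Coprime.mul_left d.cr2 d.cs2)
      hM'.symm d.hH hars (by rw [mul_assoc]; exact hc1) (by rw [mul_assoc]; exact hc2)]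
    rw [pair_sum (M' := t2 ^ 2 * M') (H := 0) (d0 := r) (e1 := s0 * t1) (e2 := 1) d.hJ d.hΛ v0 q1 (Nat.mul_pos q2 q3) one_pos
      (Nat.coprime_one_right _) (Nat.coprime_one_right _) (by rw [hM']; ring) (by simpa using d.b1) d.har hc1
      (by simpa using hr2)]
    rw [pair_sum (M' := t1 ^ 2 * M') (H := 0) (d0 := r) (e1 := 1) (e2 := s0 * t2) d.hJ d.hΛ v0 q1 one_pos (Nat.mul_pos q2 q4)
      (by simpa using crs2) crs2 (by rw [hM']; ring) (by simpa using d.b2) d.har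
      (by simpa using hr1) hc2]
    rw [pair_sum (M' := (s0 * t1 * t2) ^ 2 * M') (H := 0) (d0 := r) (e1 := 1) (e2 := 1) d.hJ d.hΛ v0 q1 one_pos one_pos
      (Nat.coprime_one_right _) (Nat.coprime_one_right _) (by rw [hM']; ring)
      (by
        simp only [mul_one, zero_add]
        refine le_trans (Nat.pow_le_pow_left ?_ 2) d.b1
        exact Nat.le_mul_of_pos_right _ (Nat.mul_pos q2 q3)) d.har (by simpa using hr1) (by simpa using hr2)]
    rw [if_pos (show Int.gcd u1 (r * (s0 * t1) : ℕ) = 1 ∧ Int.gcd u2 (r * (s0 * t2) : ℕ) = 1 from ⟨hc1, hc2⟩)]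
    simp only [Hs_zero, Finset.sum_empty, add_zero, mul_one]
    have n1 : (r : ℂ) ≠ 0 := by exact_mod_cast q1.ne'
    have n2 : (s0 : ℂ) ≠ 0 := by exact_mod_cast q2.ne'
    have n3 : (t1 : ℂ) ≠ 0 := by exact_mod_cast q3.ne'
    have n4 : (t2 : ℂ) ≠ 0 := by exact_mod_cast q4.ne'
    by_cases k1 : u2 ≡ u1 [ZMOD ((r * s0) ^ 2 : ℕ)]
    · have k2 : u2 ≡ u1 [ZMOD (r ^ 2 : ℕ)] := k1.of_dvd (by push_cast; exact ⟨(s0 : ℤ) ^ 2, by ring⟩)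
      simp only [if_pos k1, if_pos k2]
      generalize (∑ h ∈ Hs H,
        ((fc J (Λ * M') h : ℂ) * ee (-((h * v0 : ℤ) : ℝ) / ((r * s0 * t1 * t2) ^ 2 : ℕ))) * phs a (r * s0 * t1) t2 h u1 u2) = Sg
      rw [mul_add]
      push_cast
      field_simp
      ring
    · simp only [if_neg k1]
      split_ifs with k2
      · push_cast; field_simp; ring
      · ring
  · rw [if_neg hc, add_zero]
    have hz : ∀ v, (fw J Λ v0 v : ℂ) * (tm a r (s0 * t1) u1 v * tm a r (s0 * t2) u2 v) = 0 := by
      intro v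
      rw [not_and_or] at hc
      unfold tm
      rcases hc with h | h
      · rw [if_neg h]; simp
      · rw [if_neg h]; simp
    rw [Finset.sum_eq_zero fun v _ => hz v]
    split_ifs with k1
    · symm
      have : ∀ h, phs a (r * s0 * t1) t2 h u1 u2 = 0 := by
        intro h
        unfold phs
        by_cases g1 : Int.gcd u1 (r * s0 * t1 : ℕ) = 1
        · by_cases g2 : Int.gcd u2 t2 = 1
          · exfalso; apply hc
            rw [← mul_assoc, ← mul_assoc]
            refine ⟨g1, gcd_mul_one.2 ⟨?_, g2⟩⟩
            have g3 := (gcd_mul_one.1 g1).1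
            obtain ⟨k, hk⟩ := k1.symm.dvd
            have e : u2 = u1 + ((r * s0 : ℕ) : ℤ) * ((r * s0 : ℕ) * k) := by
              push_cast at hk ⊢; linarith
            rw [e, gcd_add_mul]; exact g3
          · have : ∀ B, kl t2 B u2 = 0 := fun B => by unfold kl; rw [if_neg g2]
            rw [this, mul_zero]
        · have : ∀ B, kl (r * s0 * t1) B u1 = 0 := fun B => by unfold kl; rw [if_neg g1]
          rw [this, zero_mul]
      rw [Finset.sum_eq_zero fun h _ => by rw [this, mul_zero], mul_zero]
    · rfl

end

section

lemma card_U_le {𝓤 : Finset ℤ} {α β : ℤ} (h𝓤 : 𝓤 ⊆ Finset.Ico α β) (hαβ : α ≤ β) {B : ℝ}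
    (hB : (β : ℝ) - α ≤ B) : (𝓤.card : ℝ) ≤ B := by
  refine le_trans ?_ hB
  have h1 := Finset.card_le_card h𝓤
  rw [Int.card_Ico] at h1
  have h2 : (𝓤.card : ℤ) ≤ β - α := by omega
  exact_mod_cast h2

lemma card_pairs_le {𝓤 : Finset ℤ} {α β : ℤ} (h𝓤 : 𝓤 ⊆ Finset.Ico α β) (hαβ : α ≤ β) {B : ℝ}
    (hB : (β : ℝ) - α ≤ B) (g : ℕ) (hg : 0 < g) :
    ∑ u1 ∈ 𝓤, ((𝓤.filter (fun u2 => u2 ≡ u1 [ZMOD g])).card : ℝ) ≤ B * (B / g + 1) := by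
  have hB0 : 0 ≤ B := by
    have : (α : ℝ) ≤ β := by exact_mod_cast hαβ
    linarith
  have h1 : ∀ u1 ∈ 𝓤, ((𝓤.filter (fun u2 => u2 ≡ u1 [ZMOD g])).card : ℝ) ≤ B / g + 1 := by
    intro u1 _
    refine le_trans ?_ (card_modEq_le g hg α β u1 B hB0 hB)
    exact_mod_cast Finset.card_le_card (Finset.filter_subset_filter _ h𝓤)
  refine (Finset.sum_le_card_nsmul _ _ _ h1).trans ?_
  rw [nsmul_eq_mul]
  exact mul_le_mul_of_nonneg_right (card_U_le h𝓤 hαβ hB) (by positivity)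

lemma pair_bound {a : ℤ} {J Λ H r s0 t1 t2 : ℕ} (d : TData a J Λ H r s0 t1 t2) (v0 : ℤ)
    {𝓤 : Finset ℤ} {α β : ℤ} (h𝓤 : 𝓤 ⊆ Finset.Ico α β) (hαβ : α ≤ β) {B : ℝ}
    (hB : (β : ℝ) - α ≤ B) (A : ℤ → ℤ → ℂ) (hA : ∀ u1 u2, ‖A u1 u2‖ ≤ 1) : ∃ ω : ℤ → ℂ,
    (∀ h, ‖ω h‖ ≤ 1) ∧ ‖∑ u1 ∈ 𝓤, ∑ u2 ∈ 𝓤, A u1 u2 * ∑ v ∈ Finset.Ico (0 : ℤ) (Λ * J : ℕ),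
      (fw J Λ v0 v : ℂ) * (tm a r (s0 * t1) u1 v * tm a r (s0 * t2) u2 v)‖ ≤
    ((Λ : ℝ) / ((r * s0 * t1 * t2) ^ 2 : ℕ)) *
      ‖∑ u1 ∈ 𝓤, ∑ u2 ∈ 𝓤.filter (fun u2 => u2 ≡ u1 [ZMOD ((r * s0) ^ 2 : ℕ)]), A u1 u2 *
      ∑ h ∈ Hs H, ω h * phs a (r * s0 * t1) t2 h u1 u2‖ +
    if s0 = 1 then 0 else (B * (B / ((r * s0) ^ 2 : ℕ) + 1)) * ((Λ : ℝ) / ((r * s0 * t1 * t2) ^ 2 : ℕ)) +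
      (B * (B / (r ^ 2 : ℕ) + 1)) * ((Λ : ℝ) / ((r * (s0 * t1) * (s0 * t2)) ^ 2 : ℕ)) := by
  obtain ⟨ω, hω, hT⟩ := TT_eval d v0
  refine ⟨ω, hω, ?_⟩
  simp_rw [hT, mul_add (A _ _), Finset.sum_add_distrib]
  refine (norm_add_le _ _).trans (add_le_add (le_of_eq ?_) ?_)
  · have e : (Λ : ℝ) / ((r * s0 * t1 * t2) ^ 2 : ℕ) = ‖(Λ : ℂ) / ((r * s0 * t1 * t2) ^ 2 : ℕ)‖ := by
      rw [norm_div, Complex.norm_natCast, Complex.norm_natCast]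
    rw [e, ← norm_mul, Finset.mul_sum]
    congr 1
    refine Finset.sum_congr rfl fun u1 _ => ?_
    rw [Finset.sum_filter, Finset.mul_sum]
    refine Finset.sum_congr rfl fun u2 _ => ?_
    split_ifs
    · ring
    · ring
  · split_ifs with hs
    · subst hs
      refine le_of_eq ?_
      rw [norm_eq_zero]
      refine Finset.sum_eq_zero fun u1 _ => Finset.sum_eq_zero fun u2 _ => ?_
      simp
    · set c1 : ℝ := (Λ : ℝ) / ((r * s0 * t1 * t2) ^ 2 : ℕ) with hc1
      set c2 : ℝ := (Λ : ℝ) / ((r * (s0 * t1) * (s0 * t2)) ^ 2 : ℕ) with hc2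
      have p1 : 0 ≤ c1 := by positivity
      have p2 : 0 ≤ c2 := by positivity
      have hg1 : 0 < (r * s0) ^ 2 := by have := d.r0; have := d.s00; positivity
      have hg2 : 0 < r ^ 2 := by have := d.r0; positivity
      have b1 := mul_le_mul_of_nonneg_right (card_pairs_le h𝓤 hαβ hB _ hg1) p1
      have b2 := mul_le_mul_of_nonneg_right (card_pairs_le h𝓤 hαβ hB _ hg2) p2
      refine le_trans ?_ (add_le_add b1 b2)
      rw [Finset.sum_mul, Finset.sum_mul, ← Finset.sum_add_distrib]
      refine (norm_sum_le _ _).trans (Finset.sum_le_sum fun u1 _ => ?_)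
      rw [Finset.card_eq_sum_ones, Finset.card_eq_sum_ones, Finset.sum_filter, Finset.sum_filter]
      simp only [Nat.cast_sum, Nat.cast_ite, Nat.cast_one, Nat.cast_zero]
      rw [Finset.sum_mul, Finset.sum_mul, ← Finset.sum_add_distrib]
      refine (norm_sum_le _ _).trans (Finset.sum_le_sum fun u2 _ => ?_)
      rw [norm_mul]
      refine (mul_le_of_le_one_left (norm_nonneg _) (hA u1 u2)).trans ?_
      have n1 : ‖(Λ : ℂ) / ((r * s0 * t1 * t2) ^ 2 : ℕ)‖ = c1 := by
        rw [norm_div, Complex.norm_natCast, Complex.norm_natCast]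
      have n2 : ‖(Λ : ℂ) / ((r * (s0 * t1) * (s0 * t2)) ^ 2 : ℕ)‖ = c2 := by
        rw [norm_div, Complex.norm_natCast, Complex.norm_natCast]
      rw [ite_mul, ite_mul, one_mul, one_mul, zero_mul, zero_mul]
      by_cases hc : Int.gcd u1 (r * (s0 * t1) : ℕ) = 1 ∧ Int.gcd u2 (r * (s0 * t2) : ℕ) = 1
      · rw [if_pos hc]
        refine (norm_sub_le _ _).trans ?_
        rw [apply_ite norm, apply_ite norm, n1, n2, norm_zero]
      · rw [if_neg hc, norm_zero]
        refine add_nonneg ?_ ?_ <;> split_ifs <;> first | assumption | exact le_refl _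

end

section

structure SD (Y : ℝ) (K : ℕ) (J' J'' : Finset ℕ) (a : ℤ) (Λ : ℕ) (v0 : ℤ) (𝓤 𝓥 : Finset ℤ) (α β : ℤ)
    (B : ℝ) (HJ : Finset ℕ → ℕ) (EB : ℝ) (au : ℤ → ℂ) : Prop where
  hY : 2 ≤ Y
  hJ' : J' ⊆ Finset.range K
  hJ'' : J'' ⊆ Finset.range K
  hdis : Disjoint J' J''
  ha : a ≠ 0
  haY : |(a : ℝ)| ≤ Y
  hΛ : 0 < Λ
  h𝓤 : 𝓤 ⊆ Finset.Ico α β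
  hαβ : α ≤ β
  hB : (β : ℝ) - α ≤ B
  hB0 : 0 < B
  hRS : (Y ^ J'.card) ^ 2 * Y ^ J''.card ≤ B
  hV0 : ∀ v ∈ 𝓥, 0 ≤ v
  hV8 : ∀ v ∈ 𝓥, 8 * |(v : ℝ) - v0| ≤ Λ
  hVc : (𝓥.card : ℝ) ≤ Λ
  hq1 : ∀ r ∈ DJ Y J', ∀ s ∈ DJ Y J'', (r * s) ^ 2 ≤ Λ
  hH : ∀ J0 ⊆ J'', ∀ r ∈ DJ Y J', ∀ s0 ∈ DJ Y J0, ∀ t1 ∈ DJ Y (J'' \ J0), ∀ t2 ∈ DJ Y (J'' \ J0),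
    (r * s0 * t1 * t2) ^ 2 ≤ Λ * (HJ J0 + 1)
  hau : ∀ u, ‖au u‖ ≤ 1
  hEB0 : 0 ≤ EB
  hExp : ∀ J0 ⊆ J'', ∀ rt ∈ DJ Y (J' ∪ J0), ∀ ω : ℕ → ℕ → ℤ → ℂ, (∀ t1 t2 h, ‖ω t1 t2 h‖ ≤ 1) →
    ∑ t1 ∈ DJ Y (J'' \ J0), ∑ t2 ∈ (DJ Y (J'' \ J0)).filter (fun t2 => t1.Coprime t2),
      ‖∑ u1 ∈ 𝓤, ∑ u2 ∈ 𝓤.filter (fun u2 => u2 ≡ u1 [ZMOD (rt ^ 2 : ℕ)]),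
        (au u1 * (starRingEnd ℂ) (au u2)) * ∑ h ∈ Hs (HJ J0), ω t1 t2 h * phs a (rt * t1) t2 h u1 u2‖ ≤
    EB * B * (1 + B / (Y ^ J'.card * Y ^ J0.card) ^ 2) * (Y ^ (J'' \ J0).card) ^ 2

/-- correlation -/
def GG (a : ℤ) (J Λ : ℕ) (v0 : ℤ) (𝓤 : Finset ℤ) (au : ℤ → ℂ) (r s1 s2 : ℕ) : ℝ :=
  ‖∑ u1 ∈ 𝓤, ∑ u2 ∈ 𝓤, (au u1 * (starRingEnd ℂ) (au u2)) * ∑ v ∈ Finset.Ico (0 : ℤ) (Λ * J : ℕ),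
      (fw J Λ v0 v : ℂ) * (tm a r s1 u1 v * tm a r s2 u2 v)‖

section
variable {Y : ℝ} {K : ℕ} {J' J'' : Finset ℕ} {a : ℤ} {Λ : ℕ} {v0 : ℤ} {𝓤 𝓥 : Finset ℤ} {α β : ℤ}
    {B : ℝ} {HJ : Finset ℕ → ℕ} {EB : ℝ} {au : ℤ → ℂ}

lemma SD.S3 (d : SD Y K J' J'' a Λ v0 𝓤 𝓥 α β B HJ EB au) {J : ℕ} (hJ0 : 0 < J)
    (hJ : ∀ J0 ⊆ J'', ∀ r ∈ DJ Y J', ∀ s0 ∈ DJ Y J0, ∀ t1 ∈ DJ Y (J'' \ J0), ∀ t2 ∈ DJ Y (J'' \ J0),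
    (r * s0 * t1 * t2) ^ 2 ∣ J) {J0 : Finset ℕ} (hJ0s : J0 ⊆ J'') {r s0 : ℕ} (hr : r ∈ DJ Y J')
    (hs0 : s0 ∈ DJ Y J0) :
    ∑ t1 ∈ DJ Y (J'' \ J0), ∑ t2 ∈ (DJ Y (J'' \ J0)).filter (fun t2 => t1.Coprime t2),
      GG a J Λ v0 𝓤 au r (s0 * t1) (s0 * t2) ≤
    Λ / (Y ^ J'.card * Y ^ J0.card * Y ^ (J'' \ J0).card * Y ^ (J'' \ J0).card) ^ 2 *
      (B * (1 + B / (Y ^ J'.card * Y ^ J0.card) ^ 2) * (Y ^ (J'' \ J0).card) ^ 2) *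
      (EB + if J0 = ∅ then 0 else 2 * cK K ^ 2) := by
  have hY0 : 0 < Y := by linarith [d.hY]
  have hY1 : 1 ≤ Y := by linarith [d.hY]
  have hB0 := d.hB0
  set J1 := J'' \ J0 with hJ1
  set R := Y ^ J'.card with hR
  set S := Y ^ J0.card with hS
  set T := Y ^ J1.card with hT
  have R1 : 1 ≤ R := one_le_pow₀ hY1
  have S1 : 1 ≤ S := one_le_pow₀ hY1
  have T1 : 1 ≤ T := one_le_pow₀ hY1
  have hJ1s : J1 ⊆ J'' := Finset.sdiff_subset
  have d1 : Disjoint J' J0 := d.hdis.mono_right hJ0s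
  have d2 : Disjoint J' J1 := d.hdis.mono_right hJ1s
  have d3 : Disjoint J0 J1 := Finset.disjoint_sdiff
  have tdat : ∀ t1 ∈ DJ Y J1, ∀ t2 ∈ DJ Y J1, t1.Coprime t2 → TData a J Λ (HJ J0) r s0 t1 t2 := by
    intro t1 h1 t2 h2 hc
    have es : ∀ t ∈ DJ Y J1, s0 * t ∈ DJ Y J'' := by
      intro t ht
      have := DJ_mul hY0 hs0 ht d3
      rwa [hJ1, Finset.union_sdiff_of_subset hJ0s] at this
    exact ⟨hJ0, d.hΛ, DJ_pos hr, DJ_pos hs0, DJ_pos h1, DJ_pos h2, DJ_coprime hY0 hr hs0 d1,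
      DJ_coprime hY0 hr h1 d2, DJ_coprime hY0 hr h2 d2, DJ_coprime hY0 hs0 h1 d3,
      DJ_coprime hY0 hs0 h2 d3, hc, hJ J0 hJ0s r hr s0 hs0 t1 h1 t2 h2,
      d.hH J0 hJ0s r hr s0 hs0 t1 h1 t2 h2, d.hq1 r hr _ (es _ h1), d.hq1 r hr _ (es _ h2),
      DJ_cop_a hY0 hr a d.ha d.haY, DJ_cop_a hY0 hs0 a d.ha d.haY⟩
  have key : ∀ t1 t2 : ℕ, ∃ ω : ℤ → ℂ, (∀ h, ‖ω h‖ ≤ 1) ∧ (t1 ∈ DJ Y J1 → t2 ∈ DJ Y J1 → t1.Coprime t2 →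
      GG a J Λ v0 𝓤 au r (s0 * t1) (s0 * t2) ≤ ((Λ : ℝ) / ((r * s0 * t1 * t2) ^ 2 : ℕ)) *
      ‖∑ u1 ∈ 𝓤, ∑ u2 ∈ 𝓤.filter (fun u2 => u2 ≡ u1 [ZMOD ((r * s0) ^ 2 : ℕ)]), (au u1 * (starRingEnd ℂ) (au u2)) *
      ∑ h ∈ Hs (HJ J0), ω h * phs a (r * s0 * t1) t2 h u1 u2‖ +
    if s0 = 1 then 0 else (B * (B / ((r * s0) ^ 2 : ℕ) + 1)) * ((Λ : ℝ) / ((r * s0 * t1 * t2) ^ 2 : ℕ)) +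
      (B * (B / (r ^ 2 : ℕ) + 1)) * ((Λ : ℝ) / ((r * (s0 * t1) * (s0 * t2)) ^ 2 : ℕ))) := by
    intro t1 t2
    by_cases hh : t1 ∈ DJ Y J1 ∧ t2 ∈ DJ Y J1 ∧ t1.Coprime t2
    · obtain ⟨ω, h1, h2⟩ := pair_bound (tdat t1 hh.1 t2 hh.2.1 hh.2.2) v0 d.h𝓤 d.hαβ d.hB
        (fun u1 u2 => au u1 * (starRingEnd ℂ) (au u2)) (fun u1 u2 => by
          rw [norm_mul, RCLike.norm_conj]
          exact mul_le_one₀ (d.hau u1) (norm_nonneg _) (d.hau u2))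
      exact ⟨ω, h1, fun _ _ _ => h2⟩
    · exact ⟨0, by simp, fun h1 h2 h3 => absurd ⟨h1, h2, h3⟩ hh⟩
  choose ω hω hG using key
  have rR : R ≤ r := DJ_ge hY0 hr
  have sS : S ≤ s0 := DJ_ge hY0 hs0
  set Q : ℝ := Λ / (R * S * T * T) ^ 2 with hQ
  have hQ0 : 0 ≤ Q := by positivity
  set E : ℕ → ℕ → ℝ := fun t1 t2 => ‖∑ u1 ∈ 𝓤, ∑ u2 ∈ 𝓤.filter (fun u2 => u2 ≡ u1 [ZMOD ((r * s0) ^ 2 : ℕ)]),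
      (au u1 * (starRingEnd ℂ) (au u2)) *
      ∑ h ∈ Hs (HJ J0), ω t1 t2 h * phs a (r * s0 * t1) t2 h u1 u2‖ with hE
  set tr : ℝ := if J0 = ∅ then 0 else 2 * (B * (1 + B / (R * S) ^ 2)) with htr
  have htr0 : 0 ≤ tr := by rw [htr]; split_ifs <;> positivity
  have hG' : ∀ t1 ∈ DJ Y J1, ∀ t2 ∈ (DJ Y J1).filter (fun t2 => t1.Coprime t2),
      GG a J Λ v0 𝓤 au r (s0 * t1) (s0 * t2) ≤ Q * E t1 t2 + Q * tr := by
    intro t1 h1 t2 h2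
    rw [Finset.mem_filter] at h2
    have tT1 : T ≤ t1 := DJ_ge hY0 h1
    have tT2 : T ≤ t2 := DJ_ge hY0 h2.1
    refine (hG t1 t2 h1 h2.1 h2.2).trans (add_le_add ?_ ?_)
    · refine mul_le_mul_of_nonneg_right ?_ (norm_nonneg _)
      rw [hQ]
      push_cast
      gcongr
    · by_cases h0 : J0 = ∅
      · have : s0 = 1 := by
          rw [h0, DJ_empty hY0] at hs0; simpa using hs0
        rw [if_pos this]; positivity
      · have q1 : (Λ : ℝ) / ((r * s0 * t1 * t2) ^ 2 : ℕ) ≤ Q := by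
          rw [hQ]; push_cast; gcongr
        have q2 : (B / (r ^ 2 : ℕ) + 1) * ((Λ : ℝ) / ((r * (s0 * t1) * (s0 * t2)) ^ 2 : ℕ)) ≤
            (B / (R * S) ^ 2 + 1) * Q := by
          calc (B / (r ^ 2 : ℕ) + 1) * ((Λ : ℝ) / ((r * (s0 * t1) * (s0 * t2)) ^ 2 : ℕ)) ≤
              (B / R ^ 2 + 1) * (Λ / (R * (S * T) * (S * T)) ^ 2) := by
                push_cast; gcongr
            _ = (B / (R * S) ^ 2 + 1 / S ^ 2) * Q := by
                rw [hQ]; field_simp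
            _ ≤ _ := by
                refine mul_le_mul_of_nonneg_right ?_ hQ0
                have : 1 / S ^ 2 ≤ 1 := by
                  rw [div_le_one (by positivity)]; exact one_le_pow₀ S1
                linarith
        have q3 : B / ((r * s0) ^ 2 : ℕ) ≤ B / (R * S) ^ 2 := by
          push_cast; gcongr
        have q4 : (B / ((r * s0) ^ 2 : ℕ) + 1) * ((Λ : ℝ) / ((r * s0 * t1 * t2) ^ 2 : ℕ)) ≤
            (B / (R * S) ^ 2 + 1) * Q := by gcongr
        have : (if s0 = 1 then 0 else (B * (B / ((r * s0) ^ 2 : ℕ) + 1)) * ((Λ : ℝ) / ((r * s0 * t1 * t2) ^ 2 : ℕ)) +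
      (B * (B / (r ^ 2 : ℕ) + 1)) * ((Λ : ℝ) / ((r * (s0 * t1) * (s0 * t2)) ^ 2 : ℕ))) ≤
          (B * (B / ((r * s0) ^ 2 : ℕ) + 1)) * ((Λ : ℝ) / ((r * s0 * t1 * t2) ^ 2 : ℕ)) +
      (B * (B / (r ^ 2 : ℕ) + 1)) * ((Λ : ℝ) / ((r * (s0 * t1) * (s0 * t2)) ^ 2 : ℕ)) := by
          split_ifs
          · positivity
          · exact le_refl _
        refine this.trans ?_
        rw [htr, if_neg h0, mul_assoc B, mul_assoc B]
        have := mul_le_mul_of_nonneg_left (add_le_add q4 q2) hB0.le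
        rw [mul_add] at this
        refine this.trans (le_of_eq ?_)
        ring
  have hcK : 0 < cK K := by linarith [cK_one K]
  have hcard : ((DJ Y J1).card : ℝ) ≤ cK K * T := DJ_card hY0 (hJ1s.trans d.hJ'')
  have step1 : ∑ t1 ∈ DJ Y J1, ∑ t2 ∈ (DJ Y J1).filter (fun t2 => t1.Coprime t2),
      GG a J Λ v0 𝓤 au r (s0 * t1) (s0 * t2) ≤ Q * (∑ t1 ∈ DJ Y J1,
      ∑ t2 ∈ (DJ Y J1).filter (fun t2 => t1.Coprime t2), E t1 t2) + Q * (tr * (cK K * T) ^ 2) := by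
    refine (Finset.sum_le_sum fun t1 h1 => Finset.sum_le_sum fun t2 h2 => hG' t1 h1 t2 h2).trans ?_
    simp_rw [Finset.sum_add_distrib]
    refine add_le_add (le_of_eq (by simp_rw [← Finset.mul_sum])) ?_
    have : ∑ t1 ∈ DJ Y J1, ∑ t2 ∈ (DJ Y J1).filter (fun t2 => t1.Coprime t2), Q * tr ≤
        ∑ t1 ∈ DJ Y J1, ∑ t2 ∈ (DJ Y J1), Q * tr :=
      Finset.sum_le_sum fun t1 _ => Finset.sum_le_sum_of_subset_of_nonneg (Finset.filter_subset _ _)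
        fun _ _ _ => by positivity
    refine this.trans ?_
    simp only [Finset.sum_const, nsmul_eq_mul]
    calc ((DJ Y J1).card : ℝ) * ((DJ Y J1).card * (Q * tr)) ≤ (cK K * T) * ((cK K * T) * (Q * tr)) := by
          gcongr
      _ = _ := by ring
  refine step1.trans ?_
  have hex := d.hExp J0 hJ0s (r * s0) (DJ_mul hY0 hr hs0 d1) ω hω
  have : Q * (∑ t1 ∈ DJ Y J1, ∑ t2 ∈ (DJ Y J1).filter (fun t2 => t1.Coprime t2), E t1 t2) ≤
      Q * (EB * B * (1 + B / (R * S) ^ 2) * T ^ 2) := mul_le_mul_of_nonneg_left hex hQ0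
  refine (add_le_add this (le_refl _)).trans (le_of_eq ?_)
  rw [htr]
  split_ifs <;> ring
end

end

section

lemma S4 {a : ℤ} {J Λ : ℕ} (hJ : 0 < J) (hΛ : 0 < Λ) {v0 : ℤ} {𝓤 𝓥 : Finset ℤ}
    (hV : 𝓥 ⊆ Finset.Ico (0 : ℤ) (Λ * J : ℕ)) (hV8 : ∀ v ∈ 𝓥, 8 * |(v : ℝ) - v0| ≤ Λ) (au : ℤ → ℂ)
    (r : ℕ) (𝓢 : Finset ℕ) (c : ℕ → ℂ) (hc : ∀ s, ‖c s‖ ≤ 1) :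
    ∑ v ∈ 𝓥, ‖∑ s ∈ 𝓢, c s * ∑ u ∈ 𝓤, au u * tm a r s u v‖ ^ 2 ≤
      3 * ∑ s1 ∈ 𝓢, ∑ s2 ∈ 𝓢, GG a J Λ v0 𝓤 au r s1 s2 := by
  set F : ℕ → ℤ → ℂ := fun s v => ∑ u ∈ 𝓤, au u * tm a r s u v with hF
  have h1 : ∑ v ∈ 𝓥, ‖∑ s ∈ 𝓢, c s * F s v‖ ^ 2 ≤ 3 * ∑ v ∈ Finset.Ico (0 : ℤ) (Λ * J : ℕ),
      ‖∑ s ∈ 𝓢, ((Real.sqrt (fw J Λ v0 v) : ℂ)) * (c s * F s v)‖ ^ 2 := by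
    rw [Finset.mul_sum]
    refine le_trans (Finset.sum_le_sum fun v hv => ?_)
      (Finset.sum_le_sum_of_subset_of_nonneg hV fun _ _ _ => by positivity)
    rw [← Finset.mul_sum, norm_mul, mul_pow, Complex.norm_real, Real.norm_of_nonneg (Real.sqrt_nonneg _),
      Real.sq_sqrt (fw_nonneg _ _ _ _)]
    have := fw_lower J Λ hJ hΛ v0 v (hV8 v hv)
    have h2 : 0 ≤ ‖∑ s ∈ 𝓢, c s * F s v‖ ^ 2 := by positivity
    nlinarith
  refine h1.trans (mul_le_mul_of_nonneg_left ?_ (by norm_num))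
  refine (sum_normsq_le _ _ _).trans ?_
  refine Finset.sum_le_sum fun s1 _ => Finset.sum_le_sum fun s2 _ => ?_
  have e : ∑ v ∈ Finset.Ico (0 : ℤ) (Λ * J : ℕ), ((Real.sqrt (fw J Λ v0 v) : ℂ)) * (c s1 * F s1 v) *
      (starRingEnd ℂ) (((Real.sqrt (fw J Λ v0 v) : ℂ)) * (c s2 * F s2 v)) =
      (c s1 * (starRingEnd ℂ) (c s2)) * ∑ u1 ∈ 𝓤, ∑ u2 ∈ 𝓤, (au u1 * (starRingEnd ℂ) (au u2)) *
      ∑ v ∈ Finset.Ico (0 : ℤ) (Λ * J : ℕ), (fw J Λ v0 v : ℂ) * (tm a r s1 u1 v * tm a r s2 u2 v) := by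
    have e1 : ∀ v, ((Real.sqrt (fw J Λ v0 v) : ℂ)) * (c s1 * F s1 v) *
      (starRingEnd ℂ) (((Real.sqrt (fw J Λ v0 v) : ℂ)) * (c s2 * F s2 v)) =
      (c s1 * (starRingEnd ℂ) (c s2)) * ∑ u1 ∈ 𝓤, ∑ u2 ∈ 𝓤, (au u1 * (starRingEnd ℂ) (au u2)) *
        ((fw J Λ v0 v : ℂ) * (tm a r s1 u1 v * tm a r s2 u2 v)) := by
      intro v
      have e2 : ((Real.sqrt (fw J Λ v0 v) : ℂ)) * (Real.sqrt (fw J Λ v0 v) : ℂ) = (fw J Λ v0 v : ℂ) := by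
        rw [← Complex.ofReal_mul, Real.mul_self_sqrt (fw_nonneg _ _ _ _)]
      have e3 : F s1 v * (starRingEnd ℂ) (F s2 v) = ∑ u1 ∈ 𝓤, ∑ u2 ∈ 𝓤, (au u1 * (starRingEnd ℂ) (au u2)) *
        (tm a r s1 u1 v * tm a r s2 u2 v) := by
        rw [hF]
        simp only
        rw [map_sum, Finset.sum_mul_sum]
        refine Finset.sum_congr rfl fun u1 _ => Finset.sum_congr rfl fun u2 _ => ?_
        rw [map_mul, tm_conj]; ring
      have e4 : ∑ u1 ∈ 𝓤, ∑ u2 ∈ 𝓤, (au u1 * (starRingEnd ℂ) (au u2)) *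
        ((fw J Λ v0 v : ℂ) * (tm a r s1 u1 v * tm a r s2 u2 v)) = (fw J Λ v0 v : ℂ) *
          (F s1 v * (starRingEnd ℂ) (F s2 v)) := by
        rw [e3, Finset.mul_sum]
        refine Finset.sum_congr rfl fun u1 _ => ?_
        rw [Finset.mul_sum]
        refine Finset.sum_congr rfl fun u2 _ => ?_
        ring
      rw [e4, ← e2, map_mul, map_mul, Complex.conj_ofReal]
      ring
    rw [Finset.sum_congr rfl fun v _ => e1 v, ← Finset.mul_sum]
    congr 1
    rw [Finset.sum_comm]
    refine Finset.sum_congr rfl fun u1 _ => ?_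
    rw [Finset.sum_comm]
    refine Finset.sum_congr rfl fun u2 _ => ?_
    rw [Finset.mul_sum]
  rw [e, norm_mul]
  refine mul_le_of_le_one_left (norm_nonneg _) ?_
  rw [norm_mul, RCLike.norm_conj]
  exact mul_le_one₀ (hc _) (norm_nonneg _) (hc _)

section
variable {Y : ℝ} {K : ℕ} {J' J'' : Finset ℕ} {a : ℤ} {Λ : ℕ} {v0 : ℤ} {𝓤 𝓥 : Finset ℤ} {α β : ℤ}
    {B : ℝ} {HJ : Finset ℕ → ℕ} {EB : ℝ} {au : ℤ → ℂ}

lemma SD.S5 (d : SD Y K J' J'' a Λ v0 𝓤 𝓥 α β B HJ EB au) {J : ℕ} (hJ0 : 0 < J)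
    (hJ : ∀ J0 ⊆ J'', ∀ r ∈ DJ Y J', ∀ s0 ∈ DJ Y J0, ∀ t1 ∈ DJ Y (J'' \ J0), ∀ t2 ∈ DJ Y (J'' \ J0),
    (r * s0 * t1 * t2) ^ 2 ∣ J) {r : ℕ} (hr : r ∈ DJ Y J') :
    ∑ s1 ∈ DJ Y J'', ∑ s2 ∈ DJ Y J'', GG a J Λ v0 𝓤 au r s1 s2 ≤
    2 ^ K * (2 * cK K ^ 3 * (Λ * B ^ 2 / ((Y ^ J'.card) ^ 4 * (Y ^ J''.card) ^ 2)) *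
      (1 / Y + (Y ^ J'.card) ^ 2 * Y ^ J''.card / B + EB)) := by
  have hY0 : 0 < Y := by linarith [d.hY]
  have hY1 : 1 ≤ Y := by linarith [d.hY]
  have hB0 := d.hB0
  have hEB0 := d.hEB0
  have hK1 := cK_one K
  have hRS := d.hRS
  set R := Y ^ J'.card with hR
  set S := Y ^ J''.card with hS
  have R1 : 1 ≤ R := one_le_pow₀ hY1
  have S1 : 1 ≤ S := one_le_pow₀ hY1
  refine (sum_DJ_pair hY0 _ fun _ _ => norm_nonneg _).trans ?_
  have key : ∀ J0 ∈ J''.powerset, ∑ s0 ∈ DJ Y J0, ∑ t1 ∈ DJ Y (J'' \ J0),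
      ∑ t2 ∈ (DJ Y (J'' \ J0)).filter (fun t2 => t1.Coprime t2), GG a J Λ v0 𝓤 au r (s0 * t1) (s0 * t2) ≤
      2 * cK K ^ 3 * (Λ * B ^ 2 / (R ^ 4 * S ^ 2)) * (1 / Y + R ^ 2 * S / B + EB) := by
    intro J0 hJ0
    rw [Finset.mem_powerset] at hJ0
    refine (Finset.sum_le_sum fun s0 hs0 => d.S3 (by assumption) hJ hJ0 hr hs0).trans ?_
    rw [Finset.sum_const, nsmul_eq_mul]
    have hcard : ((DJ Y J0).card : ℝ) ≤ cK K * Y ^ J0.card := DJ_card hY0 (hJ0.trans d.hJ'')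
    have hST : S = Y ^ J0.card * Y ^ (J'' \ J0).card := by
      rw [hS, ← pow_add, Finset.card_sdiff_of_subset hJ0]
      congr 1
      have := Finset.card_le_card hJ0
      omega
    rw [← hR]
    have hS0Y : J0 ≠ ∅ → Y ≤ Y ^ J0.card := by
      intro h
      have : J0.card ≠ 0 := by simpa using h
      exact le_self_pow₀ hY1 this
    set S0 := Y ^ J0.card with hS0
    set T := Y ^ (J'' \ J0).card with hT
    have S01 : 1 ≤ S0 := one_le_pow₀ hY1
    have T1 : 1 ≤ T := one_le_pow₀ hY1
    have S0S : S0 ≤ S := by rw [hST]; nlinarith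
    set x := (EB + if J0 = ∅ then 0 else 2 * cK K ^ 2) with hx
    have hx0 : 0 ≤ x := by rw [hx]; split_ifs <;> positivity
    have main : (S0 + B / (R ^ 2 * S0)) * x ≤ B / R ^ 2 * (2 * cK K ^ 2 * (1 / Y + R ^ 2 * S / B + EB)) := by
      have e1 : S0 ≤ B / R ^ 2 * (R ^ 2 * S / B) := by
        have : B / R ^ 2 * (R ^ 2 * S / B) = S := by field_simp
        rw [this]; exact S0S
      have e0 : R ^ 2 * S / B ≤ 1 := by rw [div_le_one hB0]; exact hRS
      have e2 : B / (R ^ 2 * S0) = B / R ^ 2 * (1 / S0) := by field_simp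
      have p0 : 0 ≤ B / R ^ 2 := by positivity
      have h1 : (S0 + B / (R ^ 2 * S0)) ≤ B / R ^ 2 * (R ^ 2 * S / B + 1 / S0) := by
        rw [e2, mul_add]; linarith
      have h2 : 1 / S0 ≤ 1 := by rw [div_le_one (by linarith)]; exact S01
      have hK2 : 1 ≤ cK K ^ 2 := one_le_pow₀ hK1
      have p1 : 0 ≤ R ^ 2 * S / B := by positivity
      have p2 : 0 ≤ 1 / S0 := by positivity
      have p3 : 0 ≤ 1 / Y := by positivity
      refine (mul_le_mul_of_nonneg_right h1 hx0).trans ?_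
      rw [mul_assoc]
      refine mul_le_mul_of_nonneg_left ?_ p0
      rw [hx]
      split_ifs with h
      · rw [add_zero]
        calc (R ^ 2 * S / B + 1 / S0) * EB ≤ 2 * EB := mul_le_mul_of_nonneg_right (by linarith) hEB0
          _ ≤ 2 * cK K ^ 2 * EB := by nlinarith
          _ ≤ _ := mul_le_mul_of_nonneg_left (by linarith) (by positivity)
      · have h3 : 1 / S0 ≤ 1 / Y := one_div_le_one_div_of_le hY0 (hS0Y h)
        have h4 : (R ^ 2 * S / B + 1 / S0) * EB ≤ 2 * EB := mul_le_mul_of_nonneg_right (by linarith) hEB0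
        have h5 : (R ^ 2 * S / B + 1 / S0) * (2 * cK K ^ 2) ≤ (R ^ 2 * S / B + 1 / Y) * (2 * cK K ^ 2) :=
          mul_le_mul_of_nonneg_right (by linarith) (by positivity)
        nlinarith
    calc ((DJ Y J0).card : ℝ) * (Λ / (R * S0 * T * T) ^ 2 * (B * (1 + B / (R * S0) ^ 2) * T ^ 2) * x) ≤
        (cK K * S0) * (Λ / (R * S0 * T * T) ^ 2 * (B * (1 + B / (R * S0) ^ 2) * T ^ 2) * x) := by gcongr
      _ = cK K * (Λ * B / (R ^ 2 * S ^ 2)) * ((S0 + B / (R ^ 2 * S0)) * x) := by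
          rw [hST]; field_simp
      _ ≤ cK K * (Λ * B / (R ^ 2 * S ^ 2)) * (B / R ^ 2 * (2 * cK K ^ 2 * (1 / Y + R ^ 2 * S / B + EB))) := by
          gcongr
      _ = _ := by field_simp
  refine (Finset.sum_le_sum key).trans ?_
  rw [Finset.sum_const, nsmul_eq_mul, Finset.card_powerset]
  refine mul_le_mul_of_nonneg_right ?_ (by positivity)
  push_cast
  refine pow_le_pow_right₀ (by norm_num) ?_
  simpa using Finset.card_le_card d.hJ''

lemma SD.step (d : SD Y K J' J'' a Λ v0 𝓤 𝓥 α β B HJ EB au) (bv : ℤ → ℂ) (hbv : ∀ v, ‖bv v‖ ≤ 1) :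
    (∑ r ∈ DJ Y J', ∑ s ∈ DJ Y J'', ‖∑ u ∈ 𝓤, ∑ v ∈ 𝓥, au u * bv v * tm a r s u v‖) ^ 2 ≤
    6 * 2 ^ K * cK K ^ 5 * (Λ * B / (Y ^ J'.card * Y ^ J''.card)) ^ 2 *
      (1 / Y + (Y ^ J'.card) ^ 2 * Y ^ J''.card / B + EB) := by
  have hY0 : 0 < Y := by linarith [d.hY]
  have hY1 : 1 ≤ Y := by linarith [d.hY]
  have hB0 := d.hB0
  have hEB0 := d.hEB0
  have hK1 := cK_one K
  -- choose J
  set M1 : ℕ := Finset.sup (J''.powerset) (fun J0 => Finset.sup (DJ Y J' ×ˢ DJ Y J0 ×ˢ DJ Y (J'' \ J0) ×ˢ DJ Y (J'' \ J0))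
    (fun x => (x.1 * x.2.1 * x.2.2.1 * x.2.2.2) ^ 2)) with hM1
  set M2 : ℕ := Finset.sup 𝓥 (fun v => v.toNat + 1) with hM2
  set J := Nat.factorial (M1 + M2) with hJdef
  have hJ0 : 0 < J := Nat.factorial_pos _
  have hJ : ∀ J0 ⊆ J'', ∀ r ∈ DJ Y J', ∀ s0 ∈ DJ Y J0, ∀ t1 ∈ DJ Y (J'' \ J0), ∀ t2 ∈ DJ Y (J'' \ J0),
    (r * s0 * t1 * t2) ^ 2 ∣ J := by
    intro J0 h0 r hr s0 hs0 t1 h1 t2 h2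
    refine Nat.dvd_factorial ?_ ?_
    · have := DJ_pos hr; have := DJ_pos hs0; have := DJ_pos h1; have := DJ_pos h2; positivity
    · refine le_trans ?_ (Nat.le_add_right _ _)
      refine le_trans ?_ (Finset.le_sup (f := fun J0 => Finset.sup (DJ Y J' ×ˢ DJ Y J0 ×ˢ DJ Y (J'' \ J0) ×ˢ DJ Y (J'' \ J0))
        (fun x => (x.1 * x.2.1 * x.2.2.1 * x.2.2.2) ^ 2)) (Finset.mem_powerset.2 h0))
      exact Finset.le_sup (f := fun x : ℕ × ℕ × ℕ × ℕ => (x.1 * x.2.1 * x.2.2.1 * x.2.2.2) ^ 2)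
        (b := (r, s0, t1, t2)) (by simp only [Finset.mem_product]; exact ⟨hr, hs0, h1, h2⟩)
  have hV : 𝓥 ⊆ Finset.Ico (0 : ℤ) (Λ * J : ℕ) := by
    intro v hv
    rw [Finset.mem_Ico]
    have h0 := d.hV0 v hv
    refine ⟨h0, ?_⟩
    have h1 : v.toNat + 1 ≤ M2 := Finset.le_sup (f := fun v : ℤ => v.toNat + 1) hv
    have h2 : M1 + M2 ≤ J := Nat.self_le_factorial _
    have h3 : J ≤ Λ * J := Nat.le_mul_of_pos_left _ d.hΛ
    omega
  -- phases
  set F : ℕ → ℕ → ℂ := fun r s => ∑ u ∈ 𝓤, ∑ v ∈ 𝓥, au u * bv v * tm a r s u v with hF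
  obtain ⟨c, hc1, hc2⟩ := sum_norm_eq (DJ Y J' ×ˢ DJ Y J'') (fun x => F x.1 x.2)
  have e1 : ∑ r ∈ DJ Y J', ∑ s ∈ DJ Y J'', ‖F r s‖ = ∑ x ∈ DJ Y J' ×ˢ DJ Y J'', ‖F x.1 x.2‖ := by
    rw [Finset.sum_product]
  have e2 : ∑ x ∈ DJ Y J' ×ˢ DJ Y J'', c x * F x.1 x.2 = ∑ y ∈ DJ Y J' ×ˢ 𝓥,
      bv y.2 * ∑ s ∈ DJ Y J'', c (y.1, s) * ∑ u ∈ 𝓤, au u * tm a y.1 s u y.2 := by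
    rw [Finset.sum_product, Finset.sum_product]
    refine Finset.sum_congr rfl fun r _ => ?_
    have e3 : ∀ s, c (r, s) * F r s = ∑ v ∈ 𝓥, bv v * (c (r, s) * ∑ u ∈ 𝓤, au u * tm a r s u v) := by
      intro s
      simp only [hF]
      rw [Finset.sum_comm, Finset.mul_sum]
      refine Finset.sum_congr rfl fun v _ => ?_
      rw [Finset.mul_sum, Finset.mul_sum, Finset.mul_sum]
      refine Finset.sum_congr rfl fun u _ => ?_
      ring
    simp only [e3]
    rw [Finset.sum_comm]
    refine Finset.sum_congr rfl fun v _ => ?_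
    rw [Finset.mul_sum]
  have e4 : ∑ r ∈ DJ Y J', ∑ s ∈ DJ Y J'', ‖F r s‖ = ‖∑ y ∈ DJ Y J' ×ˢ 𝓥,
      bv y.2 * ∑ s ∈ DJ Y J'', c (y.1, s) * ∑ u ∈ 𝓤, au u * tm a y.1 s u y.2‖ := by
    rw [← e2, ← hc2, Complex.norm_real, e1, Real.norm_of_nonneg]
    positivity
  rw [e4]
  refine (cs_one _ _ _ fun y _ => hbv y.2).trans ?_
  rw [Finset.card_product, Finset.sum_product]
  set R := Y ^ J'.card with hR
  set S := Y ^ J''.card with hS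
  have R1 : 1 ≤ R := one_le_pow₀ hY1
  have S1 : 1 ≤ S := one_le_pow₀ hY1
  set Z := 1 / Y + R ^ 2 * S / B + EB with hZ
  have Z0 : 0 ≤ Z := by positivity
  have hcard : ((DJ Y J').card : ℝ) ≤ cK K * R := DJ_card hY0 d.hJ'
  have b1 : ∀ r ∈ DJ Y J', ∑ v ∈ 𝓥, ‖∑ s ∈ DJ Y J'', c (r, s) * ∑ u ∈ 𝓤, au u * tm a r s u v‖ ^ 2 ≤
      3 * (2 ^ K * (2 * cK K ^ 3 * (Λ * B ^ 2 / (R ^ 4 * S ^ 2)) * Z)) := by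
    intro r hr
    refine (S4 hJ0 d.hΛ hV d.hV8 au r (DJ Y J'') (fun s => c (r, s)) fun s => hc1 _).trans ?_
    exact mul_le_mul_of_nonneg_left (d.S5 hJ0 hJ hr) (by norm_num)
  have b2 := Finset.sum_le_card_nsmul _ _ _ b1
  rw [nsmul_eq_mul] at b2
  have hVc := d.hVc
  calc (((DJ Y J').card * 𝓥.card : ℕ) : ℝ) * ∑ r ∈ DJ Y J', ∑ v ∈ 𝓥,
        ‖∑ s ∈ DJ Y J'', c (r, s) * ∑ u ∈ 𝓤, au u * tm a r s u v‖ ^ 2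
      ≤ ((cK K * R) * Λ) * ((cK K * R) * (3 * (2 ^ K * (2 * cK K ^ 3 * (Λ * B ^ 2 / (R ^ 4 * S ^ 2)) * Z)))) := by
        push_cast
        refine mul_le_mul ?_ ?_ (by positivity) (by positivity)
        · exact mul_le_mul hcard hVc (by positivity) (by positivity)
        · exact b2.trans (mul_le_mul_of_nonneg_right hcard (by positivity))
    _ = _ := by field_simp; ring
end

end

section

/-- global parameters -/
structure GP (ε σ X κ μ Y : ℝ) (K : ℕ) : Prop where
  hε : 0 < ε
  hμ : μ = ε / 1000
  hσ : 2 * varpi < σ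
  hσε : 19 * σ + 90 * varpi + 71 * ε < 1
  hX : 1 ≤ X
  hκ : (K : ℝ) * κ = 1 / 4 + varpi
  hκ1 : κ ≤ ε * (1 / 4 + varpi)
  hκ2 : ε / 8 ≤ κ
  hY : Y = X ^ κ
  hY2 : 2 ≤ Y
  hcK : 1000000 * (cK K ^ (20 + K) * 2 ^ K * K) ≤ X ^ μ
  htau : ∀ n : ℕ, 0 < n → (n : ℝ) ≤ X ^ (2 : ℝ) → (n.divisors.card : ℝ) ≤ X ^ μ
  hlog : 1 + Real.log (X ^ (2 : ℝ)) ≤ X ^ μ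

section
variable {ε σ X κ μ Y : ℝ} {K : ℕ}

lemma GP.Yp (g : GP ε σ X κ μ Y K) (n : ℕ) : Y ^ n = X ^ (κ * n) := by
  rw [g.hY, Real.rpow_mul_natCast (by linarith [g.hX])]

lemma GP.mono (g : GP ε σ X κ μ Y K) {x y : ℝ} (h : x ≤ y) : X ^ x ≤ X ^ y :=
  Real.rpow_le_rpow_of_exponent_le g.hX h

lemma GP.add (g : GP ε σ X κ μ Y K) (x y : ℝ) : X ^ x * X ^ y = X ^ (x + y) :=
  (Real.rpow_add (by linarith [g.hX]) x y).symm

lemma GP.pos (g : GP ε σ X κ μ Y K) (x : ℝ) : 0 < X ^ x := Real.rpow_pos_of_pos (by linarith [g.hX]) x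

lemma GP.K1 (g : GP ε σ X κ μ Y K) : 1 ≤ K := by
  rcases Nat.eq_zero_or_pos K with h | h
  · have := g.hκ
    rw [h] at this
    unfold varpi at this
    norm_num at this
  · exact h

lemma GP.cst (g : GP ε σ X κ μ Y K) {n : ℕ} (hn : n ≤ 20) {c : ℝ} (hc : c ≤ 1000000) (hc0 : 0 ≤ c) :
    c * cK K ^ n ≤ X ^ μ := by
  refine le_trans ?_ g.hcK
  have h1 := cK_one K
  have hK : (1 : ℝ) ≤ K := by exact_mod_cast g.K1
  have h2 : (1 : ℝ) ≤ 2 ^ K := one_le_pow₀ (by norm_num)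
  have h3 : cK K ^ n ≤ cK K ^ (20 + K) * 2 ^ K * K := by
    calc cK K ^ n ≤ cK K ^ (20 + K) := pow_le_pow_right₀ h1 (by omega)
      _ = cK K ^ (20 + K) * 1 * 1 := by ring
      _ ≤ _ := by gcongr
  exact mul_le_mul hc h3 (by positivity) (by norm_num)

/-- the frequency range -/
def HH (Y : ℝ) (K Λ : ℕ) (J'' J0 : Finset ℕ) : ℕ :=
  ⌊cK K ^ 8 * (Y ^ K * Y ^ (J'' \ J0).card) ^ 2 / Λ⌋₊

set_option maxHeartbeats 4000000 in
lemma GP.hard_exp (g : GP ε σ X κ μ Y K) {s : ℝ} (hs1 : 2 * varpi + ε ≤ s) (hs2 : s ≤ σ) {B : ℝ}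
    (hB1 : X ^ (1 / 2 - s) ≤ B) {Λ : ℕ} (hΛ : X ^ (1 / 2 + s) ≤ Λ)
    {J' J'' : Finset ℕ} (hJ' : J' ⊆ Finset.range K) (hJ'' : J'' ⊆ Finset.range K) (hdis : Disjoint J' J'')
    (hun : J' ∪ J'' = Finset.range K)
    (hn2 : κ * J''.card ≤ s + 2 * varpi + ε / 4 + κ) {a : ℤ} (ha : a ≠ 0) (haY : |(a : ℝ)| ≤ Y)
    {𝓤 : Finset ℤ} {α β : ℤ} (h𝓤 : 𝓤 ⊆ Finset.Ico α β) (hαβ : α ≤ β) (hB : (β : ℝ) - α ≤ B)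
    {au : ℤ → ℂ} (hau : ∀ u, ‖au u‖ ≤ 1) {J0 : Finset ℕ} (hJ0 : J0 ⊆ J'') {rt : ℕ} (hrt : rt ∈ DJ Y (J' ∪ J0))
    {ω : ℕ → ℕ → ℤ → ℂ} (hω : ∀ t1 t2 h, ‖ω t1 t2 h‖ ≤ 1) :
    ∑ t1 ∈ DJ Y (J'' \ J0), ∑ t2 ∈ (DJ Y (J'' \ J0)).filter (fun t2 => t1.Coprime t2),
      ‖∑ u1 ∈ 𝓤, ∑ u2 ∈ 𝓤.filter (fun u2 => u2 ≡ u1 [ZMOD (rt ^ 2 : ℕ)]),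
        (au u1 * (starRingEnd ℂ) (au u2)) * ∑ h ∈ Hs (HH Y K Λ J'' J0), ω t1 t2 h * phs a (rt * t1) t2 h u1 u2‖ ≤
    X ^ (-(ε / 10)) * B * (1 + B / (Y ^ J'.card * Y ^ J0.card) ^ 2) * (Y ^ (J'' \ J0).card) ^ 2 := by
  have hY0 : 0 < Y := by linarith [g.hY2]
  have hY1 : 1 ≤ Y := by linarith [g.hY2]
  have hX0 : 0 < X := by linarith [g.hX]
  have hBp : 0 < B := lt_of_lt_of_le (g.pos _) hB1
  have hK1 := cK_one K
  have hw : varpi = 1 / 1400 := rfl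
  have hε := g.hε
  have hμ := g.hμ
  have hσ := g.hσ
  have hσε := g.hσε
  have hκ1 := g.hκ1
  have hκ2 := g.hκ2
  have hKκ := g.hκ
  have hκ0 : 0 < κ := by linarith
  rw [hw] at hs1 hn2 hσ hσε hκ1 hKκ
  set J1 := J'' \ J0 with hJ1
  set H := HH Y K Λ J'' J0 with hH
  by_cases hH0 : H = 0
  · rw [hH0]
    refine le_trans (le_of_eq ?_) (show (0 : ℝ) ≤ _ by positivity)
    refine Finset.sum_eq_zero fun t1 _ => Finset.sum_eq_zero fun t2 _ => ?_
    rw [norm_eq_zero]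
    refine Finset.sum_eq_zero fun u1 _ => Finset.sum_eq_zero fun u2 _ => ?_
    rw [Hs_zero, Finset.sum_empty, mul_zero]
  have hJ1s : J1 ⊆ J'' := Finset.sdiff_subset
  set n := J1.card with hn
  have hnn2 : (n : ℝ) ≤ J''.card := by exact_mod_cast Finset.card_le_card hJ1s
  set τ := κ * n with hτ
  have hτ0 : 0 ≤ τ := by positivity
  have hτ1 : τ ≤ κ * J''.card := mul_le_mul_of_nonneg_left hnn2 hκ0.le
  -- H bound
  have hΛp : (0 : ℝ) < Λ := lt_of_lt_of_le (g.pos _) hΛ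
  have hHle : (H : ℝ) ≤ X ^ (2 / 1400 - s + 2 * τ + μ) := by
    rw [hH]
    unfold HH
    refine (Nat.floor_le (by positivity)).trans ?_
    rw [div_le_iff₀ hΛp]
    have e1 : (Y ^ K * Y ^ n) ^ 2 = X ^ (2 * (1 / 4 + 1 / 1400 + τ)) := by
      rw [g.Yp, g.Yp, g.add, ← Real.rpow_natCast, ← Real.rpow_mul hX0.le]
      congr 1
      push_cast
      rw [mul_comm κ (K : ℝ), hKκ]; ring
    calc cK K ^ 8 * (Y ^ K * Y ^ n) ^ 2 ≤ X ^ μ * X ^ (2 * (1 / 4 + 1 / 1400 + τ)) := by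
          rw [e1]
          refine mul_le_mul_of_nonneg_right ?_ (g.pos _).le
          simpa using g.cst (n := 8) (c := 1) (by norm_num) (by norm_num) (by norm_num)
      _ = X ^ (2 / 1400 - s + 2 * τ + μ) * X ^ (1 / 2 + s) := by
          rw [g.add, g.add]; congr 1; ring
      _ ≤ _ := mul_le_mul_of_nonneg_left hΛ (g.pos _).le
  -- Z
  set nz := ⌈(2 / 1400 - s + τ + ε / 4) / κ⌉₊ with hnz
  have hnzn : nz ≤ n := by
    rw [hnz, Nat.ceil_le, div_le_iff₀ hκ0]
    have : τ = n * κ := by rw [hτ]; ring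
    linarith
  set ζ := κ * nz with hζ
  have hζ0 : 0 ≤ ζ := by positivity
  have hζ1 : 2 / 1400 - s + τ + ε / 4 ≤ ζ := by
    have := Nat.le_ceil ((2 / 1400 - s + τ + ε / 4) / κ)
    rw [div_le_iff₀ hκ0, ← hnz] at this
    rw [hζ]; linarith
  have hζ2 : ζ ≤ 4 / 1400 + ε / 2 + 2 * κ := by
    by_cases hz : 0 ≤ (2 / 1400 - s + τ + ε / 4) / κ
    · have h1 := Nat.ceil_lt_add_one hz
      rw [← hnz] at h1
      have h2 : κ * nz < κ * ((2 / 1400 - s + τ + ε / 4) / κ + 1) := mul_lt_mul_of_pos_left h1 hκ0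
      have h3 : κ * ((2 / 1400 - s + τ + ε / 4) / κ + 1) = (2 / 1400 - s + τ + ε / 4) + κ := by field_simp
      rw [hζ]; linarith
    · have : nz = 0 := by
        rw [hnz, Nat.ceil_eq_zero]; linarith
      rw [hζ, this]; simp; linarith
  -- g
  set γ0 := max (9 / 2 * s + 21 / 1400 + 9 * κ + 11 * (ε / 4)) (4 * s + 24 / 1400 + 10 * κ + 13 * (ε / 4)) with hγ0
  set ng := ⌈γ0 / κ⌉₊ with hng
  set γ := κ * ng with hγ
  have hγ1 : γ0 ≤ γ := by
    have := Nat.le_ceil (γ0 / κ)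
    rw [div_le_iff₀ hκ0, ← hng] at this
    rw [hγ]; linarith
  have hγa := (le_max_left _ _).trans hγ1
  have hγb := (le_max_right _ _).trans hγ1
  have hγ2 : γ ≤ γ0 + κ := by
    have hz : 0 ≤ γ0 / κ := by
      refine div_nonneg (le_trans ?_ (le_max_left _ _)) hκ0.le
      linarith
    have h1 := Nat.ceil_lt_add_one hz
    rw [← hng] at h1
    have h2 : κ * ng < κ * (γ0 / κ + 1) := mul_lt_mul_of_pos_left h1 hκ0
    have h3 : κ * (γ0 / κ + 1) = γ0 + κ := by field_simp
    rw [hγ]; linarith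
  set θ := 2 * s + 12 / 1400 + 5 * κ + 5 * (ε / 4) with hθ
  have hγ3 : γ ≤ 1 / 2 - s - 2 * θ - 2 * (ε / 4) := by
    refine hγ2.trans ?_
    have : γ0 ≤ 1 / 2 - s - 2 * θ - 2 * (ε / 4) - κ := by
      rw [hγ0, hθ]
      refine max_le ?_ ?_ <;> linarith
    linarith
  have hγ4 : γ ≤ 1 / 4 + 1 / 1400 - ζ := by
    refine hγ2.trans ?_
    have : γ0 ≤ 1 / 4 + 1 / 1400 - ζ - κ := by
      rw [hγ0]
      refine max_le ?_ ?_ <;> linarith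
    linarith
  obtain ⟨Jz, hJz, hJzc⟩ := Finset.exists_subset_card_eq (s := J1) (n := nz) hnzn
  have hunion : (J' ∪ J0) ∪ (J1 \ Jz) = Finset.range K \ Jz := by
    ext x
    have h1 := Finset.ext_iff.1 hun x
    have h2 := @hJ0 x
    have h3 := @hJz x
    have h4 : x ∈ J' → x ∉ J'' := fun h => Finset.disjoint_left.1 hdis h
    rw [hJ1] at *
    simp only [Finset.mem_union, Finset.mem_sdiff] at *
    tauto
  have hJzK : Jz ⊆ Finset.range K := hJz.trans (hJ1s.trans hJ'')
  have hcardK : (Finset.range K \ Jz).card = K - nz := by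
    rw [Finset.card_sdiff_of_subset hJzK, hJzc, Finset.card_range]
  have hnzK : nz ≤ K := by
    rw [← hJzc]; simpa using Finset.card_le_card hJzK
  have hngK : ng ≤ K - nz := by
    have : (ng : ℝ) ≤ K - nz := by
      have h1 : κ * ng ≤ κ * (K - nz) := by
        rw [← hγ, mul_sub, ← hζ]; linarith
      exact le_of_mul_le_mul_left h1 hκ0
    have h2 : (ng : ℝ) + nz ≤ K := by linarith
    have h3 : ng + nz ≤ K := by exact_mod_cast h2
    omega
  obtain ⟨Jg, hJg, hJgc⟩ := Finset.exists_subset_card_eq (s := Finset.range K \ Jz) (n := ng) (hcardK ▸ hngK)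
  set N := cK K ^ 2 * Y ^ (Jz.card + J1.card) with hN
  set Gm := cK K * Y ^ (((J' ∪ J0) ∪ (J1 \ Jz)) \ Jg).card with hGm
  have hNe : N = cK K ^ 2 * X ^ (ζ + τ) := by
    rw [hN, g.Yp, hJzc]; congr 2; push_cast; rw [hζ, hτ]; ring
  have hGme : Gm = cK K * X ^ (1 / 4 + 1 / 1400 - ζ - γ) := by
    rw [hGm, hunion, g.Yp, Finset.card_sdiff_of_subset hJg, hcardK, hJgc]
    congr 2
    rw [Nat.cast_sub hngK, Nat.cast_sub hnzK, hζ, hγ, ← hKκ]; ring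
  have c1 := g.cst (n := 1) (c := 1) (by norm_num) (by norm_num) (by norm_num)
  have c2 := g.cst (n := 2) (c := 1) (by norm_num) (by norm_num) (by norm_num)
  rw [one_mul] at c1 c2
  rw [pow_one] at c1
  have hNle : N ≤ X ^ (ζ + τ + μ) := by
    rw [hNe, ← g.add (ζ + τ) μ, mul_comm]
    exact mul_le_mul_of_nonneg_left c2 (g.pos _).le
  have hNge : X ^ (ζ + τ) ≤ N := by
    rw [hNe]; exact le_mul_of_one_le_left (g.pos _).le (one_le_pow₀ hK1)
  have hNp : 0 < N := lt_of_lt_of_le (g.pos _) hNge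
  have hGmle : Gm ≤ X ^ (1 / 4 + 1 / 1400 - ζ - γ + μ) := by
    rw [hGme, ← g.add _ μ, mul_comm]
    exact mul_le_mul_of_nonneg_left c1 (g.pos _).le
  have hGmp : 0 < Gm := by rw [hGme]; have := g.pos (1 / 4 + 1 / 1400 - ζ - γ); positivity
  have sq : ∀ x : ℝ, (X ^ x) ^ 2 = X ^ (2 * x) := by
    intro x
    rw [← Real.rpow_natCast, ← Real.rpow_mul hX0.le]; congr 1; push_cast; ring
  have hGN : (Gm * N ^ 2) ^ 2 ≤ X ^ (2 * (1 / 4 + 1 / 1400 + ζ + 2 * τ - γ) + 6 * μ) := by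
    calc (Gm * N ^ 2) ^ 2 ≤ (X ^ (1 / 4 + 1 / 1400 - ζ - γ + μ) * (X ^ (ζ + τ + μ)) ^ 2) ^ 2 := by gcongr
      _ = _ := by
        rw [sq, g.add, sq]; congr 1; ring
  have hζ3 : ζ ≤ 2 / 1400 - s + τ + ε / 4 + κ ∨ (ζ = 0 ∧ τ ≤ s - 2 / 1400 - ε / 4) := by
    by_cases hz : 0 ≤ (2 / 1400 - s + τ + ε / 4) / κ
    · have h1 := Nat.ceil_lt_add_one hz
      rw [← hnz] at h1
      have h2 : κ * nz < κ * ((2 / 1400 - s + τ + ε / 4) / κ + 1) := mul_lt_mul_of_pos_left h1 hκ0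
      have h3 : κ * ((2 / 1400 - s + τ + ε / 4) / κ + 1) = (2 / 1400 - s + τ + ε / 4) + κ := by field_simp
      left
      rw [hζ]; linarith
    · right
      have : nz = 0 := by
        rw [hnz, Nat.ceil_eq_zero]; linarith
      refine ⟨by rw [hζ, this]; simp, ?_⟩
      by_contra hcon
      exact hz (div_nonneg (by linarith) hκ0.le)
  have hμ0 : 0 < μ := by rw [hμ]; positivity
  have hs0 : 0 < s := by linarith
  have hHNe : 2 / 1400 - s + 2 * τ + ζ + τ ≤ θ := by
    rw [hθ]
    rcases hζ3 with h | ⟨h, h'⟩ <;> linarith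
  have hGe : 2 * (1 / 4 + 1 / 1400 + ζ + 2 * τ - γ) ≤ 1 / 2 - s - 2 * θ - ε / 2 := by
    rw [hθ]
    rcases hζ3 with h | ⟨h, h'⟩ <;> linarith
  have hHp : (0 : ℝ) < H := by exact_mod_cast Nat.pos_of_ne_zero hH0
  have hHN : (H : ℝ) * N ≤ X ^ (θ + 2 * μ) := by
    calc (H : ℝ) * N ≤ X ^ (2 / 1400 - s + 2 * τ + μ) * X ^ (ζ + τ + μ) :=
          mul_le_mul hHle hNle hNp.le (g.pos _).le
      _ = X ^ (2 / 1400 - s + 2 * τ + μ + (ζ + τ + μ)) := g.add _ _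
      _ ≤ _ := g.mono (by linarith)
  have hHN2 : (H : ℝ) ≤ N * X ^ (μ - ε / 4) := by
    calc (H : ℝ) ≤ X ^ (2 / 1400 - s + 2 * τ + μ) := hHle
      _ ≤ X ^ (ζ + τ + (μ - ε / 4)) := g.mono (by linarith)
      _ = X ^ (ζ + τ) * X ^ (μ - ε / 4) := (g.add _ _).symm
      _ ≤ _ := mul_le_mul_of_nonneg_right hNge (g.pos _).le
  have hXle1 : ∀ x : ℝ, x ≤ 0 → X ^ x ≤ 1 := fun x hx => by
    rw [← Real.rpow_zero X]; exact g.mono hx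
  have hHN3 : (H : ℝ) ≤ N := hHN2.trans (mul_le_of_le_one_right hNp.le (hXle1 _ (by linarith)))
  set E2 := X ^ (-2 * θ - ε / 2 + 6 * μ) with hE2
  have hE2p : 0 < E2 := g.pos _
  have hT1 : (Gm * N ^ 2) ^ 2 ≤ B * E2 := by
    calc (Gm * N ^ 2) ^ 2 ≤ X ^ (2 * (1 / 4 + 1 / 1400 + ζ + 2 * τ - γ) + 6 * μ) := hGN
      _ ≤ X ^ (1 / 2 - s + (-2 * θ - ε / 2 + 6 * μ)) := g.mono (by linarith)
      _ = X ^ (1 / 2 - s) * E2 := (g.add _ _).symm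
      _ ≤ _ := mul_le_mul_of_nonneg_right hB1 hE2p.le
  have hYg : Y ^ ng = X ^ γ := g.Yp ng
  have hT2 : B ^ 2 / Y ^ ng ≤ B ^ 2 * E2 := by
    rw [div_eq_mul_inv, hYg, ← Real.rpow_neg hX0.le]
    refine mul_le_mul_of_nonneg_left (g.mono ?_) (by positivity)
    rw [hθ]; linarith
  have hT3 : cK K * Y ^ ng ≤ B * E2 := by
    calc cK K * Y ^ ng ≤ X ^ μ * X ^ γ := by
          rw [hYg]; exact mul_le_mul_of_nonneg_right c1 (g.pos _).le
      _ = X ^ (μ + γ) := g.add _ _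
      _ ≤ X ^ (1 / 2 - s + (-2 * θ - ε / 2 + 6 * μ)) := g.mono (by linarith)
      _ = X ^ (1 / 2 - s) * E2 := (g.add _ _).symm
      _ ≤ _ := mul_le_mul_of_nonneg_right hB1 hE2p.le
  have hθ0 : 0 < θ := by rw [hθ]; linarith
  have hE2le : E2 ≤ 1 := hXle1 _ (by linarith)
  have hmB : (Gm * N ^ 2) ^ 2 ≤ B := hT1.trans (mul_le_of_le_one_right hBp.le hE2le)
  have hlim : (H : ℝ) * N ^ 2 ≤ X ^ (2 : ℝ) := by
    calc (H : ℝ) * N ^ 2 = H * N * N := by ring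
      _ ≤ X ^ (θ + 2 * μ) * X ^ (ζ + τ + μ) := mul_le_mul hHN hNle hNp.le (g.pos _).le
      _ = X ^ (θ + 2 * μ + (ζ + τ + μ)) := g.add _ _
      _ ≤ _ := g.mono (by rw [hθ]; linarith)
  have hgLim : cK K * Y ^ Jg.card ≤ X ^ (2 : ℝ) := by
    rw [hJgc, hYg]
    calc cK K * X ^ γ ≤ X ^ μ * X ^ γ := mul_le_mul_of_nonneg_right c1 (g.pos _).le
      _ = X ^ (μ + γ) := g.add _ _
      _ ≤ _ := g.mono (by linarith)
  have hL1 : 1 ≤ X ^ μ := by rw [← Real.rpow_zero X]; exact g.mono hμ0.le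
  have hdis2 : Disjoint (J' ∪ J0) J1 := by
    rw [Finset.disjoint_union_left]
    exact ⟨Finset.disjoint_of_subset_right hJ1s hdis, Finset.disjoint_sdiff⟩
  have hJrK : J' ∪ J0 ⊆ Finset.range K := Finset.union_subset hJ' (hJ0.trans hJ'')
  have hJg2 : Jg ⊆ (J' ∪ J0) ∪ (J1 \ Jz) := by rw [hunion]; exact hJg
  have main := exp_lemma g.hY2 (Jr := J' ∪ J0) (J1 := J1) (Jz := Jz) (Jg := Jg) hJrK (hJ1s.trans hJ'') hdis2 hJz hJg2
    hrt a ha haY H N (X ^ (2 : ℝ)) (X ^ μ) Gm B hN hGm hL1 g.htau hlim hgLim g.hlog 𝓤 α β h𝓤 hαβ hB hmB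
    (fun u1 u2 => au u1 * (starRingEnd ℂ) (au u2)) (fun u1 u2 => by
      rw [norm_mul, RCLike.norm_conj]
      exact mul_le_one₀ (hau _) (norm_nonneg _) (hau _)) ω hω
  refine main.trans ?_
  rw [hJgc]
  have c3 : (3 : ℝ) ≤ X ^ μ := by
    simpa using g.cst (n := 0) (c := 3) (by norm_num) (by norm_num) (by norm_num)
  have hI : Real.sqrt (B * (Gm * N ^ 2) ^ 2 + B ^ 2 / Y ^ ng + B * (cK K * Y ^ ng)) ≤ B * X ^ (-θ - ε / 4 + 4 * μ) := by
    apply Real.sqrt_le_iff.2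
    refine ⟨mul_nonneg hBp.le (g.pos _).le, ?_⟩
    rw [mul_pow B, sq]
    calc B * (Gm * N ^ 2) ^ 2 + B ^ 2 / Y ^ ng + B * (cK K * Y ^ ng) ≤ B * (B * E2) + B ^ 2 * E2 + B * (B * E2) := by
          have := mul_le_mul_of_nonneg_left hT1 hBp.le
          have := mul_le_mul_of_nonneg_left hT3 hBp.le
          linarith
      _ = B ^ 2 * (3 * E2) := by ring
      _ ≤ B ^ 2 * (X ^ μ * E2) := by gcongr
      _ ≤ _ := by
        rw [hE2, g.add]
        refine mul_le_mul_of_nonneg_left (g.mono ?_) (by positivity)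
        linarith
  have c66 : (66 : ℝ) ≤ X ^ μ := by
    simpa using g.cst (n := 0) (c := 66) (by norm_num) (by norm_num) (by norm_num)
  have pw : ∀ k : ℕ, (X ^ μ) ^ k = X ^ (μ * k) := fun k => by
    rw [Real.rpow_mul_natCast hX0.le]
  have hcore : Real.sqrt (B * (2 * H * N * (X ^ μ) ^ 2 * B + 32 * (X ^ μ) ^ 5 * N ^ 2 * ((H : ℝ) ^ 2 + H * N) *
      Real.sqrt (B * (Gm * N ^ 2) ^ 2 + B ^ 2 / Y ^ ng + B * (cK K * Y ^ ng)))) ≤ B * N * X ^ (-(ε / 8) + 6 * μ) := by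
    apply Real.sqrt_le_iff.2
    refine ⟨mul_nonneg (by positivity) (g.pos _).le, ?_⟩
    rw [mul_pow (B * N), sq (-(ε / 8) + 6 * μ)]
    have h1 : 2 * H * N * (X ^ μ) ^ 2 * B ≤ 2 * (N ^ 2 * X ^ (-(ε / 4) + 11 * μ) * B) := by
      calc 2 * H * N * (X ^ μ) ^ 2 * B ≤ 2 * (N * X ^ (μ - ε / 4)) * N * (X ^ μ) ^ 2 * B := by gcongr
        _ = 2 * (N ^ 2 * (X ^ (μ - ε / 4) * X ^ (μ * (2 : ℕ))) * B) := by rw [pw]; ring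
        _ ≤ _ := by
          rw [g.add]
          have : X ^ (μ - ε / 4 + μ * (2 : ℕ)) ≤ X ^ (-(ε / 4) + 11 * μ) := g.mono (by push_cast; linarith)
          gcongr
    have h2 : 32 * (X ^ μ) ^ 5 * N ^ 2 * ((H : ℝ) ^ 2 + H * N) *
        Real.sqrt (B * (Gm * N ^ 2) ^ 2 + B ^ 2 / Y ^ ng + B * (cK K * Y ^ ng)) ≤
        64 * (N ^ 2 * X ^ (-(ε / 4) + 11 * μ) * B) := by
      have h3 : (H : ℝ) ^ 2 + H * N ≤ 2 * X ^ (θ + 2 * μ) := by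
        have : (H : ℝ) ^ 2 ≤ H * N := by rw [pow_two]; exact mul_le_mul_of_nonneg_left hHN3 hHp.le
        linarith
      calc _ ≤ 32 * (X ^ μ) ^ 5 * N ^ 2 * (2 * X ^ (θ + 2 * μ)) * (B * X ^ (-θ - ε / 4 + 4 * μ)) := by
            have := g.pos (θ + 2 * μ)
            have := g.pos μ
            gcongr
        _ = 64 * (N ^ 2 * (X ^ (μ * (5 : ℕ)) * (X ^ (θ + 2 * μ) * X ^ (-θ - ε / 4 + 4 * μ))) * B) := by rw [pw]; ring
        _ = _ := by
          rw [g.add, g.add]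
          congr 4
          push_cast; ring
    calc B * (2 * H * N * (X ^ μ) ^ 2 * B + 32 * (X ^ μ) ^ 5 * N ^ 2 * ((H : ℝ) ^ 2 + H * N) *
          Real.sqrt (B * (Gm * N ^ 2) ^ 2 + B ^ 2 / Y ^ ng + B * (cK K * Y ^ ng)))
        ≤ B * (66 * (N ^ 2 * X ^ (-(ε / 4) + 11 * μ) * B)) := by
          refine mul_le_mul_of_nonneg_left ?_ hBp.le
          linarith
      _ ≤ B * (X ^ μ * (N ^ 2 * X ^ (-(ε / 4) + 11 * μ) * B)) := by
          have := g.pos (-(ε / 4) + 11 * μ)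
          gcongr
      _ = (B * N) ^ 2 * (X ^ μ * X ^ (-(ε / 4) + 11 * μ)) := by ring
      _ = _ := by
          rw [g.add]; congr 2; ring
  have hrt2 : 2 * B / ((rt ^ 2 : ℕ) : ℝ) + 1 ≤ 2 * (1 + B / (Y ^ J'.card * Y ^ J0.card) ^ 2) := by
    have h1 := DJ_ge hY0 hrt
    rw [Finset.card_union_of_disjoint (Finset.disjoint_of_subset_right hJ0 hdis), pow_add] at h1
    have h2 : 2 * B / ((rt ^ 2 : ℕ) : ℝ) ≤ 2 * (B / (Y ^ J'.card * Y ^ J0.card) ^ 2) := by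
      rw [mul_div_assoc]
      push_cast
      gcongr
    linarith
  have hYN : cK K * Y ^ (J1 \ Jz).card * N = cK K ^ 3 * (Y ^ n) ^ 2 := by
    rw [hN, Finset.card_sdiff_of_subset hJz, hJzc, ← hn]
    have : Y ^ (n - nz) * Y ^ (nz + n) = (Y ^ n) ^ 2 := by
      rw [← pow_add, ← pow_mul]; congr 1; omega
    calc _ = cK K ^ 3 * (Y ^ (n - nz) * Y ^ (nz + n)) := by ring
      _ = _ := by rw [this]
  set Q := 1 + B / (Y ^ J'.card * Y ^ J0.card) ^ 2 with hQ
  have hQ0 : 0 ≤ Q := by positivity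
  have c23 := g.cst (n := 3) (c := 2) (by norm_num) (by norm_num) (by norm_num)
  calc _ ≤ cK K * Y ^ (J1 \ Jz).card * ((2 * Q) * (B * N * X ^ (-(ε / 8) + 6 * μ))) := by
        gcongr
    _ = cK K * Y ^ (J1 \ Jz).card * N * (2 * Q * B * X ^ (-(ε / 8) + 6 * μ)) := by ring
    _ = (2 * cK K ^ 3) * X ^ (-(ε / 8) + 6 * μ) * (Q * B * (Y ^ n) ^ 2) := by rw [hYN]; ring
    _ ≤ X ^ μ * X ^ (-(ε / 8) + 6 * μ) * (Q * B * (Y ^ n) ^ 2) := by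
        have := g.pos (-(ε / 8) + 6 * μ)
        gcongr
    _ ≤ X ^ (-(ε / 10)) * (Q * B * (Y ^ n) ^ 2) := by
        rw [g.add]
        refine mul_le_mul_of_nonneg_right (g.mono ?_) (by positivity)
        rw [hμ]; linarith
    _ = _ := by ring
end

end

section

/-- discrepancy kernel -/
def emk (a : ℤ) (d : ℕ) (u v : ℤ) : ℂ := (if Int.gcd u d = 1 then 1 else 0) * (dv a d u v - 1 / (d : ℂ) ^ 2)

lemma emk_mul {a : ℤ} {r s : ℕ} (hc : r.Coprime s) (u v : ℤ) :
    emk a (r * s) u v = tm a r s u v + 1 / (s : ℂ) ^ 2 * ((if Int.gcd u s = 1 then 1 else 0) * emk a r u v) := by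
  unfold emk tm
  rw [← dv_mul hc]
  by_cases h1 : Int.gcd u (r : ℤ) = 1
  · by_cases h2 : Int.gcd u (s : ℤ) = 1
    · rw [if_pos (gcd_mul_one.2 ⟨h1, h2⟩), if_pos h1, if_pos h2]
      push_cast
      have e : (1 : ℂ) / ((r : ℂ) * s) ^ 2 = 1 / (s : ℂ) ^ 2 * (1 / (r : ℂ) ^ 2) := by
        rw [mul_pow, mul_comm, one_div_mul_one_div]
      rw [e]; ring
    · rw [if_neg (fun h => h2 (gcd_mul_one.1 h).2), if_neg h2]; ring
  · rw [if_neg (fun h => h1 (gcd_mul_one.1 h).1), if_neg h1]; ring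

/-- total discrepancy -/
def EE (Y : ℝ) (J : Finset ℕ) (a : ℤ) (𝓤 𝓥 : Finset ℤ) (au bv : ℤ → ℂ) : ℝ :=
  ∑ d ∈ DJ Y J, ‖∑ u ∈ 𝓤, ∑ v ∈ 𝓥, au u * bv v * emk a d u v‖

lemma EE_split {Y : ℝ} (hY : 2 ≤ Y) {K : ℕ} {J' J'' : Finset ℕ} (hJ'' : J'' ⊆ Finset.range K) (hdis : Disjoint J' J'')
    {a : ℤ} {𝓤 𝓥 : Finset ℤ} {au bv : ℤ → ℂ} {M : ℝ}
    (hM : ∀ s : ℕ, EE Y J' a 𝓤 𝓥 (fun u => au u * (if Int.gcd u s = 1 then 1 else 0)) bv ≤ M) :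
    EE Y (J' ∪ J'') a 𝓤 𝓥 au bv ≤
      (∑ r ∈ DJ Y J', ∑ s ∈ DJ Y J'', ‖∑ u ∈ 𝓤, ∑ v ∈ 𝓥, au u * bv v * tm a r s u v‖) + cK K / Y ^ J''.card * M := by
  have hY0 : 0 < Y := by linarith
  have hM0 : 0 ≤ M := le_trans (Finset.sum_nonneg fun _ _ => norm_nonneg _) (hM 0)
  have s1 := sum_DJ_split hY0 (Finset.subset_union_left : J' ⊆ J' ∪ J'')
    (fun d => ‖∑ u ∈ 𝓤, ∑ v ∈ 𝓥, au u * bv v * emk a d u v‖) (fun _ => norm_nonneg _)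
  rw [Finset.union_sdiff_cancel_left hdis] at s1
  refine s1.trans ?_
  have key : ∀ r ∈ DJ Y J', ∀ s ∈ DJ Y J'', ‖∑ u ∈ 𝓤, ∑ v ∈ 𝓥, au u * bv v * emk a (r * s) u v‖ ≤
      ‖∑ u ∈ 𝓤, ∑ v ∈ 𝓥, au u * bv v * tm a r s u v‖ + 1 / (Y ^ J''.card) ^ 2 *
      ‖∑ u ∈ 𝓤, ∑ v ∈ 𝓥, (au u * (if Int.gcd u s = 1 then 1 else 0)) * bv v * emk a r u v‖ := by
    intro r hr s hs
    have e : ∑ u ∈ 𝓤, ∑ v ∈ 𝓥, au u * bv v * emk a (r * s) u v = ∑ u ∈ 𝓤, ∑ v ∈ 𝓥, au u * bv v * tm a r s u v +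
        1 / (s : ℂ) ^ 2 * ∑ u ∈ 𝓤, ∑ v ∈ 𝓥, (au u * (if Int.gcd u s = 1 then 1 else 0)) * bv v * emk a r u v := by
      rw [Finset.mul_sum, ← Finset.sum_add_distrib]
      refine Finset.sum_congr rfl fun u _ => ?_
      rw [Finset.mul_sum, ← Finset.sum_add_distrib]
      refine Finset.sum_congr rfl fun v _ => ?_
      rw [emk_mul (DJ_coprime hY0 hr hs hdis)]; ring
    rw [e]
    refine (norm_add_le _ _).trans ?_
    rw [norm_mul]
    have h1 := DJ_ge hY0 hs
    have h2 : ‖(1 : ℂ) / (s : ℂ) ^ 2‖ ≤ 1 / (Y ^ J''.card) ^ 2 := by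
      rw [norm_div, norm_pow, Complex.norm_natCast, norm_one]
      gcongr
    gcongr
  calc _ ≤ ∑ r ∈ DJ Y J', ∑ s ∈ DJ Y J'', (‖∑ u ∈ 𝓤, ∑ v ∈ 𝓥, au u * bv v * tm a r s u v‖ + 1 / (Y ^ J''.card) ^ 2 *
      ‖∑ u ∈ 𝓤, ∑ v ∈ 𝓥, (au u * (if Int.gcd u s = 1 then 1 else 0)) * bv v * emk a r u v‖) :=
        Finset.sum_le_sum fun r hr => Finset.sum_le_sum fun s hs => key r hr s hs
    _ = (∑ r ∈ DJ Y J', ∑ s ∈ DJ Y J'', ‖∑ u ∈ 𝓤, ∑ v ∈ 𝓥, au u * bv v * tm a r s u v‖) +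
        1 / (Y ^ J''.card) ^ 2 * ∑ s ∈ DJ Y J'', EE Y J' a 𝓤 𝓥 (fun u => au u * (if Int.gcd u s = 1 then 1 else 0)) bv := by
      simp_rw [Finset.sum_add_distrib]
      congr 1
      rw [Finset.sum_comm, Finset.mul_sum]
      refine Finset.sum_congr rfl fun s _ => ?_
      rw [EE, Finset.mul_sum]
    _ ≤ _ := by
      refine add_le_add le_rfl ?_
      calc _ ≤ 1 / (Y ^ J''.card) ^ 2 * ∑ s ∈ DJ Y J'', M := by
            refine mul_le_mul_of_nonneg_left (Finset.sum_le_sum fun s _ => hM s) (by positivity)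
        _ = 1 / (Y ^ J''.card) ^ 2 * ((DJ Y J'').card * M) := by rw [Finset.sum_const, nsmul_eq_mul]
        _ ≤ 1 / (Y ^ J''.card) ^ 2 * ((cK K * Y ^ J''.card) * M) := by
            have := DJ_card hY0 hJ''
            gcongr
        _ = _ := by field_simp

lemma EE_easy {Y : ℝ} (hY : 2 ≤ Y) {K : ℕ} {a : ℤ} (ha : a ≠ 0) (haY : |(a : ℝ)| ≤ Y) {Λ : ℕ} (hΛ : 0 < Λ)
    {v0 : ℤ} {𝓤 𝓥 : Finset ℤ} {α β : ℤ} (h𝓤 : 𝓤 ⊆ Finset.Ico α β) (hαβ : α ≤ β) {B : ℝ} (hB : (β : ℝ) - α ≤ B)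
    (hB0 : 0 < B) (hV0 : ∀ v ∈ 𝓥, 0 ≤ v) (hV8 : ∀ v ∈ 𝓥, 8 * |(v : ℝ) - v0| ≤ Λ) (hVc : (𝓥.card : ℝ) ≤ Λ)
    {bv : ℤ → ℂ} (hbv : ∀ v, ‖bv v‖ ≤ 1) (n : ℕ) :
    (Y ^ n) ^ 2 ≤ B → cK K ^ 8 * (Y ^ (n + 1)) ^ 2 ≤ Λ → ∀ J ⊆ Finset.range K, J.card = n →
    ∀ au : ℤ → ℂ, (∀ u, ‖au u‖ ≤ 1) →
    EE Y J a 𝓤 𝓥 au bv ≤ (12 * 2 ^ K * cK K ^ 5) * (n * cK K ^ n) * (Λ * B / Y ^ n) * Real.sqrt (1 / Y) := by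
  have hY0 : 0 < Y := by linarith
  have hY1 : 1 ≤ Y := by linarith
  have hK1 := cK_one K
  induction n with
  | zero =>
    intro _ _ J _ hJ au _
    rw [Finset.card_eq_zero] at hJ
    rw [hJ, EE, DJ_empty hY0]
    simp [emk, dv]
  | succ n ih =>
    intro h1 h2 J hJ hJc au hau
    obtain ⟨j, hj⟩ : J.Nonempty := by rw [← Finset.card_pos]; omega
    have hYn : Y ^ n ≤ Y ^ (n + 1) := pow_le_pow_right₀ hY1 (by omega)
    have hYn2 : Y ^ (n + 1) ≤ Y ^ (n + 1 + 1) := pow_le_pow_right₀ hY1 (by omega)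
    have hJ'c : (J.erase j).card = n := by rw [Finset.card_erase_of_mem hj, hJc]; omega
    have hJ'K : J.erase j ⊆ Finset.range K := (Finset.erase_subset _ _).trans hJ
    have hjK : {j} ⊆ Finset.range K := Finset.singleton_subset_iff.2 (hJ hj)
    have hun : J.erase j ∪ {j} = J := by
      ext x; simp only [Finset.mem_union, Finset.mem_erase, Finset.mem_singleton]
      constructor
      · rintro (h | h)
        · exact h.2
        · exact h ▸ hj
      · intro h
        by_cases hx : x = j
        · exact Or.inr hx
        · exact Or.inl ⟨hx, h⟩
    have hdis : Disjoint (J.erase j) {j} := by simp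
    have hsd : SD Y K (J.erase j) {j} a Λ v0 𝓤 𝓥 α β B (fun _ => 0) 0 au := by
      refine ⟨hY, hJ'K, hjK, hdis, ha, haY, hΛ, h𝓤, hαβ, hB, hB0, ?_, hV0, hV8, hVc, ?_, ?_, hau, le_rfl, ?_⟩
      · rw [hJ'c, Finset.card_singleton]
        refine le_trans ?_ h1
        rw [← pow_mul, ← pow_add, ← pow_mul]
        exact pow_le_pow_right₀ hY1 (by omega)
      · intro r hr s hs
        have h3 := DJ_le hY0 hJ'K hr
        have h4 := DJ_le hY0 hjK hs
        rw [hJ'c] at h3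
        rw [Finset.card_singleton] at h4
        have : (((r * s) ^ 2 : ℕ) : ℝ) ≤ Λ := by
          push_cast
          calc ((r : ℝ) * s) ^ 2 ≤ (cK K * Y ^ n * (cK K * Y ^ 1)) ^ 2 := by gcongr
            _ = cK K ^ 4 * (Y ^ (n + 1)) ^ 2 := by rw [pow_succ Y n]; ring
            _ ≤ cK K ^ 8 * (Y ^ (n + 1 + 1)) ^ 2 := by
              have : cK K ^ 4 ≤ cK K ^ 8 := pow_le_pow_right₀ hK1 (by norm_num)
              gcongr
            _ ≤ _ := h2
        exact_mod_cast this
      · intro J0 hJ0 r hr s0 hs0 t1 ht1 t2 ht2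
        have h3 := DJ_le hY0 hJ'K hr
        have h4 := DJ_le hY0 (hJ0.trans hjK) hs0
        have h5 := DJ_le hY0 (Finset.sdiff_subset.trans hjK) ht1
        have h6 := DJ_le hY0 (Finset.sdiff_subset.trans hjK) ht2
        rw [hJ'c] at h3
        have hcc : J0.card + ({j} \ J0).card = 1 := by
          rw [Finset.card_sdiff_of_subset hJ0, Finset.card_singleton]
          have := Finset.card_le_card hJ0
          rw [Finset.card_singleton] at this; omega
        have : (((r * s0 * t1 * t2) ^ 2 : ℕ) : ℝ) ≤ Λ := by
          push_cast
          calc ((r : ℝ) * s0 * t1 * t2) ^ 2 ≤ (cK K * Y ^ n * (cK K * Y ^ J0.card) * (cK K * Y ^ ({j} \ J0).card) *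
                (cK K * Y ^ ({j} \ J0).card)) ^ 2 := by gcongr
            _ = cK K ^ 8 * (Y ^ (n + (J0.card + ({j} \ J0).card) + ({j} \ J0).card)) ^ 2 := by
              rw [pow_add, pow_add, pow_add]; ring
            _ ≤ cK K ^ 8 * (Y ^ (n + 1 + 1)) ^ 2 := by
              have : Y ^ (n + (J0.card + ({j} \ J0).card) + ({j} \ J0).card) ≤ Y ^ (n + 1 + 1) :=
                pow_le_pow_right₀ hY1 (by omega)
              gcongr
            _ ≤ _ := h2
        have h7 : (r * s0 * t1 * t2) ^ 2 ≤ Λ := by exact_mod_cast this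
        simpa using h7
      · intro J0 _ rt _ ω _
        simp [Hs_zero]
    have hst := hsd.step bv hbv
    rw [hJ'c, Finset.card_singleton] at hst
    have hsplit := EE_split hY (a := a) (𝓤 := 𝓤) (𝓥 := 𝓥) (au := au) (bv := bv) hjK hdis
      (fun s => ih (le_trans (by gcongr) h1) (le_trans (by gcongr) h2) (J.erase j) hJ'K hJ'c
        (fun u => au u * (if Int.gcd u s = 1 then 1 else 0)) (fun u => by
          split_ifs
          · simpa using hau u
          · simp))
    rw [hun, Finset.card_singleton] at hsplit
    refine hsplit.trans ?_
    set St := (∑ r ∈ DJ Y (J.erase j), ∑ s ∈ DJ Y {j}, ‖∑ u ∈ 𝓤, ∑ v ∈ 𝓥, au u * bv v * tm a r s u v‖) with hSt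
    set c := 12 * 2 ^ K * cK K ^ 5 with hc
    have hc1 : 1 ≤ c := by
      rw [hc]
      have : (1 : ℝ) ≤ 2 ^ K := one_le_pow₀ (by norm_num)
      have : (1 : ℝ) ≤ cK K ^ 5 := one_le_pow₀ hK1
      nlinarith
    set W := Λ * B / Y ^ (n + 1) with hW
    have hW0 : 0 ≤ W := by positivity
    have hStle : St ≤ c * W * Real.sqrt (1 / Y) := by
      refine abs_le_of_sq_le_sq' ?_ (by positivity) |>.2
      refine hst.trans ?_
      rw [mul_pow, Real.sq_sqrt (by positivity)]
      have h3 : (Y ^ n) ^ 2 * Y ^ 1 / B ≤ 1 / Y := by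
        rw [div_le_div_iff₀ hB0 hY0]
        calc (Y ^ n) ^ 2 * Y ^ 1 * Y = (Y ^ (n + 1)) ^ 2 := by rw [pow_succ Y n]; ring
          _ ≤ _ := by linarith
      calc _ ≤ 6 * 2 ^ K * cK K ^ 5 * (Λ * B / (Y ^ n * Y ^ 1)) ^ 2 * (1 / Y + 1 / Y + 0) := by gcongr
        _ = c * W ^ 2 * (1 / Y) := by rw [hc, hW, ← pow_add]; ring
        _ ≤ c ^ 2 * W ^ 2 * (1 / Y) := by
          have : c ≤ c ^ 2 := by nlinarith
          gcongr
        _ = _ := by ring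
    have e2 : cK K / Y ^ 1 * (c * (n * cK K ^ n) * (Λ * B / Y ^ n) * Real.sqrt (1 / Y)) =
        c * (n * cK K ^ (n + 1)) * W * Real.sqrt (1 / Y) := by
      rw [hW, pow_succ, pow_succ]; field_simp; ring
    rw [e2]
    have h5 : (1 : ℝ) ≤ cK K ^ (n + 1) := one_le_pow₀ hK1
    have hcW : 0 ≤ c * W * Real.sqrt (1 / Y) := by positivity
    push_cast
    nlinarith [mul_le_mul_of_nonneg_left h5 hcW]

end

section

section
variable {ε σ X κ μ Y : ℝ} {K : ℕ}

set_option maxHeartbeats 1000000 in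
lemma GP.hard (g : GP ε σ X κ μ Y K) {s : ℝ} (hs1 : 2 * varpi + ε ≤ s) (hs2 : s ≤ σ) {B : ℝ}
    (hB1 : X ^ (1 / 2 - s) ≤ B) {Λ : ℕ} (hΛ : X ^ (1 / 2 + s) ≤ Λ)
    {a : ℤ} (ha : a ≠ 0) (haY : |(a : ℝ)| ≤ Y) {v0 : ℤ} {𝓤 𝓥 : Finset ℤ} {α β : ℤ}
    (h𝓤 : 𝓤 ⊆ Finset.Ico α β) (hαβ : α ≤ β) (hB : (β : ℝ) - α ≤ B)
    (hV0 : ∀ v ∈ 𝓥, 0 ≤ v) (hV8 : ∀ v ∈ 𝓥, 8 * |(v : ℝ) - v0| ≤ Λ) (hVc : (𝓥.card : ℝ) ≤ Λ)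
    {au bv : ℤ → ℂ} (hau : ∀ u, ‖au u‖ ≤ 1) (hbv : ∀ v, ‖bv v‖ ≤ 1) :
    EE Y (Finset.range K) a 𝓤 𝓥 au bv ≤ Λ * B / Y ^ K * X ^ (-(ε / 25)) := by
  have hY0 : 0 < Y := by linarith [g.hY2]
  have hY1 : 1 ≤ Y := by linarith [g.hY2]
  have hX0 : 0 < X := by linarith [g.hX]
  have hBp : 0 < B := lt_of_lt_of_le (g.pos _) hB1
  have hK1 := cK_one K
  have hw : varpi = 1 / 1400 := rfl
  have hε := g.hε
  have hμ := g.hμ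
  have hσ := g.hσ
  have hσε := g.hσε
  have hκ1 := g.hκ1
  have hκ2 := g.hκ2
  have hKκ := g.hκ
  have hκ0 : 0 < κ := by linarith
  have hs1' := hs1
  rw [hw] at hs1 hσ hσε hκ1 hKκ
  have hΛp : (0 : ℝ) < Λ := lt_of_lt_of_le (g.pos _) hΛ
  have hΛ0 : 0 < Λ := by exact_mod_cast hΛp
  have pw : ∀ (x : ℝ) (k : ℕ), (X ^ x) ^ k = X ^ (x * k) := fun x k => by
    rw [Real.rpow_mul_natCast hX0.le]
  -- n2
  set n2 := ⌈(s + 2 / 1400 + ε / 4) / κ⌉₊ with hn2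
  have hk1 : s + 2 / 1400 + ε / 4 ≤ κ * n2 := by
    have := Nat.le_ceil ((s + 2 / 1400 + ε / 4) / κ)
    rw [div_le_iff₀ hκ0, ← hn2] at this
    linarith
  have hk2 : κ * n2 ≤ s + 2 / 1400 + ε / 4 + κ := by
    have h1 := Nat.ceil_lt_add_one (a := (s + 2 / 1400 + ε / 4) / κ) (div_nonneg (by linarith) hκ0.le)
    rw [← hn2] at h1
    have h2 : κ * n2 < κ * ((s + 2 / 1400 + ε / 4) / κ + 1) := mul_lt_mul_of_pos_left h1 hκ0
    have h3 : κ * ((s + 2 / 1400 + ε / 4) / κ + 1) = (s + 2 / 1400 + ε / 4) + κ := by field_simp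
    linarith
  have hn2K : n2 ≤ K := by
    have : κ * n2 ≤ κ * K := by linarith
    exact_mod_cast le_of_mul_le_mul_left this hκ0
  obtain ⟨J'', hJ'', hJ''c⟩ := Finset.exists_subset_card_eq (s := Finset.range K) (n := n2) (by simpa using hn2K)
  set J' := Finset.range K \ J'' with hJ'def
  have hJ' : J' ⊆ Finset.range K := Finset.sdiff_subset
  have hdis : Disjoint J' J'' := Finset.sdiff_disjoint
  have hun : J' ∪ J'' = Finset.range K := Finset.sdiff_union_of_subset hJ''
  have hJ'c : J'.card = K - n2 := by
    rw [hJ'def, Finset.card_sdiff_of_subset hJ'', Finset.card_range, hJ''c]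
  set n1 := K - n2 with hn1
  have hn12 : n1 + n2 = K := by omega
  have hn1κ : κ * n1 = 1 / 4 + 1 / 1400 - κ * n2 := by
    have : (n1 : ℝ) + n2 = K := by exact_mod_cast hn12
    rw [← hKκ, ← this]; ring
  have hYK : Y ^ n1 * Y ^ n2 = Y ^ K := by rw [← pow_add, hn12]
  have hμ0 : 0 < μ := by rw [hμ]; positivity
  have hYKX : (Y ^ K) ^ 2 = X ^ (1 / 2 + 2 / 1400 : ℝ) := by
    rw [g.Yp, pw]; congr 1; rw [mul_comm κ, hKκ]; norm_num
  have hR2 : (Y ^ n1) ^ 2 = X ^ (1 / 2 + 2 / 1400 - 2 * (κ * n2)) := by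
    rw [g.Yp, pw]; congr 1; rw [hn1κ]; push_cast; ring
  have hR2S : (Y ^ n1) ^ 2 * Y ^ n2 ≤ B * X ^ (-(ε / 4)) := by
    calc (Y ^ n1) ^ 2 * Y ^ n2 = X ^ (1 / 2 + 2 / 1400 - 2 * (κ * n2) + κ * n2) := by
          rw [hR2, g.Yp n2, g.add]
      _ ≤ X ^ (1 / 2 - s + -(ε / 4)) := g.mono (by linarith)
      _ = X ^ (1 / 2 - s) * X ^ (-(ε / 4)) := (g.add _ _).symm
      _ ≤ _ := mul_le_mul_of_nonneg_right hB1 (g.pos _).le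
  have hXle1 : ∀ x : ℝ, x ≤ 0 → X ^ x ≤ 1 := fun x hx => by
    rw [← Real.rpow_zero X]; exact g.mono hx
  have hsd : SD Y K J' J'' a Λ v0 𝓤 𝓥 α β B (HH Y K Λ J'') (X ^ (-(ε / 10))) au := by
    refine ⟨g.hY2, hJ', hJ'', hdis, ha, haY, hΛ0, h𝓤, hαβ, hB, hBp, ?_, hV0, hV8, hVc, ?_, ?_, hau, (g.pos _).le, ?_⟩
    · rw [hJ'c, hJ''c]
      exact hR2S.trans (mul_le_of_le_one_right hBp.le (hXle1 _ (by linarith)))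
    · intro r hr t ht
      have h3 := DJ_le hY0 hJ' hr
      have h4 := DJ_le hY0 hJ'' ht
      rw [hJ'c] at h3
      rw [hJ''c] at h4
      have c4 := g.cst (n := 4) (c := 1) (by norm_num) (by norm_num) (by norm_num)
      rw [one_mul] at c4
      have : (((r * t) ^ 2 : ℕ) : ℝ) ≤ Λ := by
        push_cast
        calc ((r : ℝ) * t) ^ 2 ≤ (cK K * Y ^ n1 * (cK K * Y ^ n2)) ^ 2 := by gcongr
          _ = cK K ^ 4 * (Y ^ n1 * Y ^ n2) ^ 2 := by ring
          _ ≤ X ^ μ * (Y ^ n1 * Y ^ n2) ^ 2 := by gcongr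
          _ = X ^ (μ + (1 / 2 + 2 / 1400)) := by rw [hYK, hYKX, g.add]
          _ ≤ X ^ (1 / 2 + s) := g.mono (by linarith)
          _ ≤ _ := hΛ
      exact_mod_cast this
    · intro J0 hJ0 r hr s0 hs0 t1 ht1 t2 ht2
      have h3 := DJ_le hY0 hJ' hr
      have h4 := DJ_le hY0 (hJ0.trans hJ'') hs0
      have h5 := DJ_le hY0 (Finset.sdiff_subset.trans hJ'') ht1
      have h6 := DJ_le hY0 (Finset.sdiff_subset.trans hJ'') ht2
      rw [hJ'c] at h3
      have hcc : J0.card + (J'' \ J0).card = n2 := by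
        rw [Finset.card_sdiff_of_subset hJ0, hJ''c]
        have := Finset.card_le_card hJ0
        rw [hJ''c] at this; omega
      have : (((r * s0 * t1 * t2) ^ 2 : ℕ) : ℝ) ≤ Λ * (HH Y K Λ J'' J0 + 1) := by
        push_cast
        calc ((r : ℝ) * s0 * t1 * t2) ^ 2 ≤ (cK K * Y ^ n1 * (cK K * Y ^ J0.card) * (cK K * Y ^ (J'' \ J0).card) *
              (cK K * Y ^ (J'' \ J0).card)) ^ 2 := by gcongr
          _ = cK K ^ 8 * (Y ^ K * Y ^ (J'' \ J0).card) ^ 2 := by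
            rw [← hYK, ← hcc, pow_add]; ring
          _ = Λ * (cK K ^ 8 * (Y ^ K * Y ^ (J'' \ J0).card) ^ 2 / Λ) := by field_simp
          _ ≤ _ := by
            refine mul_le_mul_of_nonneg_left ?_ hΛp.le
            unfold HH
            exact (Nat.lt_floor_add_one _).le
      exact_mod_cast this
    · intro J0 hJ0 rt hrt ω hω
      exact g.hard_exp hs1' hs2 hB1 hΛ hJ' hJ'' hdis hun (by rw [hJ''c, hw]; linarith) ha haY h𝓤 hαβ hB hau hJ0 hrt hω
  have hst := hsd.step bv hbv
  rw [hJ'c, hJ''c, hYK] at hst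
  have c8 := g.cst (n := 8) (c := 1) (by norm_num) (by norm_num) (by norm_num)
  rw [one_mul] at c8
  have hsplit := EE_split g.hY2 (a := a) (𝓤 := 𝓤) (𝓥 := 𝓥) (au := au) (bv := bv) hJ'' hdis
      (fun t => EE_easy (K := K) g.hY2 ha haY hΛ0 h𝓤 hαβ hB hBp hV0 hV8 hVc hbv n1
        (by
          rw [hR2]
          refine le_trans (g.mono ?_) hB1
          linarith)
        (by
          calc cK K ^ 8 * (Y ^ (n1 + 1)) ^ 2 ≤ X ^ μ * (Y ^ (n1 + 1)) ^ 2 := by gcongr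
            _ = X ^ μ * ((Y ^ n1) ^ 2 * Y ^ 2) := by rw [pow_succ]; ring
            _ = X ^ (μ + (1 / 2 + 2 / 1400 - 2 * (κ * n2) + κ * (2 : ℕ))) := by rw [hR2, g.Yp 2, g.add, g.add]
            _ ≤ X ^ (1 / 2 + s) := g.mono (by push_cast; linarith)
            _ ≤ _ := hΛ) J' hJ' hJ'c
        (fun u => au u * (if Int.gcd u t = 1 then 1 else 0)) (fun u => by
          split_ifs
          · simpa using hau u
          · simp))
  rw [hun, hJ''c] at hsplit
  refine hsplit.trans ?_
  set St := (∑ r ∈ DJ Y J', ∑ s ∈ DJ Y J'', ‖∑ u ∈ 𝓤, ∑ v ∈ 𝓥, au u * bv v * tm a r s u v‖) with hSt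
  set W := Λ * B / Y ^ K with hW
  have hW0 : 0 ≤ W := by positivity
  have h2K : (1 : ℝ) ≤ 2 ^ K := one_le_pow₀ (by norm_num)
  have hKr : (1 : ℝ) ≤ K := by exact_mod_cast g.K1
  have hc : ∀ m : ℕ, m ≤ 20 + K → 18 * 2 ^ K * cK K ^ m * K ≤ X ^ μ := by
    intro m hm
    refine le_trans ?_ g.hcK
    have : cK K ^ m ≤ cK K ^ (20 + K) := pow_le_pow_right₀ hK1 hm
    calc 18 * 2 ^ K * cK K ^ m * K ≤ 1000000 * 2 ^ K * cK K ^ (20 + K) * K := by gcongr; norm_num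
      _ = _ := by ring
  have hStle : St ≤ W * X ^ (μ - ε / 20) := by
    refine abs_le_of_sq_le_sq' ?_ (mul_nonneg hW0 (g.pos _).le) |>.2
    refine hst.trans ?_
    rw [mul_pow, pw]
    have i1 : 1 / Y ≤ X ^ (-(ε / 10)) := by
      rw [g.hY, one_div, ← Real.rpow_neg hX0.le]
      exact g.mono (by linarith)
    have i2 : (Y ^ n1) ^ 2 * Y ^ n2 / B ≤ X ^ (-(ε / 10)) := by
      rw [div_le_iff₀ hBp]
      refine hR2S.trans ?_
      rw [mul_comm]
      exact mul_le_mul_of_nonneg_right (g.mono (by linarith)) hBp.le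
    calc 6 * 2 ^ K * cK K ^ 5 * W ^ 2 * (1 / Y + (Y ^ n1) ^ 2 * Y ^ n2 / B + X ^ (-(ε / 10)))
        ≤ 6 * 2 ^ K * cK K ^ 5 * W ^ 2 * (X ^ (-(ε / 10)) + X ^ (-(ε / 10)) + X ^ (-(ε / 10))) := by gcongr
      _ = W ^ 2 * ((18 * 2 ^ K * cK K ^ 5) * X ^ (-(ε / 10))) := by ring
      _ ≤ W ^ 2 * (X ^ μ * X ^ (-(ε / 10))) := by
        have h5 : 18 * 2 ^ K * cK K ^ 5 ≤ X ^ μ :=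
          le_trans (le_mul_of_one_le_right (by positivity) hKr) (hc 5 (by omega))
        have := g.pos (-(ε / 10))
        gcongr
      _ ≤ _ := by
        rw [g.add]
        refine mul_le_mul_of_nonneg_left (g.mono ?_) (by positivity)
        push_cast; linarith
  have hsq : Real.sqrt (1 / Y) ≤ X ^ (-(ε / 20)) := by
    apply Real.sqrt_le_iff.2
    refine ⟨(g.pos _).le, ?_⟩
    rw [pw, g.hY, one_div, ← Real.rpow_neg hX0.le]
    exact g.mono (by push_cast; linarith)
  have e2 : cK K / Y ^ n2 * (12 * 2 ^ K * cK K ^ 5 * (n1 * cK K ^ n1) * (Λ * B / Y ^ n1) * Real.sqrt (1 / Y)) ≤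
      W * X ^ (μ - ε / 20) := by
    have hn1K : (n1 : ℝ) ≤ K := by exact_mod_cast (show n1 ≤ K by omega)
    calc _ = (12 * 2 ^ K * cK K ^ (6 + n1) * n1) * (Λ * B / (Y ^ n1 * Y ^ n2)) * Real.sqrt (1 / Y) := by
          rw [pow_add]; field_simp
      _ ≤ (18 * 2 ^ K * cK K ^ (6 + n1) * K) * W * X ^ (-(ε / 20)) := by
          rw [hYK]; gcongr; norm_num
      _ ≤ X ^ μ * W * X ^ (-(ε / 20)) := by
          have := hc (6 + n1) (by omega)
          have := g.pos (-(ε / 20))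
          gcongr
      _ = W * (X ^ μ * X ^ (-(ε / 20))) := by ring
      _ = _ := by rw [g.add]; congr 2
  have c2 : (2 : ℝ) ≤ X ^ μ := by
    simpa using g.cst (n := 0) (c := 2) (by norm_num) (by norm_num) (by norm_num)
  calc _ ≤ W * X ^ (μ - ε / 20) + W * X ^ (μ - ε / 20) := add_le_add hStle e2
    _ = W * (2 * X ^ (μ - ε / 20)) := by ring
    _ ≤ W * (X ^ μ * X ^ (μ - ε / 20)) := by
      have := g.pos (μ - ε / 20)
      gcongr
    _ ≤ _ := by
      rw [g.add]
      refine mul_le_mul_of_nonneg_left (g.mono ?_) hW0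
      linarith
end

end

section

lemma prod_one_sub_ge {ι : Type*} (S : Finset ι) (x : ι → ℝ) (h0 : ∀ i ∈ S, 0 ≤ x i) (h1 : ∀ i ∈ S, x i ≤ 1) :
    1 - ∑ i ∈ S, x i ≤ ∏ i ∈ S, (1 - x i) := by
  induction S using Finset.induction_on with
  | empty => simp
  | insert i S hi ih =>
    rw [Finset.sum_insert hi, Finset.prod_insert hi]
    have i1 := ih (fun j hj => h0 j (Finset.mem_insert_of_mem hj)) (fun j hj => h1 j (Finset.mem_insert_of_mem hj))
    have a0 := h0 i (Finset.mem_insert_self _ _)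
    have a1 := h1 i (Finset.mem_insert_self _ _)
    have s0 : 0 ≤ ∑ j ∈ S, x j := Finset.sum_nonneg fun j hj => h0 j (Finset.mem_insert_of_mem hj)
    nlinarith

lemma DJ_pf_card {Y : ℝ} (hY : 0 < Y) {K d : ℕ} (h : d ∈ DJ Y (Finset.range K)) : d.primeFactors.card ≤ K := by
  obtain ⟨p, hp, rfl⟩ := (mem_DJ hY).1 h
  calc _ ≤ ((Finset.range K).image p).card := by
        refine Finset.card_le_card fun q hq => ?_
        have hq' := Nat.mem_primeFactors.1 hq
        obtain ⟨j, hj, hqj⟩ := (hq'.1.prime.dvd_finsetProd_iff _).1 hq'.2.1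
        have : q = p j := (Nat.prime_dvd_prime_iff_eq hq'.1 (hp j hj).1).1 hqj
        exact Finset.mem_image.2 ⟨j, hj, this.symm⟩
    _ ≤ _ := by simpa using Finset.card_image_le (s := Finset.range K) (f := p)

lemma tot_ge {Y : ℝ} (hY : 2 ≤ Y) {K d : ℕ} (h : d ∈ DJ Y (Finset.range K)) :
    (d : ℝ) ^ 2 * (1 - K / Y) ≤ ((d ^ 2).totient : ℝ) := by
  have hY0 : 0 < Y := by linarith
  have h1 := Nat.totient_eq_mul_prod_factors (d ^ 2)
  have h2 : ((d ^ 2).totient : ℝ) = (d : ℝ) ^ 2 * ∏ p ∈ (d ^ 2).primeFactors, (1 - (p : ℝ)⁻¹) := by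
    have := congrArg (fun x : ℚ => (x : ℝ)) h1
    push_cast at this
    exact this
  rw [h2, Nat.primeFactors_pow _ (by norm_num)]
  refine mul_le_mul_of_nonneg_left ?_ (by positivity)
  have hp : ∀ p ∈ d.primeFactors, Y ≤ p := fun p hp =>
    (DJ_prime_gt hY0 h (Nat.prime_of_mem_primeFactors hp) (Nat.dvd_of_mem_primeFactors hp)).le
  refine le_trans ?_ (prod_one_sub_ge _ (fun p : ℕ => (p : ℝ)⁻¹) (fun p _ => by positivity) (fun p h => ?_))
  · have : ∑ p ∈ d.primeFactors, (p : ℝ)⁻¹ ≤ K / Y := by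
      calc _ ≤ ∑ p ∈ d.primeFactors, Y⁻¹ := Finset.sum_le_sum fun p h => inv_anti₀ hY0 (hp p h)
        _ = d.primeFactors.card * Y⁻¹ := by rw [Finset.sum_const, nsmul_eq_mul]
        _ ≤ K * Y⁻¹ := by
          have := DJ_pf_card hY0 h
          gcongr
        _ = _ := by ring
    linarith
  · exact inv_le_one_of_one_le₀ (by linarith [hp p h])

lemma gcd_mul_int {d : ℕ} {u v : ℤ} : Int.gcd (u * v) d = 1 ↔ Int.gcd u d = 1 ∧ Int.gcd v d = 1 := by
  rw [← Int.isCoprime_iff_gcd_eq_one, ← Int.isCoprime_iff_gcd_eq_one, ← Int.isCoprime_iff_gcd_eq_one]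
  exact IsCoprime.mul_left_iff

lemma dv_cop {a : ℤ} {d : ℕ} (had : Int.gcd a d = 1) (u v : ℤ) :
    dv a d u v = (if Int.gcd u d = 1 then 1 else 0) * dv a d u v := by
  by_cases h : Int.gcd u (d : ℤ) = 1
  · rw [if_pos h, one_mul]
  · rw [if_neg h, zero_mul]
    unfold dv
    rw [if_neg]
    intro h2
    apply h
    rw [← Int.isCoprime_iff_gcd_eq_one] at had ⊢
    obtain ⟨k, hk⟩ := h2
    obtain ⟨x, y, hxy⟩ := had
    push_cast at hk
    refine ⟨x * v, y - x * d * k, ?_⟩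
    linear_combination hxy + x * hk

lemma emk_err {Y : ℝ} (hY : 2 ≤ Y) {K d : ℕ} (h : d ∈ DJ Y (Finset.range K)) (hKY : 2 * (K : ℝ) ≤ Y) {a : ℤ}
    (ha : a ≠ 0) (haY : |(a : ℝ)| ≤ Y) (u v : ℤ) :
    ‖(dv a d u v - 1 / ((d ^ 2).totient : ℂ) * (if Int.gcd (u * v) d = 1 then 1 else 0)) - emk a d u v‖ ≤
    1 / (d : ℝ) ^ 2 * (2 * K / Y + if Int.gcd v d = 1 then 0 else 1) := by
  have hY0 : 0 < Y := by linarith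
  have hd : (0 : ℝ) < d := by exact_mod_cast DJ_pos h
  unfold emk
  have e1 := dv_cop (DJ_cop_a hY0 h a ha haY) u v
  have e2 : dv a d u v - 1 / ((d ^ 2).totient : ℂ) * (if Int.gcd (u * v) d = 1 then 1 else 0) -
      (if Int.gcd u d = 1 then 1 else 0) * (dv a d u v - 1 / (d : ℂ) ^ 2) =
      (if Int.gcd u d = 1 then 1 else 0) * (1 / (d : ℂ) ^ 2) -
      1 / ((d ^ 2).totient : ℂ) * (if Int.gcd (u * v) d = 1 then 1 else 0) := by
    linear_combination e1
  rw [e2]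
  by_cases h1 : Int.gcd u (d : ℤ) = 1
  · by_cases h2 : Int.gcd v (d : ℤ) = 1
    · rw [if_pos h1, if_pos h2, if_pos (gcd_mul_int.2 ⟨h1, h2⟩)]
      have t1 := tot_ge hY h
      have t2 : ((d ^ 2).totient : ℝ) ≤ (d : ℝ) ^ 2 := by exact_mod_cast Nat.totient_le (d ^ 2)
      have hk : (K : ℝ) / Y ≤ 1 / 2 := by rw [div_le_div_iff₀ hY0 (by norm_num)]; linarith
      have hk0 : 0 ≤ (K : ℝ) / Y := by positivity
      set x := (K : ℝ) / Y with hx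
      set t := ((d ^ 2).totient : ℝ) with ht
      have hd2 : 0 < (d : ℝ) ^ 2 := by positivity
      have t0 : 0 < t := lt_of_lt_of_le (by nlinarith) t1
      have e3 : (1 * (1 / (d : ℂ) ^ 2) - 1 / ((d ^ 2).totient : ℂ) * 1) = ((1 / (d : ℝ) ^ 2 - 1 / t : ℝ) : ℂ) := by
        rw [ht]; push_cast; ring
      rw [e3, Complex.norm_real, Real.norm_eq_abs, abs_sub_comm, abs_of_nonneg]
      · have : 1 / t ≤ 1 / (d : ℝ) ^ 2 * (1 + 2 * x) := by
          rw [div_le_iff₀ t0]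
          have h5 : 1 / (d : ℝ) ^ 2 * (1 + 2 * x) * ((d : ℝ) ^ 2 * (1 - x)) = (1 + 2 * x) * (1 - x) := by field_simp
          have h6 : 1 / (d : ℝ) ^ 2 * (1 + 2 * x) * ((d : ℝ) ^ 2 * (1 - x)) ≤ 1 / (d : ℝ) ^ 2 * (1 + 2 * x) * t := by gcongr
          nlinarith
        rw [mul_div_assoc, ← hx]
        linarith
      · rw [sub_nonneg]
        exact one_div_le_one_div_of_le t0 t2
    · rw [if_pos h1, if_neg h2, if_neg (fun h => h2 (gcd_mul_int.1 h).2), mul_zero, sub_zero, one_mul, norm_div, norm_pow,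
        Complex.norm_natCast, norm_one]
      refine le_mul_of_one_le_right (by positivity) ?_
      have : 0 ≤ 2 * (K : ℝ) / Y := by positivity
      linarith
  · rw [if_neg h1, if_neg (fun h => h1 (gcd_mul_int.1 h).1), mul_zero, zero_mul, sub_zero, norm_zero]
    have : (0 : ℝ) ≤ if Int.gcd v (d : ℤ) = 1 then 0 else 1 := by split_ifs <;> norm_num
    positivity

lemma count_bad {Y : ℝ} (hY : 2 ≤ Y) {K d : ℕ} (h : d ∈ DJ Y (Finset.range K)) {𝓥 : Finset ℤ} {α β : ℤ}
    (h𝓥 : 𝓥 ⊆ Finset.Ico α β) {B : ℝ} (hB : (β : ℝ) - α ≤ B) (hB0 : 0 ≤ B) :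
    ∑ v ∈ 𝓥, (if Int.gcd v d = 1 then (0 : ℝ) else 1) ≤ K * (B / Y + 1) := by
  have hY0 : 0 < Y := by linarith
  have h1 : ∀ v ∈ 𝓥, (if Int.gcd v d = 1 then (0 : ℝ) else 1) ≤
      ∑ p ∈ d.primeFactors, if v ≡ 0 [ZMOD p] then (1 : ℝ) else 0 := by
    intro v _
    split_ifs with hg
    · exact Finset.sum_nonneg fun _ _ => by split_ifs <;> norm_num
    · obtain ⟨q, hq, hqg⟩ := Nat.exists_prime_and_dvd hg
      have hqd : q ∣ d := by
        have := (Int.natCast_dvd_natCast.2 hqg).trans (Int.gcd_dvd_right v d)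
        exact_mod_cast this
      have hqv : (q : ℤ) ∣ v := (Int.natCast_dvd_natCast.2 hqg).trans (Int.gcd_dvd_left v d)
      have hmem : q ∈ d.primeFactors := Nat.mem_primeFactors.2 ⟨hq, hqd, (DJ_pos h).ne'⟩
      calc (1 : ℝ) = if v ≡ 0 [ZMOD q] then (1 : ℝ) else 0 := by
            rw [if_pos (Int.modEq_zero_iff_dvd.2 hqv)]
        _ ≤ _ := Finset.single_le_sum (f := fun p : ℕ => if v ≡ 0 [ZMOD p] then (1 : ℝ) else 0)
            (fun _ _ => by split_ifs <;> norm_num) hmem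
  calc _ ≤ ∑ v ∈ 𝓥, ∑ p ∈ d.primeFactors, (if v ≡ 0 [ZMOD p] then (1 : ℝ) else 0) := Finset.sum_le_sum h1
    _ = ∑ p ∈ d.primeFactors, ∑ v ∈ 𝓥, (if v ≡ 0 [ZMOD p] then (1 : ℝ) else 0) := Finset.sum_comm
    _ ≤ ∑ p ∈ d.primeFactors, (B / Y + 1) := by
      refine Finset.sum_le_sum fun p hp => ?_
      rw [Finset.sum_boole]
      have hpp := Nat.prime_of_mem_primeFactors hp
      have hpY := (DJ_prime_gt hY0 h hpp (Nat.dvd_of_mem_primeFactors hp)).le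
      calc _ ≤ (((Finset.Ico α β).filter (fun u => u ≡ 0 [ZMOD p])).card : ℝ) := by
            exact_mod_cast Finset.card_le_card (Finset.filter_subset_filter _ h𝓥)
        _ ≤ B / p + 1 := card_modEq_le p hpp.pos α β 0 B hB0 hB
        _ ≤ _ := by gcongr
    _ = d.primeFactors.card * (B / Y + 1) := by rw [Finset.sum_const, nsmul_eq_mul]
    _ ≤ _ := by
      have := DJ_pf_card hY0 h
      gcongr

lemma emk_triv {d : ℕ} (hd : 0 < d) (a u : ℤ) {𝓥 : Finset ℤ} {α β : ℤ}
    (h𝓥 : 𝓥 ⊆ Finset.Ico α β) (hαβ : α ≤ β) {B : ℝ} (hB : (β : ℝ) - α ≤ B) (hB0 : 0 ≤ B) :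
    ∑ v ∈ 𝓥, ‖emk a d u v‖ ≤ 2 * B / (d : ℝ) ^ 2 + 1 := by
  have hd' : (0 : ℝ) < d := by exact_mod_cast hd
  by_cases hu : Int.gcd u (d : ℤ) = 1
  · have h1 : ∀ v ∈ 𝓥, ‖emk a d u v‖ ≤ (if v ≡ iv (d ^ 2) u * a [ZMOD (d ^ 2 : ℕ)] then (1 : ℝ) else 0) + 1 / (d : ℝ) ^ 2 := by
      intro v _
      unfold emk
      rw [if_pos hu, one_mul]
      refine (norm_sub_le _ _).trans ?_
      rw [norm_div, norm_pow, Complex.norm_natCast, norm_one]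
      refine add_le_add ?_ le_rfl
      rw [dv_eq]
      split_ifs with h2 h3 h3
      · simp
      · exfalso
        apply h3
        have hi := iv_spec (gcd_sq_one hu)
        refine cancel_unit (gcd_sq_one hu) (h2.trans ?_)
        have := (hi.mul_right a).symm
        rw [one_mul, mul_assoc] at this
        exact this
      · simp
      · simp
    calc _ ≤ _ := Finset.sum_le_sum h1
      _ = ((𝓥.filter (fun v => v ≡ iv (d ^ 2) u * a [ZMOD (d ^ 2 : ℕ)])).card : ℝ) + 𝓥.card * (1 / (d : ℝ) ^ 2) := by
        rw [Finset.sum_add_distrib, Finset.sum_boole, Finset.sum_const, nsmul_eq_mul]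
      _ ≤ (B / (d ^ 2 : ℕ) + 1) + B * (1 / (d : ℝ) ^ 2) := by
        refine add_le_add ?_ ?_
        · refine le_trans ?_ (card_modEq_le (d ^ 2) (by positivity) α β (iv (d ^ 2) u * a) B hB0 hB)
          exact_mod_cast Finset.card_le_card (Finset.filter_subset_filter _ h𝓥)
        · have := card_U_le h𝓥 hαβ hB
          gcongr
      _ = _ := by push_cast; ring
  · rw [Finset.sum_eq_zero]
    · positivity
    · intro v _
      unfold emk
      rw [if_neg hu]; simp

end

section

lemma Ioc_cover {U : ℝ} (hU : 2 ≤ U) {𝓤 : Finset ℤ} (h : ∀ u ∈ 𝓤, U < (u : ℝ) ∧ (u : ℝ) ≤ 2 * U) :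
    𝓤 ⊆ Finset.Ico ⌊U⌋ (⌊2 * U⌋ + 1) ∧ ⌊U⌋ ≤ ⌊2 * U⌋ + 1 ∧ (((⌊2 * U⌋ + 1 : ℤ)) : ℝ) - (⌊U⌋ : ℤ) ≤ 2 * U := by
  refine ⟨fun u hu => ?_, ?_, ?_⟩
  · obtain ⟨h1, h2⟩ := h u hu
    rw [Finset.mem_Ico]
    constructor
    · have : (⌊U⌋ : ℝ) ≤ U := Int.floor_le U
      have : (⌊U⌋ : ℝ) ≤ u := by linarith
      exact_mod_cast this
    · exact Int.lt_add_one_iff.2 (Int.le_floor.2 h2)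
  · have : ⌊U⌋ ≤ ⌊2 * U⌋ := Int.floor_le_floor (by linarith)
    omega
  · push_cast
    have h1 := Int.floor_le (2 * U)
    have h2 := Int.lt_floor_add_one U
    linarith

section
variable {ε σ X κ μ Y : ℝ} {K : ℕ}

set_option maxHeartbeats 2000000 in
lemma GP.final (g : GP ε σ X κ μ Y K) {s : ℝ} (hs1 : 2 * varpi + ε ≤ s) (hs2 : s ≤ σ) {U V : ℝ}
    (hU : U = X ^ (1 / 2 - s)) (hV : V = X ^ (1 / 2 + s))
    {a : ℤ} (ha : a ≠ 0) (haY : |(a : ℝ)| ≤ Y) (hKY : 2 * (K : ℝ) ≤ Y) {ψ : ℝ → ℝ} (hψ : ∀ x, 0 ≤ ψ x ∧ ψ x ≤ 1)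
    {Lp : ℝ} (hLp0 : 0 ≤ Lp) (hLp : ∀ x y, |ψ x - ψ y| ≤ Lp * |x - y|) (hLpX : Lp ≤ X ^ μ)
    {𝓤 𝓥 : Finset ℤ} (h𝓤 : ∀ u ∈ 𝓤, U < (u : ℝ) ∧ (u : ℝ) ≤ 2 * U) (h𝓥 : ∀ v ∈ 𝓥, V < (v : ℝ) ∧ (v : ℝ) ≤ 2 * V)
    {au bv : ℤ → ℂ} (hau : ∀ u, ‖au u‖ ≤ 1) (hbv : ∀ v, ‖bv v‖ ≤ 1) :
    ∑ d ∈ DJ Y (Finset.range K), ‖∑ u ∈ 𝓤, ∑ v ∈ 𝓥, au u * bv v * (ψ ((u : ℝ) * v / X) : ℂ) *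
      (dv a d u v - 1 / ((d ^ 2).totient : ℂ) * (if Int.gcd (u * v) d = 1 then 1 else 0))‖ ≤
    X / Y ^ K * X ^ (-(ε / 50) + 4 * μ) := by
  have hY0 : 0 < Y := by linarith [g.hY2]
  have hY1 : 1 ≤ Y := by linarith [g.hY2]
  have hX0 : 0 < X := by linarith [g.hX]
  have hK1 := cK_one K
  have hw : varpi = 1 / 1400 := rfl
  have hε := g.hε
  have hμ := g.hμ
  have hσ := g.hσ
  have hσε := g.hσε
  have hκ1 := g.hκ1
  have hκ2 := g.hκ2
  have hKκ := g.hκ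
  have hs1' := hs1
  rw [hw] at hs1 hσ hσε hκ1 hKκ
  have hμ0 : 0 < μ := by rw [hμ]; positivity
  have pw : ∀ (x : ℝ) (k : ℕ), (X ^ x) ^ k = X ^ (x * k) := fun x k => by
    rw [Real.rpow_mul_natCast hX0.le]
  have hbig : (1000000 : ℝ) ≤ X ^ μ := by
    simpa using g.cst (n := 0) (c := 1000000) (by norm_num) (by norm_num) (by norm_num)
  have hU2 : 2 ≤ U := by
    rw [hU]; refine le_trans (by linarith) (g.mono (show μ ≤ 1 / 2 - s by linarith))
  have hV2 : 2 ≤ V := by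
    rw [hV]; refine le_trans (by linarith) (g.mono (show μ ≤ 1 / 2 + s by linarith))
  have hU0 : 0 < U := by linarith
  have hV0 : 0 < V := by linarith
  have hUV : U * V = X := by
    rw [hU, hV, g.add]
    have : (1 / 2 - s + (1 / 2 + s)) = 1 := by ring
    rw [this, Real.rpow_one]
  obtain ⟨hu1, hu2, hu3⟩ := Ioc_cover hU2 h𝓤
  obtain ⟨hv1, hv2, hv3⟩ := Ioc_cover hV2 h𝓥
  have hUc := card_U_le hu1 hu2 hu3
  have hVc := card_U_le hv1 hv2 hv3
  set J := Finset.range K with hJ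
  have hDc : ((DJ Y J).card : ℝ) ≤ cK K * Y ^ K := by
    simpa [hJ] using DJ_card hY0 (Finset.Subset.refl J)
  have hDge : ∀ d ∈ DJ Y J, Y ^ K ≤ d := fun d hd => by simpa [hJ] using DJ_ge hY0 hd
  set Z := Y ^ K with hZ
  have hZ1 : 1 ≤ Z := one_le_pow₀ hY1
  have hZ0 : 0 < Z := by linarith
  have hZX : Z ^ 2 = X ^ (1 / 2 + 2 / 1400 : ℝ) := by
    rw [hZ, g.Yp, pw]; congr 1; rw [mul_comm κ, hKκ]; norm_num
  have hZV : Z ^ 2 ≤ V := by rw [hZX, hV]; exact g.mono (by linarith)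
  have hYV : Y ≤ V := by
    rw [g.hY, hV]; exact g.mono (by nlinarith)
  -- subdivisions
  set M := ⌈X ^ (ε / 50)⌉₊ with hM
  have hM1 : X ^ (ε / 50) ≤ M := Nat.le_ceil _
  have hMp : (0 : ℝ) < M := lt_of_lt_of_le (g.pos _) hM1
  have hXε1 : 1 ≤ X ^ (ε / 50) := by
    rw [← Real.rpow_zero X]; exact g.mono (by positivity)
  have hM2 : (M : ℝ) + 1 ≤ 3 * X ^ (ε / 50) := by
    have := Nat.ceil_lt_add_one (g.pos (ε / 50)).le
    rw [← hM] at this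
    linarith
  set idx : ℤ → ℕ := fun u => ⌊((u : ℝ) - U) * M / U⌋₊ with hidx
  set Ui : ℕ → ℝ := fun i => U * (1 + i / M) with hUi
  have hidxM : ∀ u ∈ 𝓤, idx u ∈ Finset.range (M + 1) := by
    intro u hu
    rw [Finset.mem_range, Nat.lt_add_one_iff]
    refine Nat.floor_le_of_le ?_
    rw [div_le_iff₀ hU0]
    nlinarith [(h𝓤 u hu).2]
  have happ : ∀ u ∈ 𝓤, ∀ v ∈ 𝓥, |ψ ((u : ℝ) * v / X) - ψ (Ui (idx u) * v / X)| ≤ 2 * Lp / M := by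
    intro u hu v hv
    refine (hLp _ _).trans ?_
    have h1 : |(u : ℝ) - Ui (idx u)| ≤ U / M := by
      have hn : 0 ≤ ((u : ℝ) - U) * M / U := div_nonneg (mul_nonneg (by linarith [(h𝓤 u hu).1]) hMp.le) hU0.le
      have h2 := Nat.floor_le hn
      have h3 := Nat.lt_floor_add_one (((u : ℝ) - U) * M / U)
      have h4 : ((u : ℝ) - U) = (((u : ℝ) - U) * M / U) * (U / M) := by field_simp
      have hUM : 0 < U / M := by positivity
      have h5 : (u : ℝ) - Ui (idx u) = ((((u : ℝ) - U) * M / U) - idx u) * (U / M) := by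
        rw [sub_mul, ← h4, hUi]; ring
      rw [h5, abs_mul, abs_of_pos hUM]
      refine mul_le_of_le_one_left hUM.le ?_
      rw [abs_le]
      constructor <;> simp only [hidx] <;> linarith
    have hvp : (0 : ℝ) < v := by linarith [(h𝓥 v hv).1]
    have e : (u : ℝ) * v / X - Ui (idx u) * v / X = ((u : ℝ) - Ui (idx u)) * (v / X) := by ring
    rw [e, abs_mul, abs_of_pos (div_pos hvp hX0)]
    calc Lp * (|(u : ℝ) - Ui (idx u)| * (v / X)) ≤ Lp * (U / M * (2 * V / X)) := by
          have := (h𝓥 v hv).2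
          gcongr
      _ = 2 * Lp / M * (U * V / X) := by ring
      _ = _ := by rw [hUV, div_self hX0.ne', mul_one]
  -- three parts
  set F1 : ℕ → ℂ := fun d => ∑ u ∈ 𝓤, ∑ v ∈ 𝓥, au u * bv v * (ψ ((u : ℝ) * v / X) : ℂ) *
    ((dv a d u v - 1 / ((d ^ 2).totient : ℂ) * (if Int.gcd (u * v) d = 1 then 1 else 0)) - emk a d u v) with hF1
  set F2 : ℕ → ℂ := fun d => ∑ u ∈ 𝓤, ∑ v ∈ 𝓥, au u * bv v * ((ψ ((u : ℝ) * v / X) : ℂ) - (ψ (Ui (idx u) * v / X) : ℂ)) *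
    emk a d u v with hF2
  set F3 : ℕ → ℕ → ℂ := fun d i => ∑ u ∈ 𝓤.filter (fun u => idx u = i), ∑ v ∈ 𝓥,
    au u * (bv v * (ψ (Ui i * v / X) : ℂ)) * emk a d u v with hF3
  have hdec : ∀ d, ∑ u ∈ 𝓤, ∑ v ∈ 𝓥, au u * bv v * (ψ ((u : ℝ) * v / X) : ℂ) *
      (dv a d u v - 1 / ((d ^ 2).totient : ℂ) * (if Int.gcd (u * v) d = 1 then 1 else 0)) =
      F1 d + F2 d + ∑ i ∈ Finset.range (M + 1), F3 d i := by
    intro d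
    have e3 : ∑ i ∈ Finset.range (M + 1), F3 d i = ∑ u ∈ 𝓤, ∑ v ∈ 𝓥,
        au u * (bv v * (ψ (Ui (idx u) * v / X) : ℂ)) * emk a d u v := by
      rw [← Finset.sum_fiberwise_of_maps_to hidxM]
      refine Finset.sum_congr rfl fun i _ => Finset.sum_congr rfl fun u hu => ?_
      rw [(Finset.mem_filter.1 hu).2]
    rw [e3, hF1, hF2, ← Finset.sum_add_distrib, ← Finset.sum_add_distrib]
    refine Finset.sum_congr rfl fun u _ => ?_
    rw [← Finset.sum_add_distrib, ← Finset.sum_add_distrib]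
    refine Finset.sum_congr rfl fun v _ => ?_
    ring
  have hψn : ∀ x, ‖(ψ x : ℂ)‖ ≤ 1 := fun x => by
    rw [Complex.norm_real, Real.norm_eq_abs, abs_of_nonneg (hψ x).1]; exact (hψ x).2
  have hab : ∀ u v, ‖au u * bv v‖ ≤ 1 := fun u v => by
    rw [norm_mul]; exact mul_le_one₀ (hau u) (norm_nonneg _) (hbv v)
  -- part 1
  have hP1 : ∑ d ∈ DJ Y J, ‖F1 d‖ ≤ X / Z * X ^ (-(ε / 50) + 3 * μ) := by
    have h1 : ∀ d ∈ DJ Y J, ‖F1 d‖ ≤ 1 / Z ^ 2 * (2 * U * (8 * K * V / Y)) := by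
      intro d hd
      have hZd := hDge d hd
      calc ‖F1 d‖ ≤ ∑ u ∈ 𝓤, ∑ v ∈ 𝓥, 1 / (d : ℝ) ^ 2 * (2 * K / Y + if Int.gcd v d = 1 then 0 else 1) := by
            refine (norm_sum_le _ _).trans (Finset.sum_le_sum fun u _ => ?_)
            refine (norm_sum_le _ _).trans (Finset.sum_le_sum fun v _ => ?_)
            rw [norm_mul]
            refine le_trans (mul_le_of_le_one_left (norm_nonneg _) ?_) (emk_err g.hY2 hd hKY ha haY u v)
            rw [norm_mul]
            exact mul_le_one₀ (hab u v) (norm_nonneg _) (hψn _)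
        _ = 𝓤.card * (1 / (d : ℝ) ^ 2 * (𝓥.card * (2 * K / Y) + ∑ v ∈ 𝓥, if Int.gcd v d = 1 then (0 : ℝ) else 1)) := by
            rw [Finset.sum_const, nsmul_eq_mul, ← Finset.mul_sum, Finset.sum_add_distrib, Finset.sum_const, nsmul_eq_mul]
        _ ≤ (2 * U) * (1 / Z ^ 2 * ((2 * V) * (2 * K / Y) + K * (2 * V / Y + 1))) := by
            have h5 := count_bad g.hY2 hd hv1 hv3 (by linarith)
            have h6 : 0 ≤ ∑ v ∈ 𝓥, if Int.gcd v d = 1 then (0 : ℝ) else 1 :=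
              Finset.sum_nonneg fun _ _ => by split_ifs <;> norm_num
            gcongr
        _ ≤ (2 * U) * (1 / Z ^ 2 * ((2 * V) * (2 * K / Y) + K * (2 * V / Y + 2 * V / Y))) := by
            have : 1 ≤ 2 * V / Y := by rw [le_div_iff₀ hY0]; linarith
            gcongr
        _ = _ := by ring
    calc _ ≤ ∑ d ∈ DJ Y J, 1 / Z ^ 2 * (2 * U * (8 * K * V / Y)) := Finset.sum_le_sum h1
      _ = (DJ Y J).card * (1 / Z ^ 2 * (2 * U * (8 * K * V / Y))) := by rw [Finset.sum_const, nsmul_eq_mul]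
      _ ≤ (cK K * Z) * (1 / Z ^ 2 * (2 * U * (8 * K * V / Y))) := by gcongr
      _ = (U * V) / Z * ((16 * cK K * K) * (1 / Y)) := by field_simp; ring
      _ ≤ X / Z * (X ^ μ * X ^ (-κ)) := by
          rw [hUV]
          have e : 1 / Y = X ^ (-κ) := by rw [g.hY, Real.rpow_neg hX0.le, one_div]
          rw [e]
          have h7 : 16 * cK K * K ≤ X ^ μ := by
            refine le_trans ?_ g.hcK
            have q1 : cK K ≤ cK K ^ (20 + K) := le_self_pow₀ hK1 (by omega)
            have q2 : (1 : ℝ) ≤ 2 ^ K := one_le_pow₀ (by norm_num)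
            calc 16 * cK K * K ≤ 1000000 * cK K ^ (20 + K) * K := by gcongr; norm_num
              _ = 1000000 * (cK K ^ (20 + K) * 1 * K) := by ring
              _ ≤ _ := by gcongr
          have := g.pos (-κ)
          gcongr
      _ ≤ _ := by
          rw [g.add]
          refine mul_le_mul_of_nonneg_left (g.mono ?_) (by positivity)
          linarith
  -- part 2
  have hP2 : ∑ d ∈ DJ Y J, ‖F2 d‖ ≤ X / Z * X ^ (-(ε / 50) + 3 * μ) := by
    have h1 : ∀ d ∈ DJ Y J, ‖F2 d‖ ≤ 2 * Lp / M * ((2 * U) * (5 * V / Z ^ 2)) := by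
      intro d hd
      have hZd := hDge d hd
      calc ‖F2 d‖ ≤ ∑ u ∈ 𝓤, ∑ v ∈ 𝓥, 2 * Lp / M * ‖emk a d u v‖ := by
            refine (norm_sum_le _ _).trans (Finset.sum_le_sum fun u hu => ?_)
            refine (norm_sum_le _ _).trans (Finset.sum_le_sum fun v hv => ?_)
            rw [norm_mul, norm_mul]
            refine mul_le_mul_of_nonneg_right ?_ (norm_nonneg _)
            refine le_trans (mul_le_of_le_one_left (norm_nonneg _) (hab u v)) ?_
            rw [← Complex.ofReal_sub, Complex.norm_real, Real.norm_eq_abs]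
            exact happ u hu v hv
        _ ≤ ∑ u ∈ 𝓤, 2 * Lp / M * (2 * (2 * V) / (d : ℝ) ^ 2 + 1) := by
            refine Finset.sum_le_sum fun u _ => ?_
            rw [← Finset.mul_sum]
            exact mul_le_mul_of_nonneg_left (emk_triv (DJ_pos hd) a u hv1 hv2 hv3 (by linarith)) (by positivity)
        _ = 𝓤.card * (2 * Lp / M * (2 * (2 * V) / (d : ℝ) ^ 2 + 1)) := by rw [Finset.sum_const, nsmul_eq_mul]
        _ ≤ (2 * U) * (2 * Lp / M * (2 * (2 * V) / Z ^ 2 + V / Z ^ 2)) := by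
            have : 1 ≤ V / Z ^ 2 := by rw [le_div_iff₀ (by positivity)]; linarith
            gcongr
        _ = _ := by ring
    calc _ ≤ ∑ d ∈ DJ Y J, 2 * Lp / M * ((2 * U) * (5 * V / Z ^ 2)) := Finset.sum_le_sum h1
      _ = (DJ Y J).card * (2 * Lp / M * ((2 * U) * (5 * V / Z ^ 2))) := by rw [Finset.sum_const, nsmul_eq_mul]
      _ ≤ (cK K * Z) * (2 * Lp / M * ((2 * U) * (5 * V / Z ^ 2))) := by gcongr
      _ = (U * V) / Z * ((20 * cK K ^ 1) * Lp * (1 / M)) := by field_simp; ring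
      _ ≤ X / Z * (X ^ μ * X ^ μ * (1 / X ^ (ε / 50))) := by
          rw [hUV]
          have h7 := g.cst (n := 1) (c := 20) (by norm_num) (by norm_num) (by norm_num)
          have := g.pos (ε / 50)
          gcongr
      _ ≤ _ := by
          rw [one_div, ← Real.rpow_neg hX0.le, g.add, g.add]
          refine mul_le_mul_of_nonneg_left (g.mono ?_) (by positivity)
          linarith
  -- part 3
  have hP3 : ∑ d ∈ DJ Y J, ‖∑ i ∈ Finset.range (M + 1), F3 d i‖ ≤ X / Z * X ^ (-(ε / 50) + 3 * μ) := by
    set Λ := ⌈8 * V + 8⌉₊ with hΛ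
    have hΛ1 : 8 * V + 8 ≤ Λ := Nat.le_ceil _
    have hΛ2 : (Λ : ℝ) ≤ 17 * V := by
      have := Nat.ceil_lt_add_one (show 0 ≤ 8 * V + 8 by linarith)
      rw [← hΛ] at this
      linarith
    have h1 : ∀ i ∈ Finset.range (M + 1), ∑ d ∈ DJ Y J, ‖F3 d i‖ ≤ Λ * (2 * U) / Z * X ^ (-(ε / 25)) := by
      intro i _
      refine g.hard hs1' hs2 (B := 2 * U) (by rw [← hU]; linarith) (Λ := Λ) (by rw [← hV]; linarith) ha haY (v0 := ⌊V⌋)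
        (𝓤 := 𝓤.filter (fun u => idx u = i)) (𝓥 := 𝓥) ((Finset.filter_subset _ _).trans hu1) hu2 hu3 ?_ ?_ (by linarith) hau
        (bv := fun v => bv v * (ψ (Ui i * v / X) : ℂ)) ?_
      · intro v hv
        have : (0 : ℝ) ≤ v := by linarith [(h𝓥 v hv).1]
        exact_mod_cast this
      · intro v hv
        have h2 := h𝓥 v hv
        have h3 := Int.floor_le V
        have h4 := Int.lt_floor_add_one V
        rw [abs_of_nonneg (by linarith)]
        linarith
      · intro v
        rw [norm_mul]
        exact mul_le_one₀ (hbv v) (norm_nonneg _) (hψn _)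
    calc _ ≤ ∑ d ∈ DJ Y J, ∑ i ∈ Finset.range (M + 1), ‖F3 d i‖ := Finset.sum_le_sum fun d _ => norm_sum_le _ _
      _ = ∑ i ∈ Finset.range (M + 1), ∑ d ∈ DJ Y J, ‖F3 d i‖ := Finset.sum_comm
      _ ≤ ∑ i ∈ Finset.range (M + 1), (Λ : ℝ) * (2 * U) / Z * X ^ (-(ε / 25)) := Finset.sum_le_sum h1
      _ = ((M : ℝ) + 1) * (Λ * (2 * U) / Z * X ^ (-(ε / 25))) := by
          rw [Finset.sum_const, nsmul_eq_mul, Finset.card_range]; push_cast; ring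
      _ ≤ (3 * X ^ (ε / 50)) * ((17 * V) * (2 * U) / Z * X ^ (-(ε / 25))) := by
          have := g.pos (-(ε / 25))
          gcongr
      _ = (U * V) / Z * (102 * (X ^ (ε / 50) * X ^ (-(ε / 25)))) := by ring
      _ ≤ X / Z * (X ^ μ * (X ^ (ε / 50) * X ^ (-(ε / 25)))) := by
          rw [hUV]
          have := g.pos (-(ε / 25))
          have := g.pos (ε / 50)
          have : (102 : ℝ) ≤ X ^ μ := by linarith
          gcongr
      _ ≤ _ := by
          rw [g.add, g.add]
          refine mul_le_mul_of_nonneg_left (g.mono ?_) (by positivity)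
          linarith
  calc _ ≤ ∑ d ∈ DJ Y J, (‖F1 d‖ + ‖F2 d‖ + ‖∑ i ∈ Finset.range (M + 1), F3 d i‖) := by
        refine Finset.sum_le_sum fun d _ => ?_
        rw [hdec]
        exact norm_add₃_le
    _ ≤ X / Z * (3 * X ^ (-(ε / 50) + 3 * μ)) := by
        rw [Finset.sum_add_distrib, Finset.sum_add_distrib]
        linarith
    _ ≤ X / Z * (X ^ μ * X ^ (-(ε / 50) + 3 * μ)) := by
        have := g.pos (-(ε / 50) + 3 * μ)
        have : (3 : ℝ) ≤ X ^ μ := by linarith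
        gcongr
    _ = _ := by
        rw [g.add]; congr 2; ring
end

end

section

lemma psi_lip {ψ : ℝ → ℝ} (hψsmooth : ContDiff ℝ (⊤ : ℕ∞) ψ)
    (hψsupp : ∀ x, x ∉ Set.Icc (1 : ℝ) 2 → ψ x = 0) :
    ∃ Lp : ℝ, 0 ≤ Lp ∧ ∀ x y, |ψ x - ψ y| ≤ Lp * |x - y| := by
  have hc : HasCompactSupport ψ := HasCompactSupport.intro isCompact_Icc hψsupp
  obtain ⟨L, hL⟩ := ContDiff.lipschitzWith_of_hasCompactSupport hc hψsmooth (by simp)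
  refine ⟨L, L.2, fun x y => ?_⟩
  have := hL.dist_le_mul x y
  simpa [Real.dist_eq] using this

lemma ev_ge {r : ℝ} (hr : 0 < r) (c : ℝ) : ∀ᶠ X : ℝ in Filter.atTop, c ≤ X ^ r :=
  (tendsto_rpow_atTop hr).eventually_ge_atTop c

lemma ev_tau {C μ : ℝ} (hC : 0 < C) (hμ : 0 < μ) : ∀ᶠ X : ℝ in Filter.atTop,
    ∀ n : ℕ, 0 < n → (n : ℝ) ≤ X ^ (2 : ℝ) → (n.divisors.card : ℝ) ^ C ≤ X ^ μ := by
  obtain ⟨C1, h1, hb⟩ := tau_bound (μ / (4 * C)) (by positivity)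
  filter_upwards [ev_ge (show 0 < μ / 2 by positivity) (C1 ^ C), Filter.eventually_ge_atTop 1] with X hX hX1 n hn hnX
  have hX0 : 0 ≤ X := by linarith
  have hC1 : 0 ≤ C1 := by linarith
  have h2 : (n.divisors.card : ℝ) ≤ C1 * X ^ (μ / (2 * C)) := by
    refine (hb n hn.ne').trans ?_
    refine mul_le_mul_of_nonneg_left ?_ hC1
    refine (Real.rpow_le_rpow (by positivity) hnX (by positivity)).trans ?_
    rw [← Real.rpow_mul hX0]
    apply le_of_eq; congr 1; field_simp; ring
  refine (Real.rpow_le_rpow (by positivity) h2 hC.le).trans ?_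
  rw [Real.mul_rpow hC1 (by positivity), ← Real.rpow_mul hX0]
  have e : μ / (2 * C) * C = μ / 2 := by field_simp
  rw [e]
  calc C1 ^ C * X ^ (μ / 2) ≤ X ^ (μ / 2) * X ^ (μ / 2) := by gcongr
    _ = X ^ μ := by rw [← Real.rpow_add (by linarith)]; congr 1; ring

lemma ev_log {μ : ℝ} (hμ : 0 < μ) : ∀ᶠ X : ℝ in Filter.atTop,
    1 + Real.log (X ^ (2 : ℝ)) ≤ X ^ μ := by
  have h := (isLittleO_log_rpow_atTop hμ).bound (show (0 : ℝ) < 1 / 4 by norm_num)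
  filter_upwards [h, ev_ge hμ 2, Filter.eventually_ge_atTop 1] with X h1 h2 h3
  have h4 : 0 ≤ Real.log X := Real.log_nonneg h3
  rw [Real.log_rpow (by linarith)]
  rw [Real.norm_of_nonneg h4, Real.norm_of_nonneg (by positivity)] at h1
  linarith

lemma frakD_eq {ε X Y : ℝ} (hY : bigP ε X ^ ((1 : ℝ) / 2) = Y) (hY0 : 0 < Y) :
    frakD ε X = ↑(DJ Y (Finset.range (bigK ε))) := by
  ext d
  rw [Finset.mem_coe, mem_DJ hY0]
  unfold frakD
  rw [hY]
  constructor
  · rintro ⟨p, hp, rfl⟩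
    refine ⟨fun j => if h : j < bigK ε then p ⟨j, h⟩ else 0, ?_, ?_⟩
    · intro j hj
      have hj' := Finset.mem_range.1 hj
      simp only [hj', dif_pos]
      exact hp ⟨j, hj'⟩
    · rw [Finset.prod_range]
      refine Finset.prod_congr rfl fun j _ => ?_
      simp
  · rintro ⟨p, hp, rfl⟩
    refine ⟨fun j => p j, fun j => hp j (Finset.mem_range.2 j.2), ?_⟩
    rw [Finset.prod_range]

lemma mem_dy {U : ℝ} (hU : 0 ≤ U) (u : ℕ) :
    u ∈ Finset.Ioc ⌊U⌋₊ ⌊2 * U⌋₊ ↔ U < (u : ℝ) ∧ (u : ℝ) ≤ 2 * U := by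
  rw [Finset.mem_Ioc, Nat.floor_lt hU, Nat.le_floor_iff (by linarith)]

lemma tsum_dy {U V : ℝ} (hU : 0 ≤ U) (hV : 0 ≤ V) (P : ℕ → ℕ → Prop) [∀ u v, Decidable (P u v)] (f : ℕ → ℕ → ℂ) :
    (∑' u : ℕ, ∑' v : ℕ, if U < (u : ℝ) ∧ (u : ℝ) ≤ 2 * U ∧ V < (v : ℝ) ∧ (v : ℝ) ≤ 2 * V ∧ P u v
      then f u v else 0) =
    ∑ u ∈ Finset.Ioc ⌊U⌋₊ ⌊2 * U⌋₊, ∑ v ∈ Finset.Ioc ⌊V⌋₊ ⌊2 * V⌋₊, if P u v then f u v else 0 := by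
  rw [tsum_eq_sum (s := Finset.Ioc ⌊U⌋₊ ⌊2 * U⌋₊)]
  · refine Finset.sum_congr rfl fun u hu => ?_
    rw [mem_dy hU] at hu
    rw [tsum_eq_sum (s := Finset.Ioc ⌊V⌋₊ ⌊2 * V⌋₊)]
    · refine Finset.sum_congr rfl fun v hv => ?_
      rw [mem_dy hV] at hv
      simp [hu, hv]
    · intro v hv
      rw [mem_dy hV] at hv
      rw [if_neg]
      tauto
  · intro u hu
    rw [mem_dy hU] at hu
    have : ∀ v : ℕ, (if U < (u : ℝ) ∧ (u : ℝ) ≤ 2 * U ∧ V < (v : ℝ) ∧ (v : ℝ) ≤ 2 * V ∧ P u v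
      then f u v else 0) = 0 := fun v => if_neg (by tauto)
    simp [this]

lemma nat_to_int_sum {U V X M : ℝ} (hU : 0 ≤ U) (hV : 0 ≤ V) (hM : 0 < M) (a : ℤ) (d : ℕ)
    (ψ : ℝ → ℝ) (au bv : ℕ → ℂ) :
    ((∑' u : ℕ, ∑' v : ℕ,
              if U < (u : ℝ) ∧ (u : ℝ) ≤ 2 * U ∧ V < (v : ℝ) ∧ (v : ℝ) ≤ 2 * V ∧
                  ((d : ℤ) ^ 2 ∣ ((u * v : ℕ) : ℤ) - a)
                then au u * bv v * (ψ (((u * v : ℕ) : ℝ) / X) : ℂ) else 0) -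
            (1 / (Nat.totient (d ^ 2) : ℝ) : ℂ) *
              ∑' u : ℕ, ∑' v : ℕ,
                if U < (u : ℝ) ∧ (u : ℝ) ≤ 2 * U ∧ V < (v : ℝ) ∧ (v : ℝ) ≤ 2 * V ∧
                    Nat.gcd (u * v) (d ^ 2) = 1
                  then au u * bv v * (ψ (((u * v : ℕ) : ℝ) / X) : ℂ) else 0) =
    ((M * M : ℝ) : ℂ) * ∑ u ∈ (Finset.Ioc ⌊U⌋₊ ⌊2 * U⌋₊).map Nat.castEmbedding,
      ∑ v ∈ (Finset.Ioc ⌊V⌋₊ ⌊2 * V⌋₊).map Nat.castEmbedding,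
      (if u ∈ (Finset.Ioc ⌊U⌋₊ ⌊2 * U⌋₊).map Nat.castEmbedding then au u.toNat / (M : ℂ) else 0) *
      (if v ∈ (Finset.Ioc ⌊V⌋₊ ⌊2 * V⌋₊).map Nat.castEmbedding then bv v.toNat / (M : ℂ) else 0) *
      (ψ (((u : ℤ) : ℝ) * ((v : ℤ) : ℝ) / X) : ℂ) *
      (dv a d u v - 1 / ((d ^ 2).totient : ℂ) * (if Int.gcd (u * v) d = 1 then 1 else 0)) := by
  rw [tsum_dy hU hV (fun u v => ((d : ℤ) ^ 2 ∣ ((u * v : ℕ) : ℤ) - a)) (fun u v => au u * bv v * (ψ (((u * v : ℕ) : ℝ) / X) : ℂ)), tsum_dy hU hV (fun u v => Nat.gcd (u * v) (d ^ 2) = 1) (fun u v => au u * bv v * (ψ (((u * v : ℕ) : ℝ) / X) : ℂ))]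
  have hM0 : (M : ℂ) ≠ 0 := by exact_mod_cast hM.ne'
  rw [Finset.mul_sum, Finset.mul_sum, ← Finset.sum_sub_distrib, Finset.sum_map]
  refine Finset.sum_congr rfl fun u hu => ?_
  rw [Finset.mul_sum, Finset.mul_sum, ← Finset.sum_sub_distrib, Finset.sum_map]
  refine Finset.sum_congr rfl fun v hv => ?_
  rw [if_pos (Finset.mem_map_of_mem _ hu), if_pos (Finset.mem_map_of_mem _ hv)]
  have e1 : ((d : ℤ) ^ 2 ∣ ((u * v : ℕ) : ℤ) - a) ↔ (((d ^ 2 : ℕ) : ℤ) ∣ (u : ℤ) * v - a) := by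
    push_cast; rfl
  have e2 : Nat.gcd (u * v) (d ^ 2) = 1 ↔ Int.gcd ((u : ℤ) * v) d = 1 := by
    have : Int.gcd ((u : ℤ) * v) d = Nat.gcd (u * v) d := by
      rw [← Int.gcd_natCast_natCast]; push_cast; rfl
    rw [this]
    exact Nat.coprime_pow_right_iff (by norm_num) _ _
  have e3 : Nat.castEmbedding (R := ℤ) u = (u : ℤ) := rfl
  have e4 : Nat.castEmbedding (R := ℤ) v = (v : ℤ) := rfl
  rw [e3, e4]
  unfold dv
  simp only [e1, e2, Int.toNat_natCast]
  have e5 : (((u : ℤ) : ℝ) * ((v : ℤ) : ℝ)) = ((u * v : ℕ) : ℝ) := by push_cast; rfl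
  rw [e5]
  push_cast
  split_ifs <;> field_simp <;> ring

end

/-- **Type II estimate on average** (Merikoski, Proposition 4). -/
theorem type_II_estimate_on_average (a : ℤ) (ha : a ≠ 0) (ε : ℝ) (hε : 0 < ε)
    (ψ : ℝ → ℝ) (hψsmooth : ContDiff ℝ (⊤ : ℕ∞) ψ)
    (hψ01 : ∀ x, 0 ≤ ψ x ∧ ψ x ≤ 1)
    (hψsupp : ∀ x, x ∉ Set.Icc (1 : ℝ) 2 → ψ x = 0)
    (σ : ℝ) (hσ : 2 * varpi < σ) (hσε : 19 * σ + 90 * varpi + 71 * ε < 1)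
    (C : ℝ) (hC : 0 < C) :
    ∃ η : ℝ, 0 < η ∧ ∃ X₀ : ℝ, 2 ≤ X₀ ∧ ∃ C' : ℝ, 0 < C' ∧ ∀ X ≥ X₀, ∀ U V : ℝ,
      U * V = X → X ^ ((1 : ℝ) / 2 - σ) ≤ U → U ≤ X ^ ((1 : ℝ) / 2 - 2 * varpi - ε) →
      ∀ au bv : ℕ → ℂ,
        (∀ u : ℕ, ‖au u‖ ≤ (u.divisors.card : ℝ) ^ C) →
        (∀ v : ℕ, ‖bv v‖ ≤ (v.divisors.card : ℝ) ^ C) →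
        (∑' d : ℕ, Set.indicator (frakD ε X) (fun d : ℕ =>
          ‖(∑' u : ℕ, ∑' v : ℕ,
              if U < (u : ℝ) ∧ (u : ℝ) ≤ 2 * U ∧ V < (v : ℝ) ∧ (v : ℝ) ≤ 2 * V ∧
                  ((d : ℤ) ^ 2 ∣ ((u * v : ℕ) : ℤ) - a)
                then au u * bv v * (ψ (((u * v : ℕ) : ℝ) / X) : ℂ) else 0) -
            (1 / (Nat.totient (d ^ 2) : ℝ) : ℂ) *
              ∑' u : ℕ, ∑' v : ℕ,
                if U < (u : ℝ) ∧ (u : ℝ) ≤ 2 * U ∧ V < (v : ℝ) ∧ (v : ℝ) ≤ 2 * V ∧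
                    Nat.gcd (u * v) (d ^ 2) = 1
                  then au u * bv v * (ψ (((u * v : ℕ) : ℝ) / X) : ℂ) else 0‖) d) ≤
          C' * bigD X ^ (-(1 : ℝ) / 2) * X ^ (1 - η) := by
  obtain ⟨Lp, hLp0, hLp⟩ := psi_lip hψsmooth hψsupp
  have hw : varpi = 1 / 1400 := rfl
  have hε1 : ε < 1 / 71 := by rw [hw] at hσ hσε; linarith
  set K := bigK ε with hK
  have hK1 : 1 / ε ≤ (K : ℝ) := Nat.le_ceil _
  have hK2 : (K : ℝ) < 1 / ε + 1 := Nat.ceil_lt_add_one (by positivity)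
  have hie : 1 < 1 / ε := by rw [lt_div_iff₀ hε]; linarith
  have hK0 : 0 < (K : ℝ) := by linarith
  have heK : 1 ≤ ε * K := by
    have := mul_le_mul_of_nonneg_left hK1 hε.le
    rwa [mul_one_div_cancel hε.ne'] at this
  have heK2 : ε * K ≤ 2 := by
    have := mul_le_mul_of_nonneg_left hK2.le hε.le
    rw [mul_add, mul_one_div_cancel hε.ne'] at this
    linarith
  set κ := (1 / 4 + varpi) / K with hκ
  have hκK : (K : ℝ) * κ = 1 / 4 + varpi := by rw [hκ]; field_simp
  have hw0 : (0 : ℝ) < 1 / 4 + varpi := by rw [hw]; norm_num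
  have hκ0 : 0 < κ := by positivity
  have hκ1 : κ ≤ ε * (1 / 4 + varpi) := by
    rw [hκ, div_le_iff₀ hK0]; nlinarith
  have hκ2 : ε / 8 ≤ κ := by
    rw [hκ, le_div_iff₀ hK0, hw]; linarith
  set μ := ε / 1000 with hμ
  have hμ0 : 0 < μ := by positivity
  have hev := (ev_ge hκ0 2).and ((ev_ge hκ0 |(a : ℝ)|).and ((ev_ge hκ0 (2 * (K : ℝ))).and
    ((ev_ge hμ0 (1000000 * (cK K ^ (20 + K) * 2 ^ K * K))).and ((ev_ge hμ0 Lp).and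
    ((ev_log hμ0).and ((ev_tau one_pos hμ0).and (ev_tau hC hμ0)))))))
  obtain ⟨X₁, hX₁⟩ := Filter.eventually_atTop.1 hev
  refine ⟨10 * μ, by positivity, max 2 X₁, le_max_left _ _, 1, one_pos, ?_⟩
  intro X hX U V hUV hU1 hU2 au bv hau hbv
  have hX2 : 2 ≤ X := le_trans (le_max_left _ _) hX
  obtain ⟨c1, c2, c3, c4, c5, c6, c7, c8⟩ := hX₁ X (le_trans (le_max_right _ _) hX)
  have hX0 : 0 < X := by linarith
  have hX1 : 1 ≤ X := by linarith
  have g : GP ε σ X κ μ (X ^ κ) K := ⟨hε, rfl, hσ, hσε, hX1, hκK, hκ1, hκ2, rfl, c1, c4,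
    fun n hn hnX => by simpa using c7 n hn hnX, c6⟩
  set Y := X ^ κ with hY
  have hY0 : 0 < Y := by positivity
  have hPY : bigP ε X ^ ((1 : ℝ) / 2) = Y := by
    unfold bigP bigD
    rw [← hK, ← Real.rpow_mul hX0.le, ← Real.rpow_mul hX0.le, hY, hκ]
    congr 1
    field_simp
    ring
  have hDY : bigD X ^ (-(1 : ℝ) / 2) = 1 / Y ^ K := by
    unfold bigD
    rw [g.Yp, ← Real.rpow_mul hX0.le, mul_comm κ, hκK, one_div (X ^ (1 / 4 + varpi)), ← Real.rpow_neg hX0.le]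
    congr 1
    ring
  -- the exponent of U
  have hU0 : 0 < U := lt_of_lt_of_le (by positivity) hU1
  have hV0 : 0 < V := by
    by_contra h
    have := mul_nonpos_of_nonneg_of_nonpos hU0.le (not_lt.1 h)
    linarith
  have hlX : 0 < Real.log X := Real.log_pos (by linarith)
  set s := 1 / 2 - Real.log U / Real.log X with hs
  have hU : U = X ^ (1 / 2 - s) := by
    rw [hs, sub_sub_cancel, Real.rpow_def_of_pos hX0, mul_div_cancel₀ _ hlX.ne', Real.exp_log hU0]
  have hV : V = X ^ (1 / 2 + s) := by
    have h1 : U * X ^ (1 / 2 + s) = X := by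
      rw [hU, ← Real.rpow_add hX0]
      have : 1 / 2 - s + (1 / 2 + s) = 1 := by ring
      rw [this, Real.rpow_one]
    exact mul_left_cancel₀ hU0.ne' (hUV.trans h1.symm)
  have hX1' : 1 < X := by linarith
  have hs2 : s ≤ σ := by
    rw [hU, Real.rpow_le_rpow_left_iff hX1'] at hU1; linarith
  have hs1 : 2 * varpi + ε ≤ s := by
    rw [hU, Real.rpow_le_rpow_left_iff hX1'] at hU2; linarith
  have hs3 : s ≤ 1 / 2 := by rw [hw] at hσε; linarith
  have hs0 : 0 ≤ s := by rw [hw] at hs1; linarith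
  have hUX : U ≤ X := by
    rw [hU]; nth_rewrite 2 [← Real.rpow_one X]; exact g.mono (by linarith)
  have hVX : V ≤ X := by
    rw [hV]; nth_rewrite 2 [← Real.rpow_one X]; exact g.mono (by linarith)
  have hXX : 2 * X ≤ X ^ (2 : ℝ) := by
    rw [Real.rpow_two]; nlinarith
  set M := X ^ μ with hM
  have hM0 : 0 < M := by positivity
  have bd : ∀ (W : ℝ), 0 < W → W ≤ X → ∀ (f : ℕ → ℂ), (∀ u : ℕ, ‖f u‖ ≤ (u.divisors.card : ℝ) ^ C) →
      ∀ u : ℤ, ‖(if u ∈ (Finset.Ioc ⌊W⌋₊ ⌊2 * W⌋₊).map Nat.castEmbedding then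
        f u.toNat / (M : ℂ) else 0)‖ ≤ 1 := by
    intro W hW hWX f hf u
    split_ifs with h
    · obtain ⟨n, hn, rfl⟩ := Finset.mem_map.1 h
      rw [mem_dy hW.le] at hn
      have e3 : Nat.castEmbedding (R := ℤ) n = (n : ℤ) := rfl
      rw [e3, Int.toNat_natCast, norm_div, Complex.norm_real, Real.norm_of_nonneg hM0.le,
        div_le_one hM0]
      have hn0 : (0 : ℝ) < n := by linarith
      exact (hf n).trans (c8 n (by exact_mod_cast hn0) (by linarith))
    · simp
  have mm : ∀ (W : ℝ), 0 < W → ∀ u ∈ (Finset.Ioc ⌊W⌋₊ ⌊2 * W⌋₊).map (Nat.castEmbedding (R := ℤ)),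
      W < (u : ℝ) ∧ (u : ℝ) ≤ 2 * W := by
    intro W hW u hu
    obtain ⟨n, hn, rfl⟩ := Finset.mem_map.1 hu
    rw [mem_dy hW.le] at hn
    have e3 : Nat.castEmbedding (R := ℤ) n = (n : ℤ) := rfl
    rw [e3]; exact_mod_cast hn
  have F := g.final hs1 hs2 hU hV ha c2 c3 hψ01 hLp0 hLp c5 (mm U hU0) (mm V hV0)
    (bd U hU0 hUX au hau) (bd V hV0 hVX bv hbv)
  rw [frakD_eq hPY hY0]
  rw [tsum_eq_sum (s := DJ Y (Finset.range (bigK ε))) (fun d hd => Set.indicator_of_notMem (by simpa using hd) _)]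
  rw [← hK]
  have F2 := mul_le_mul_of_nonneg_left F (show 0 ≤ M * M by positivity)
  rw [Finset.mul_sum] at F2
  refine le_trans (le_trans (le_of_eq (Finset.sum_congr rfl fun d hd => ?_)) F2) ?_
  · rw [Set.indicator_of_mem (Finset.mem_coe.2 hd), nat_to_int_sum hU0.le hV0.le hM0 a d ψ au bv,
      norm_mul, Complex.norm_real, Real.norm_of_nonneg (by positivity)]
  rw [hDY, hM, g.add]
  have e : X = X ^ (1 : ℝ) := (Real.rpow_one X).symm
  have e6 : X ^ (μ + μ) * (X / Y ^ K * X ^ (-(ε / 50) + 4 * μ)) =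
      1 / Y ^ K * (X ^ (μ + μ) * (X ^ (1 : ℝ) * X ^ (-(ε / 50) + 4 * μ))) := by
    rw [Real.rpow_one]; ring
  rw [e6, g.add, g.add, one_mul]
  refine mul_le_mul_of_nonneg_left (g.mono ?_) (by positivity)
  rw [hμ]; linarith
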